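/- arXiv:2603.14234 — 4 statements merged into one kernel-verified Lean document; each statement's English description precedes it below -/
import Mathlib

section
/- There are infinitely many primes p with p ≡ 7 (mod 12) such that the group of F_p-rational points of the reduction of E modulo p contains no element of order 2 (equivalently, such that #E(F_p) is odd, i.e. the trace of Frobenius a_p = p + 1 − #E(F_p) is odd). -/
/-- The reduction modulo `p` of the elliptic curve `E : y² + y = x³ + 2` (of conductor 243),
as a Weierstrass curve over `ZMod p`. -/
def Ecurve (p : ℕ) : WeierstrassCurve.Affine (ZMod p) :=
  { a₁ := 0, a₂ := 0, a₃ := 1, a₄ := 0, a₆ := 2 }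


open NumberField

open ArithmeticFunction.vonMangoldt in
lemma LSeries_real_eq_tsum (g : ℕ → ℝ) (h0 : g 0 = 0) (x : ℝ) :
    LSeries (fun n => (g n : ℂ)) x = ((∑' n, g n / (n : ℝ) ^ x : ℝ) : ℂ) := by
  rw [LSeries, Complex.ofReal_tsum]
  congr 1
  ext n
  rcases eq_or_ne n 0 with rfl | hn
  · simp [h0]
  · rw [LSeries.term_of_ne_zero hn]
    push_cast
    rw [Complex.ofReal_cpow (Nat.cast_nonneg _)]
    simp

/-- indicator of the primes in a residue class -/
noncomputable def pind {q : ℕ} (a : ZMod q) (n : ℕ) : ℝ :=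
  if n.Prime ∧ (n : ZMod q) = a then 1 else 0

lemma pind_abs {q : ℕ} (a : ZMod q) :
    LSeries.abscissaOfAbsConv (fun n => (pind a n : ℂ)) ≤ 1 := by
  apply LSeries.abscissaOfAbsConv_le_one_of_isBigO_one
  apply Asymptotics.IsBigO.of_bound 1
  refine Filter.Eventually.of_forall fun n => ?_
  unfold pind
  split_ifs <;> simp

lemma pind_summable {q : ℕ} (a : ZMod q) {x : ℝ} (hx : 1 < x) :
    Summable fun n : ℕ => pind a n / (n : ℝ) ^ x :=
  LSeries.summable_real_of_abscissaOfAbsConv_lt <| (pind_abs a).trans_lt (mod_cast hx)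

open ArithmeticFunction.vonMangoldt in
lemma prime_log_sum_lower {q : ℕ} [NeZero q] {a : ZMod q} (ha : IsUnit a) :
    ∃ C : ℝ, ∀ x ∈ Set.Ioc (1 : ℝ) 2,
      (q.totient : ℝ)⁻¹ / (x - 1) - C ≤ ∑' n : ℕ, (Real.log n * pind a n) / (n : ℝ) ^ x := by
  obtain ⟨C, hC⟩ := LSeries_residueClass_lower_bound ha
  have hs := summable_residueClass_non_primes_div a
  refine ⟨C + ∑' n : ℕ, (if n.Prime then 0 else residueClass a n) / (n : ℝ), fun x hx => ?_⟩
  have h1 := hC hx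
  have hsx : Summable fun n : ℕ => residueClass a n / (n : ℝ) ^ x :=
    LSeries.summable_real_of_abscissaOfAbsConv_lt <|
        (abscissaOfAbsConv_residueClass_le_one a).trans_lt <| mod_cast hx.1
  have hle : ∀ n : ℕ, (if n.Prime then 0 else residueClass a n) / (n : ℝ) ^ x ≤
      (if n.Prime then 0 else residueClass a n) / (n : ℝ) := by
    intro n
    rcases n.eq_zero_or_pos with rfl | hn
    · simp
    · refine div_le_div_of_nonneg_left ?_ (mod_cast hn) ?_
      · split_ifs
        · exact le_rfl
        · exact residueClass_nonneg a _
      · conv_lhs => rw [← Real.rpow_one n]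
        exact Real.rpow_le_rpow_of_exponent_le (by norm_cast) hx.1.le
  have hnn : ∀ n : ℕ, 0 ≤ (if n.Prime then 0 else residueClass a n) / (n : ℝ) ^ x := by
    intro n
    apply div_nonneg _ (by positivity)
    split_ifs
    · exact le_rfl
    · exact residueClass_nonneg a _
  have hs2 := Summable.of_nonneg_of_le hnn hle hs
  have h2 := Summable.tsum_le_tsum hle hs2 hs
  have h3 : ∑' n : ℕ, (Real.log n * pind a n) / (n : ℝ) ^ x =
      ∑' n, residueClass a n / (n : ℝ) ^ x -
        ∑' n : ℕ, (if n.Prime then 0 else residueClass a n) / (n : ℝ) ^ x := by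
    rw [← hsx.tsum_sub hs2]
    congr 1
    ext n
    by_cases hp : n.Prime
    · by_cases hn : (n : ZMod q) = a
      · simp [pind, hp, hn, residueClass, ArithmeticFunction.vonMangoldt_apply_prime hp]
      · simp [pind, hp, hn, residueClass]
    · simp [pind, hp]
  linarith

lemma prime_sum_lower {q : ℕ} [NeZero q] {a : ZMod q} (ha : IsUnit a) :
    ∃ C : ℝ, ∀ x ∈ Set.Ioc (1 : ℝ) 2,
      -(q.totient : ℝ)⁻¹ * Real.log (x - 1) - C ≤ ∑' n : ℕ, pind a n / (n : ℝ) ^ x := by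
  obtain ⟨C, hC⟩ := prime_log_sum_lower ha
  set c := (q.totient : ℝ)⁻¹ with hc
  have hp0 : pind a 0 = 0 := by simp [pind, Nat.not_prime_zero]
  have hd : ∀ x ∈ Set.Ioc (1 : ℝ) 2, HasDerivAt (fun x : ℝ => ∑' n : ℕ, pind a n / (n : ℝ) ^ x)
      (-∑' n : ℕ, (Real.log n * pind a n) / (n : ℝ) ^ x) x := by
    intro x hx
    have h1 : HasDerivAt (LSeries fun n => (pind a n : ℂ)) _ (x : ℂ) :=
      LSeries_hasDerivAt (s := (x : ℂ)) ((pind_abs a).trans_lt (by simpa using mod_cast hx.1))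
    have h2 := h1.real_of_complex
    convert! h2 using 1
    · ext y
      rw [LSeries_real_eq_tsum _ hp0, Complex.ofReal_re]
    · have : LSeries.logMul (fun n => (pind a n : ℂ)) =
        fun n : ℕ => ((Real.log n * pind a n : ℝ) : ℂ) := by
        ext n
        simp [LSeries.logMul, Complex.ofReal_log]
      rw [this, LSeries_real_eq_tsum (fun n : ℕ => Real.log n * pind a n) (by simp), Complex.neg_re, Complex.ofReal_re]
  have hd2 : ∀ x ∈ Set.Ioc (1 : ℝ) 2, HasDerivAt
      (fun x : ℝ => ∑' n : ℕ, pind a n / (n : ℝ) ^ x + c * Real.log (x - 1) - C * x)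
      (-∑' n : ℕ, (Real.log n * pind a n) / (n : ℝ) ^ x + c * (1 / (x - 1)) - C * 1) x := by
    intro x hx
    refine ((hd x hx).add (HasDerivAt.const_mul c ?_)).sub ((hasDerivAt_id x).const_mul C)
    exact ((hasDerivAt_id x).sub_const 1).log (by have := hx.1; simp; linarith)
  have hanti := antitoneOn_of_deriv_nonpos (convex_Ioc (1 : ℝ) 2)
    (fun x hx => (hd2 x hx).continuousAt.continuousWithinAt)
    (fun x hx => (hd2 x (interior_subset hx)).differentiableAt.differentiableWithinAt)
    (fun x hx => by
      rw [(hd2 x (interior_subset hx)).deriv]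
      have := hC x (interior_subset hx)
      rw [mul_one_div]
      linarith)
  refine ⟨|C|, fun x hx => ?_⟩
  have h := hanti hx (Set.right_mem_Ioc.mpr one_lt_two) hx.2
  have hnn : 0 ≤ ∑' n : ℕ, pind a n / (n : ℝ) ^ (2 : ℝ) := tsum_nonneg fun n => by
    unfold pind
    split_ifs <;> positivity
  simp only at h
  rw [show (2 : ℝ) - 1 = 1 by norm_num, Real.log_one] at h
  have : C * (2 - x) ≤ |C| := by
    have h1 := le_abs_self C
    have h2 := abs_nonneg C
    have := hx.1
    have := hx.2
    nlinarith
  linarith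

lemma LSeries_real_eq_tsum' (g : ℕ → ℝ) (x : ℝ) (hx : x ≠ 0) :
    LSeries (fun n => (g n : ℂ)) x = ((∑' n, g n / (n : ℝ) ^ x : ℝ) : ℂ) := by
  rw [LSeries, Complex.ofReal_tsum]
  congr 1
  ext n
  rcases eq_or_ne n 0 with rfl | hn
  · simp [Real.zero_rpow hx]
  · rw [LSeries.term_of_ne_zero hn]
    push_cast
    rw [Complex.ofReal_cpow (Nat.cast_nonneg _)]
    simp

/-- number of ideals of given norm -/
noncomputable def cK (K : Type*) [Field K] [NumberField K] (n : ℕ) : ℝ :=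
  (Nat.card {I : Ideal (𝓞 K) // Ideal.absNorm I = n} : ℝ)

lemma cK_bound (K : Type*) [Field K] [NumberField K] :
    ∃ C : ℝ, 0 < C ∧ ∃ ε : ℝ, 0 < ε ∧ ∀ x : ℝ, 1 < x → x < 1 + ε →
      (Summable fun n : ℕ => cK K n / (n : ℝ) ^ x) ∧
      ∑' n : ℕ, cK K n / (n : ℝ) ^ x ≤ C / (x - 1) := by
  have h := tendsto_sub_one_mul_dedekindZeta_nhdsGT K
  have hr := dedekindZeta_residue_pos K
  have h' : Filter.Tendsto (fun x : ℝ => (x - 1) * ∑' n : ℕ, cK K n / (n : ℝ) ^ x)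
      (nhdsWithin 1 (Set.Ioi 1)) (nhds (dedekindZeta_residue K)) := by
    have := (Complex.continuous_re.tendsto _).comp h
    rw [Complex.ofReal_re] at this
    refine this.congr' ?_
    filter_upwards [self_mem_nhdsWithin] with x hx
    have hx0 : x ≠ 0 := by have : 1 < x := hx; linarith
    have h2 : dedekindZeta K x = ((∑' n, cK K n / (n : ℝ) ^ x : ℝ) : ℂ) := by
      rw [← LSeries_real_eq_tsum' (cK K) x hx0, dedekindZeta]
      simp [cK]
    rw [Function.comp_apply, h2, ← Complex.ofReal_one, ← Complex.ofReal_sub, ← Complex.ofReal_mul,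
      Complex.ofReal_re]
  have h1 := h'.eventually (lt_mem_nhds hr)
  have h2 := h'.eventually (gt_mem_nhds (lt_add_one (dedekindZeta_residue K)))
  obtain ⟨u, hu, hu2⟩ := mem_nhdsGT_iff_exists_Ioo_subset.mp (h1.and h2)
  refine ⟨dedekindZeta_residue K + 1, by linarith, u - 1, by simpa using hu, fun x hx1 hx2 => ?_⟩
  obtain ⟨ha, hb⟩ := hu2 ⟨hx1, by linarith⟩
  have hx : 0 < x - 1 := by linarith
  constructor
  · by_contra hns
    rw [tsum_eq_zero_of_not_summable hns] at ha
    simp at ha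
  · rw [le_div_iff₀ hx]
    linarith

lemma sum_ideals_le (K : Type*) [Field K] [NumberField K] (x : ℝ)
    (hs : Summable fun n : ℕ => cK K n / (n : ℝ) ^ x) (U : Finset (Ideal (𝓞 K))) :
    ∑ I ∈ U, ((Ideal.absNorm I : ℝ) ^ x)⁻¹ ≤ ∑' n : ℕ, cK K n / (n : ℝ) ^ x := by
  classical
  rw [← Finset.sum_fiberwise_of_maps_to (g := fun I => Ideal.absNorm I)
    (fun i hi => Finset.mem_image_of_mem _ hi)]
  refine le_trans (Finset.sum_le_sum fun n hn => ?_)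
    (hs.sum_le_tsum (U.image fun I => Ideal.absNorm I) fun n _ => by unfold cK; positivity)
  rw [Finset.sum_congr rfl (g := fun _ => ((n : ℝ) ^ x)⁻¹)
    (fun I hI => by rw [(Finset.mem_filter.mp hI).2])]
  rw [Finset.sum_const, nsmul_eq_mul, div_eq_mul_inv]
  refine mul_le_mul_of_nonneg_right ?_ (by positivity)
  unfold cK
  norm_cast
  have hf := Ideal.finite_setOfPred_absNorm_eq (S := 𝓞 K) n
  change _ ≤ Nat.card {I : Ideal (𝓞 K) | Ideal.absNorm I = n}
  rw [Nat.card_coe_set_eq, ← Set.ncard_coe_finset]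
  apply Set.ncard_le_ncard _ hf
  intro I hI
  simp at hI
  exact hI.2

lemma prod_primes_le (K : Type*) [Field K] [NumberField K] (x : ℝ)
    (hs : Summable fun n : ℕ => cK K n / (n : ℝ) ^ x) (T : Finset (Ideal (𝓞 K)))
    (hT : ∀ I ∈ T, Prime I) :
    ∏ I ∈ T, (1 + ((Ideal.absNorm I : ℝ) ^ x)⁻¹) ≤ ∑' n : ℕ, cK K n / (n : ℝ) ^ x := by
  classical
  rw [Finset.prod_one_add]
  have hinj : Set.InjOn (fun U : Finset (Ideal (𝓞 K)) => ∏ I ∈ U, I) T.powerset := by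
    intro U hU V hV h
    have key : ∀ W ∈ T.powerset, UniqueFactorizationMonoid.normalizedFactors (∏ I ∈ W, I) = W.val := by
      intro W hW
      have := UniqueFactorizationMonoid.normalizedFactors_prod_of_prime (m := W.val)
        (fun I hI => hT I (Finset.mem_powerset.mp hW hI))
      rw [Finset.prod_val] at this
      exact this
    apply Finset.val_injective
    rw [← key U hU, ← key V hV]
    exact congrArg _ h
  refine le_trans (le_of_eq ?_) (sum_ideals_le K x hs (T.powerset.image fun U => ∏ I ∈ U, I))
  rw [Finset.sum_image hinj]
  refine Finset.sum_congr rfl fun U hU => ?_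
  rw [map_prod, Nat.cast_prod, ← Real.finsetProd_rpow _ _ (fun _ _ => Nat.cast_nonneg _),
    Finset.prod_inv_distrib]

lemma sum_primes_le (K : Type*) [Field K] [NumberField K] :
    ∃ C : ℝ, ∃ ε : ℝ, 0 < ε ∧ ∀ x : ℝ, 1 < x → x < 1 + ε →
      ∀ T : Finset (Ideal (𝓞 K)), (∀ I ∈ T, Prime I) →
      ∑ I ∈ T, ((Ideal.absNorm I : ℝ) ^ x)⁻¹ ≤ - Real.log (x - 1) + C := by
  obtain ⟨C, hC, ε, hε, h⟩ := cK_bound K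
  set x0 : ℝ := 1 + min (ε / 2) 1 with hx0
  have hm : 0 < min (ε / 2) 1 := by positivity
  have hm1 := min_le_left (ε / 2) 1
  have hm2 := min_le_right (ε / 2) 1
  have h0 := (h x0 (by linarith) (by linarith)).1
  refine ⟨Real.log C + ∑' n : ℕ, cK K n / (n : ℝ) ^ x0, ε, hε, fun x hx1 hx2 T hT => ?_⟩
  obtain ⟨hs, hle⟩ := h x hx1 hx2
  have h1 := (prod_primes_le K x hs T hT).trans hle
  have hN : ∀ I ∈ T, 1 ≤ (Ideal.absNorm I : ℝ) := by
    intro I hI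
    have : Ideal.absNorm I ≠ 0 := by
      rw [Ne, Ideal.absNorm_eq_zero_iff]
      exact (hT I hI).ne_zero
    exact_mod_cast Nat.one_le_iff_ne_zero.mpr this
  have hlog : ∑ I ∈ T, Real.log (1 + ((Ideal.absNorm I : ℝ) ^ x)⁻¹) ≤
      Real.log C - Real.log (x - 1) := by
    rw [← Real.log_prod, ← Real.log_div hC.ne' (by linarith)]
    · refine Real.log_le_log (Finset.prod_pos fun I hI => ?_) h1
      positivity
    · intro I hI
      positivity
  have hsq := sum_ideals_le K x0 h0 T
  have : ∀ I ∈ T, ((Ideal.absNorm I : ℝ) ^ x)⁻¹ ≤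
      Real.log (1 + ((Ideal.absNorm I : ℝ) ^ x)⁻¹) + ((Ideal.absNorm I : ℝ) ^ x0)⁻¹ := by
    intro I hI
    have hN1 := hN I hI
    generalize (Ideal.absNorm I : ℝ) = N at hN1 ⊢
    have hu : 0 < (N ^ x)⁻¹ := by positivity
    have hu2 : (N ^ x)⁻¹ * (N ^ x)⁻¹ ≤ (N ^ x0)⁻¹ := by
      rw [← mul_inv, ← Real.rpow_add (by linarith)]
      gcongr
      linarith
    have hl := Real.one_sub_inv_le_log_of_pos (x := 1 + (N ^ x)⁻¹) (by linarith)
    have : (N ^ x)⁻¹ - (N ^ x)⁻¹ * (N ^ x)⁻¹ ≤ 1 - (1 + (N ^ x)⁻¹)⁻¹ := by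
      generalize (N ^ x)⁻¹ = u at hu
      rw [← sub_nonneg]
      have : 1 - (1 + u)⁻¹ - (u - u * u) = u ^ 3 / (1 + u) := by field_simp; ring
      rw [this]
      positivity
    linarith
  have := Finset.sum_le_sum this
  rw [Finset.sum_add_distrib] at this
  linarith

open Polynomial in
lemma ideals_of_roots (K : Type*) [Field K] [NumberField K] (θ : 𝓞 K)
    (hm : minpoly ℤ θ = X ^ 3 - C 18) (p : ℕ) [Fact p.Prime]
    (hp : ¬ p ∣ RingOfIntegers.exponent θ) (R : Finset (ZMod p)) (hR : ∀ r ∈ R, r ^ 3 = 18) :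
    ∃ T : Finset (Ideal (𝓞 K)), T.card = R.card ∧ ∀ I ∈ T, Prime I ∧ Ideal.absNorm I = p := by
  classical
  have h0 : Polynomial.map (Int.castRingHom (ZMod p)) (minpoly ℤ θ) ≠ 0 :=
    map_monic_ne_zero (minpoly.monic θ.isIntegral)
  have hmem : ∀ r ∈ R, (X - C r : (ZMod p)[X]) ∈ RingOfIntegers.monicFactorsMod θ p := by
    intro r hr
    rw [Multiset.mem_toFinset, Polynomial.mem_normalizedFactors_iff h0]
    refine ⟨irreducible_X_sub_C r, monic_X_sub_C r, ?_⟩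
    rw [dvd_iff_isRoot, hm]
    simp [hR r hr]
  let f : R → Ideal (𝓞 K) := fun r =>
    ((NumberField.Ideal.primesOverSpanEquivMonicFactorsMod hp).symm ⟨X - C r.1, hmem r.1 r.2⟩)
  have hf : Function.Injective f := by
    intro r s h
    have := (NumberField.Ideal.primesOverSpanEquivMonicFactorsMod hp).symm.injective
      (Subtype.ext h)
    have h2 : (X - C r.1 : (ZMod p)[X]) = X - C s.1 := congrArg Subtype.val this
    apply Subtype.ext
    simpa using h2
  refine ⟨Finset.univ.image f, ?_, ?_⟩
  · rw [Finset.card_image_of_injective _ hf]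
    simp
  · intro I hI
    obtain ⟨r, -, rfl⟩ := Finset.mem_image.mp hI
    have hd := NumberField.Ideal.inertiaDeg_primesOverSpanEquivMonicFactorsMod_symm_apply' hp
      (hmem r.1 r.2)
    have hP := ((NumberField.Ideal.primesOverSpanEquivMonicFactorsMod hp).symm
      ⟨X - C r.1, hmem r.1 r.2⟩).2
    change (f r).inertiaDeg ℤ = _ at hd
    change f r ∈ _ at hP
    have i1 : (f r).IsPrime := hP.1
    have i2 : (f r).LiesOver (Ideal.span {(p : ℤ)}) := hP.2
    have hn := Ideal.pow_inertiaDeg p (f r)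
    rw [hd, natDegree_X_sub_C, pow_one] at hn
    refine ⟨Ideal.prime_of_isPrime ?_ i1, hn.symm⟩
    intro hb
    rw [hb] at hn
    simp at hn
    exact (Fact.out : p.Prime).ne_zero hn

lemma not_cube_rat (b : ℚ) : b ^ 3 ≠ 18 := by
  intro h
  have h1 : padicValRat 2 (b ^ 3) = 3 * padicValRat 2 b := by
    rw [padicValRat.pow]
    norm_num
  have h2 : padicValRat 2 (18 : ℚ) = 1 := by
    have : padicValNat 2 18 = 1 := by
      rw [show 18 = 2 * 9 by norm_num, padicValNat.mul (by norm_num) (by norm_num),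
        padicValNat_self, padicValNat.eq_zero_of_not_dvd (by norm_num)]
    have h3 := padicValRat.of_nat (p := 2) (n := 18)
    rw [this] at h3
    exact_mod_cast h3
  rw [h, h2] at h1
  omega

open Polynomial in
lemma exists_cubic_field : ∃ (K : Type) (_ : Field K) (_ : NumberField K) (θ : 𝓞 K),
    minpoly ℤ θ = X ^ 3 - C 18 ∧ RingOfIntegers.exponent θ ≠ 0 := by
  have hirr : Irreducible (X ^ 3 - C 18 : ℚ[X]) :=
    X_pow_sub_C_irreducible_of_prime Nat.prime_three not_cube_rat
  have : Fact (Irreducible (X ^ 3 - C 18 : ℚ[X])) := ⟨hirr⟩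
  let K := AdjoinRoot (X ^ 3 - C 18 : ℚ[X])
  let B : PowerBasis ℚ K := AdjoinRoot.powerBasis hirr.ne_zero
  have : FiniteDimensional ℚ K := B.finite
  have : NumberField K := { to_charZero := inferInstance, to_finiteDimensional := inferInstance }
  have hgen : B.gen ^ 3 = 18 := by
    have h := AdjoinRoot.eval₂_root (X ^ 3 - C 18 : ℚ[X])
    simp only [eval₂_sub, eval₂_pow, eval₂_X, map_ofNat, eval₂_ofNat] at h
    exact sub_eq_zero.mp h
  have hInteg : IsIntegral ℤ B.gen := by
    refine ⟨X ^ 3 - C 18, monic_X_pow_sub_C _ (by norm_num), ?_⟩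
    simp [hgen]
  let θ : 𝓞 K := ⟨B.gen, hInteg⟩
  have hminQ : minpoly ℚ B.gen = X ^ 3 - C 18 := by
    symm
    apply minpoly.eq_of_irreducible_of_monic hirr
    · simp [hgen]
    · exact monic_X_pow_sub_C _ (by norm_num)
  refine ⟨K, inferInstance, inferInstance, θ, ?_, ?_⟩
  · have h1 : minpoly ℤ θ = minpoly ℤ B.gen :=
      (minpoly.algebraMap_eq (B := 𝓞 K) (B' := K) RingOfIntegers.coe_injective θ).symm
    have h2 := minpoly.isIntegrallyClosed_eq_field_fractions' ℚ hInteg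
    rw [h1]
    apply Polynomial.map_injective (algebraMap ℤ ℚ) (algebraMap ℤ ℚ).injective_int
    rw [← h2, hminQ]
    simp
    exact map_ofNat C 18
  · obtain ⟨d, hd⟩ : ∃ d : ℤ, (d : ℚ) = Algebra.discr ℚ B.basis := by
      have : IsIntegral ℤ (Algebra.discr ℚ B.basis) :=
        Algebra.discr_isIntegral ℚ fun i => by rw [B.basis_eq_pow]; exact hInteg.pow _
      exact IsIntegrallyClosed.isIntegral_iff.mp this
    have hd0 : d ≠ 0 := by
      rintro rfl
      exact Algebra.discr_not_zero_of_basis ℚ B.basis (by rw [← hd]; simp)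
    have hc : (d : 𝓞 K) ∈ conductor ℤ θ := by
      rw [mem_conductor_iff]
      intro b
      have h1 := Algebra.discr_mul_isIntegral_mem_adjoin ℚ hInteg (RingOfIntegers.isIntegral_coe b)
      rw [← hd] at h1
      have h2 : Algebra.adjoin ℤ {B.gen} =
          (Algebra.adjoin ℤ {θ}).map (IsScalarTower.toAlgHom ℤ (𝓞 K) K) := by
        rw [AlgHom.map_adjoin, Set.image_singleton]
        rfl
      rw [h2] at h1
      obtain ⟨y, hy, hy2⟩ := h1
      have : y = (d : 𝓞 K) * b := by
        apply RingOfIntegers.coe_injective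
        change (algebraMap (𝓞 K) K y) = _ at hy2
        rw [hy2, map_mul, Algebra.smul_def]
        simp
      rwa [← this]
    intro he
    unfold RingOfIntegers.exponent at he
    rw [Ideal.absNorm_eq_zero_iff] at he
    have : d ∈ Ideal.under ℤ (conductor ℤ θ) := by
      rw [Ideal.mem_comap]
      simpa using hc
    rw [he] at this
    exact hd0 (by simpa using this)

lemma cube_root_of_order_two {p : ℕ} [Fact p.Prime] (P : (Ecurve p).Point) (hP : addOrderOf P = 2) :
    ∃ r : ZMod p, r ^ 3 = 18 := by
  have h2 : (2 : ℕ) • P = 0 := by rw [← hP]; exact addOrderOf_nsmul_eq_zero P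
  have hne : P ≠ 0 := by
    rintro rfl
    simp at hP
  have hneg : P = -P := by
    rw [two_nsmul] at h2
    exact eq_neg_of_add_eq_zero_left h2
  rcases P with _ | ⟨x, y, h⟩
  · exact absurd rfl hne
  · rw [WeierstrassCurve.Affine.Point.neg_some] at hneg
    have hy : y = (Ecurve p).negY x y := by
      injection hneg
    have he := (WeierstrassCurve.Affine.equation_iff _ _).mp h.1
    simp only [WeierstrassCurve.Affine.negY, Ecurve] at hy he
    refine ⟨-2 * x, ?_⟩
    linear_combination 8 * he - (2 * (2 * y + 1)) * hy

lemma exists_cube_root {p : ℕ} [Fact p.Prime] (hp : p % 3 = 2) (a : ZMod p) :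
    ∃ r : ZMod p, r ^ 3 = a := by
  refine ⟨a ^ (2 * (p / 3) + 1), ?_⟩
  have h1 : (2 * (p / 3) + 1) * 3 = p + (p - 1) := by omega
  have h2 : 1 + (p - 1) = p := by omega
  calc (a ^ (2 * (p / 3) + 1)) ^ 3 = a ^ p * a ^ (p - 1) := by rw [← pow_mul, h1, pow_add]
    _ = a ^ (1 + (p - 1)) := by rw [ZMod.pow_card, pow_add, pow_one]
    _ = a := by rw [h2, ZMod.pow_card]

lemma three_cube_roots {p : ℕ} [hpf : Fact p.Prime] (hp : p % 12 = 7) (r : ZMod p) (hr : r ^ 3 = 18) :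
    ∃ R : Finset (ZMod p), R.card = 3 ∧ ∀ s ∈ R, s ^ 3 = 18 := by
  classical
  have hcard : 3 ∣ Fintype.card (ZMod p)ˣ := by
    rw [ZMod.card_units]
    omega
  have : Fact (Nat.Prime 3) := ⟨Nat.prime_three⟩
  obtain ⟨w, hw⟩ := exists_prime_orderOf_dvd_card 3 hcard
  have hw3 : w ^ 3 = 1 := by rw [← hw]; exact pow_orderOf_eq_one w
  have hw1 : w ≠ 1 := by
    rintro rfl
    simp at hw
  have hv3 : (w : ZMod p) ^ 3 = 1 := by rw [← Units.val_pow_eq_pow_val, hw3, Units.val_one]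
  have hv1 : (w : ZMod p) ≠ 1 := by simpa using hw1
  have hv0 : (w : ZMod p) ≠ 0 := w.ne_zero
  generalize (w : ZMod p) = v at hv3 hv1 hv0
  have h18 : (18 : ZMod p) ≠ 0 := by
    intro h
    have h' : ((18 : ℕ) : ZMod p) = 0 := by exact_mod_cast h
    rw [ZMod.natCast_eq_zero_iff] at h'
    have h'' : p ∣ 2 * 3 ^ 2 := by simpa using h'
    rcases (Nat.Prime.dvd_mul hpf.out).mp h'' with h | h
    · have := (Nat.prime_dvd_prime_iff_eq hpf.out Nat.prime_two).mp h
      omega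
    · have := (Nat.prime_dvd_prime_iff_eq hpf.out Nat.prime_three).mp (hpf.out.dvd_of_dvd_pow h)
      omega
  have hr0 : r ≠ 0 := by
    rintro rfl
    apply h18
    rw [← hr]
    simp
  have hv2 : v ^ 2 ≠ 1 := by
    intro h
    apply hv1
    calc v = v ^ 2 * v := by rw [h, one_mul]
      _ = 1 := by rw [← pow_succ]; exact hv3
  refine ⟨{r, r * v, r * v ^ 2}, ?_, ?_⟩
  · rw [Finset.card_eq_three]
    refine ⟨_, _, _, ?_, ?_, ?_, rfl⟩
    · intro h
      exact hv1 (mul_left_cancel₀ hr0 (by rw [mul_one]; exact h.symm))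
    · intro h
      exact hv2 (mul_left_cancel₀ hr0 (by rw [mul_one]; exact h.symm))
    · intro h
      have := mul_left_cancel₀ hr0 h
      apply hv1
      apply mul_left_cancel₀ hv0
      rw [mul_one, ← sq]
      exact this.symm
  · intro s hs
    simp only [Finset.mem_insert, Finset.mem_singleton] at hs
    rcases hs with rfl | rfl | rfl
    · exact hr
    · rw [mul_pow, hr, hv3, mul_one]
    · rw [mul_pow, hr, ← pow_mul, mul_comm 2 3, pow_mul, hv3, one_pow, mul_one]

/-- the weight -/
noncomputable def wt (n : ℕ) : ℝ := 3 * pind (7 : ZMod 12) n + pind (2 : ZMod 3) n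

lemma cast_seven (n : ℕ) : (n : ZMod 12) = 7 ↔ n % 12 = 7 := by
  have : ((7 : ℕ) : ZMod 12) = 7 := rfl
  rw [← this, ZMod.natCast_eq_natCast_iff']

lemma cast_two (n : ℕ) : (n : ZMod 3) = 2 ↔ n % 3 = 2 := by
  have : ((2 : ℕ) : ZMod 3) = 2 := rfl
  rw [← this, ZMod.natCast_eq_natCast_iff']

lemma wt_nonneg (n : ℕ) : 0 ≤ wt n := by
  unfold wt pind
  split_ifs <;> norm_num

lemma wt_le (n : ℕ) : wt n ≤ 4 := by
  unfold wt pind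
  split_ifs <;> norm_num

lemma wt_lower : ∃ C : ℝ, ∀ x ∈ Set.Ioc (1 : ℝ) 2,
    (Summable fun n : ℕ => wt n / (n : ℝ) ^ x) ∧
    -(5 / 4) * Real.log (x - 1) - C ≤ ∑' n : ℕ, wt n / (n : ℝ) ^ x := by
  obtain ⟨C1, h1⟩ := prime_sum_lower (q := 12) (a := 7) (by decide)
  obtain ⟨C2, h2⟩ := prime_sum_lower (q := 3) (a := 2) (by decide)
  refine ⟨3 * C1 + C2, fun x hx => ?_⟩
  have s1 := (pind_summable (7 : ZMod 12) hx.1).mul_left 3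
  have s2 := pind_summable (2 : ZMod 3) hx.1
  have he : (fun n : ℕ => wt n / (n : ℝ) ^ x) = fun n : ℕ =>
      3 * (pind (7 : ZMod 12) n / (n : ℝ) ^ x) + pind (2 : ZMod 3) n / (n : ℝ) ^ x := by
    ext n
    unfold wt
    ring
  rw [he]
  refine ⟨s1.add s2, ?_⟩
  rw [s1.tsum_add s2, tsum_mul_left]
  have a1 := h1 x hx
  have a2 := h2 x hx
  rw [show Nat.totient 12 = 4 by decide] at a1
  rw [show Nat.totient 3 = 2 by decide] at a2
  push_cast at a1 a2
  linarith

/-- There are infinitely many primes `p ≡ 7 (mod 12)` such that the group of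
`𝔽_p`-rational points of the reduction of `E : y² + y = x³ + 2` modulo `p` contains
no element of order `2`. -/
theorem infinitely_many_primes_with_no_two_torsion :
    {p : ℕ | ∃ _ : Fact p.Prime, p % 12 = 7 ∧
      ∀ P : (Ecurve p).Point, addOrderOf P ≠ 2}.Infinite := by
  classical
  intro hfin
  obtain ⟨K, _, _, θ, hmin, hexp⟩ := exists_cubic_field
  set bad : Finset ℕ := hfin.toFinset ∪ (RingOfIntegers.exponent θ).divisors with hbad
  have key : ∀ n : ℕ, ∃ T : Finset (Ideal (𝓞 K)), n ∉ bad →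
      (T.card : ℝ) = wt n ∧ ∀ I ∈ T, Prime I ∧ Ideal.absNorm I = n := by
    intro n
    by_cases hn : n ∈ bad
    · exact ⟨∅, fun h => absurd hn h⟩
    rw [hbad, Finset.mem_union, not_or, Set.Finite.mem_toFinset, Nat.mem_divisors, not_and] at hn
    obtain ⟨hn1, hn2⟩ := hn
    have hn3 : ¬ n ∣ RingOfIntegers.exponent θ := fun h => hn2 h hexp
    by_cases hp : n.Prime
    · have : Fact n.Prime := ⟨hp⟩
      by_cases h7 : n % 12 = 7
      · have h' : ∃ P : (Ecurve n).Point, addOrderOf P = 2 := by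
          by_contra hcon
          push Not at hcon
          exact hn1 ⟨this, h7, hcon⟩
        obtain ⟨P, hP⟩ := h'
        obtain ⟨r, hr⟩ := cube_root_of_order_two P hP
        obtain ⟨R, hR, hR2⟩ := three_cube_roots h7 r hr
        obtain ⟨T, hT, hT2⟩ := ideals_of_roots K θ hmin n hn3 R hR2
        refine ⟨T, fun _ => ⟨?_, hT2⟩⟩
        have h3 : ¬ n % 3 = 2 := by omega
        simp [hT, hR, wt, pind, hp, cast_seven, cast_two, h7, h3]
      · by_cases h3 : n % 3 = 2
        · obtain ⟨r, hr⟩ := exists_cube_root h3 (18 : ZMod n)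
          obtain ⟨T, hT, hT2⟩ := ideals_of_roots K θ hmin n hn3 {r} (by simpa using hr)
          refine ⟨T, fun _ => ⟨?_, hT2⟩⟩
          simp [hT, wt, pind, hp, cast_seven, cast_two, h7, h3]
        · refine ⟨∅, fun _ => ⟨?_, by simp⟩⟩
          simp [wt, pind, cast_seven, cast_two, h7, h3]
    · refine ⟨∅, fun _ => ⟨?_, by simp⟩⟩
      simp [wt, pind, hp]
  choose T hT using key
  obtain ⟨C1, ε, hε, hup⟩ := sum_primes_le K
  obtain ⟨C2, hlow⟩ := wt_lower
  -- upper bound for the weighted sum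
  have hmain : ∀ x : ℝ, 1 < x → x < 1 + ε → x ≤ 2 →
      -(5 / 4) * Real.log (x - 1) - C2 ≤ 4 * bad.card + (-Real.log (x - 1) + C1) := by
    intro x hx1 hx2 hx3
    obtain ⟨hs, hl⟩ := hlow x ⟨hx1, hx3⟩
    refine hl.trans (hs.tsum_le_of_sum_le fun F => ?_)
    rw [← Finset.sum_filter_add_sum_filter_not F (fun n => n ∈ bad)]
    refine add_le_add ?_ ?_
    · have hterm : ∀ n ∈ F.filter (fun n => n ∈ bad), wt n / (n : ℝ) ^ x ≤ 4 := by
        intro n _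
        rcases n.eq_zero_or_pos with rfl | hn
        · rw [Nat.cast_zero, Real.zero_rpow (by linarith), div_zero]
          norm_num
        · have h1 : 1 ≤ (n : ℝ) ^ x := Real.one_le_rpow (by exact_mod_cast hn) (by linarith)
          exact (div_le_self (wt_nonneg n) h1).trans (wt_le n)
      refine (Finset.sum_le_card_nsmul _ _ 4 hterm).trans ?_
      rw [nsmul_eq_mul, mul_comm]
      have : (F.filter (fun n => n ∈ bad)).card ≤ bad.card :=
        Finset.card_le_card fun n hn => (Finset.mem_filter.mp hn).2
      have : ((F.filter (fun n => n ∈ bad)).card : ℝ) ≤ bad.card := by exact_mod_cast this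
      linarith
    · set G := F.filter (fun n => n ∉ bad) with hG
      have hGb : ∀ n ∈ G, n ∉ bad := fun n hn => (Finset.mem_filter.mp hn).2
      have hdisj : Set.PairwiseDisjoint (G : Set ℕ) T := by
        intro m hm n hn hmn
        rw [Function.onFun, Finset.disjoint_left]
        intro I hI hI'
        apply hmn
        rw [← ((hT m (hGb m hm)).2 I hI).2, ((hT n (hGb n hn)).2 I hI').2]
      have hb := hup x hx1 hx2 (G.biUnion T) (by
        intro I hI
        obtain ⟨n, hn, hI⟩ := Finset.mem_biUnion.mp hI
        exact ((hT n (hGb n hn)).2 I hI).1)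
      rw [Finset.sum_biUnion hdisj] at hb
      refine le_trans (le_of_eq (Finset.sum_congr rfl fun n hn => ?_)) hb
      rw [Finset.sum_congr rfl (g := fun _ => ((n : ℝ) ^ x)⁻¹)
        (fun I hI => by rw [((hT n (hGb n hn)).2 I hI).2]), Finset.sum_const, nsmul_eq_mul,
        (hT n (hGb n hn)).1, div_eq_mul_inv]
  -- let x tend to 1
  set M : ℝ := 4 * (4 * bad.card + C1 + C2) + 1 with hM
  set δ : ℝ := min (Real.exp (-M)) (min (ε / 2) 1) with hδ
  have hδ0 : 0 < δ := by
    have := Real.exp_pos (-M)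
    positivity
  have hδ1 : δ ≤ ε / 2 := (min_le_right _ _).trans (min_le_left _ _)
  have hδ2 : δ ≤ 1 := (min_le_right _ _).trans (min_le_right _ _)
  have h := hmain (1 + δ) (by linarith) (by linarith) (by linarith)
  rw [add_sub_cancel_left] at h
  have hlog : Real.log δ ≤ -M := by
    rw [← Real.log_exp (-M)]
    exact Real.log_le_log hδ0 (min_le_left _ _)
  linarith
end

section
/- For each integer n ≥ 1 define Ξ_n = ∑_{k ∈ (ℤ/2^{n+2}ℤ)ˣ} ψ_n(k)·S(k/2^{n+2}) ∈ ℚ₂(ζ_{2^n}) (the sum makes sense since S takes values in (1/2)ℤ ⊂ ℚ ⊂ ℚ₂). Then Ξ_1 = 0, and for every integer n ≥ 2, v(Ξ_n) = q_n/2^{n−1}. -/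
/-- The sequence `q_n`: `q_1 = 1`, `q_n = (2^n + 7)/3` for odd `n ≥ 3`, and
`q_n = (2^n − 1)/3` for even `n`. -/
def qseq (n : ℕ) : ℕ :=
  if n = 1 then 1 else if Odd n then (2 ^ n + 7) / 3 else (2 ^ n - 1) / 3

/-- The valuation `v` on a finite extension `K` of `ℚ₂`, normalized so that `v(2) = 1`:
`v(x) = v₂(N_{K/ℚ₂}(x))/[K : ℚ₂]`. -/
noncomputable def vK {K : Type*} [Field K] [Algebra ℚ_[2] K] (x : K) : ℚ :=
  ((Algebra.norm ℚ_[2] x).valuation : ℚ) / (Module.finrank ℚ_[2] K : ℚ)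

/-- The cyclotomic specialization `Ξ_n = ∑_{k ∈ (ℤ/2^{n+2}ℤ)ˣ} ψ_n(k)·S(k/2^{n+2})`. -/
noncomputable def XiN (S : ℚ → ℚ) {K : Type*} [Field K] (n : ℕ)
    (ψ : (ZMod (2 ^ (n + 2)))ˣ →* K) : K :=
  ∑ k : (ZMod (2 ^ (n + 2)))ˣ,
    ψ k * (S (((k : ZMod (2 ^ (n + 2))).val : ℚ) / (2 ^ (n + 2) : ℚ)) : K)

section Val
open Polynomial

variable {K : Type*} [Field K] [Algebra ℚ_[2] K] [FiniteDimensional ℚ_[2] K]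

lemma vK_mul {x y : K} (hx : x ≠ 0) (hy : y ≠ 0) : vK (x * y) = vK x + vK y := by
  unfold vK
  rw [map_mul, Padic.valuation_mul (Algebra.norm_ne_zero_iff.2 hx) (Algebra.norm_ne_zero_iff.2 hy)]
  push_cast
  ring

lemma vK_pow (x : K) (k : ℕ) : vK (x ^ k) = k * vK x := by
  unfold vK
  rw [map_pow, Padic.valuation_pow]
  push_cast
  ring

lemma vK_two : vK (2 : K) = 1 := by
  have h : (2 : K) = algebraMap ℚ_[2] K 2 := (map_ofNat _ 2).symm
  have hf : (Module.finrank ℚ_[2] K : ℚ) ≠ 0 := by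
    exact_mod_cast (Module.finrank_pos (R := ℚ_[2]) (M := K)).ne'
  have h2 : ((2 : ℚ_[2])).valuation = 1 := by
    simpa using (Padic.valuation_p (p := 2))
  unfold vK
  rw [h, Algebra.norm_algebraMap, Padic.valuation_pow, h2]
  simp [hf]

/-- Integral elements have norm of nonnegative valuation. -/
lemma norm_le_of_integral [Algebra ℤ_[2] K] [IsScalarTower ℤ_[2] ℚ_[2] K] {x : K}
    (hx : IsIntegral ℤ_[2] x) : 0 ≤ (Algebra.norm ℚ_[2] x).valuation := by
  obtain ⟨y, hy⟩ := IsIntegrallyClosed.isIntegral_iff.1 (Algebra.isIntegral_norm ℚ_[2] hx)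
  rw [← hy]
  rw [PadicInt.algebraMap_apply, PadicInt.valuation_coe]
  positivity

lemma unit_of_odd {n : ℕ} {ζ : K} (hζ : ζ ^ (2 ^ n) = 1) (U : ℤ[X]) (hU : Odd (U.eval 1)) :
    aeval ζ U ≠ 0 ∧ vK (aeval ζ U) = 0 := by
  let _ : Algebra ℤ_[2] K := ((algebraMap ℚ_[2] K).comp (algebraMap ℤ_[2] ℚ_[2])).toAlgebra
  have : IsScalarTower ℤ_[2] ℚ_[2] K := IsScalarTower.of_algebraMap_eq (fun _ => rfl)
  have hint : IsIntegral ℤ_[2] ζ := by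
    refine IsIntegral.of_pow (n := 2 ^ n) (by positivity) ?_
    rw [hζ]; exact isIntegral_one
  let z : integralClosure ℤ_[2] K := ⟨ζ, hint⟩
  have hz : z ^ (2 ^ n) = 1 := Subtype.ext (by simpa [z] using hζ)
  have hval : ((aeval z U : integralClosure ℤ_[2] K) : K) = aeval ζ U := by
    have := Polynomial.aeval_algebraMap_apply K z U
    simpa [z] using this.symm
  have hunit : IsUnit (aeval z U) := by
    by_contra hnu
    obtain ⟨M, hM, hmem⟩ := exists_max_ideal_of_mem_nonunits hnu
    have hcm : (M.comap (algebraMap ℤ_[2] (integralClosure ℤ_[2] K))).IsMaximal :=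
      Ideal.isMaximal_comap_of_isIntegral_of_isMaximal M
    have h2 : (2 : integralClosure ℤ_[2] K) ∈ M := by
      have h := IsLocalRing.eq_maximalIdeal hcm
      have h2' : (2 : ℤ_[2]) ∈ IsLocalRing.maximalIdeal ℤ_[2] := by
        rw [PadicInt.maximalIdeal_eq_span_p]
        exact Ideal.subset_span (by simp)
      rw [← h, Ideal.mem_comap] at h2'
      rwa [map_ofNat] at h2'
    let φ := Ideal.Quotient.mk M
    have hφ2 : (2 : (integralClosure ℤ_[2] K) ⧸ M) = 0 := by
      have := Ideal.Quotient.eq_zero_iff_mem.2 h2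
      rwa [map_ofNat] at this
    have : Nontrivial ((integralClosure ℤ_[2] K) ⧸ M) := Ideal.Quotient.nontrivial_iff.2 hM.ne_top
    have : IsDomain ((integralClosure ℤ_[2] K) ⧸ M) := Ideal.Quotient.isDomain M
    have : CharP ((integralClosure ℤ_[2] K) ⧸ M) 2 := CharTwo.of_one_ne_zero_of_two_eq_zero one_ne_zero hφ2
    have h1 : φ z = 1 := by
      have : (φ z - 1) ^ (2 ^ n) = 0 := by
        rw [sub_pow_char_pow, ← map_pow, hz]; simp
      exact sub_eq_zero.1 (pow_eq_zero_iff (by positivity) |>.1 this)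
    have h3 : φ (aeval z U) = ((U.eval 1 : ℤ) : (integralClosure ℤ_[2] K) ⧸ M) := by
      have e1 : φ (aeval z U) = aeval (φ z) U := by
        rw [Polynomial.aeval_def, Polynomial.aeval_def, Polynomial.hom_eval₂]
        congr 1
      rw [e1, h1]
      have := Polynomial.aeval_algebraMap_apply ((integralClosure ℤ_[2] K) ⧸ M) (1 : ℤ) U
      simpa using this
    have h4 : φ (aeval z U) = 0 := Ideal.Quotient.eq_zero_iff_mem.2 hmem
    obtain ⟨k, hk⟩ := hU
    rw [h4, hk] at h3
    push_cast at h3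
    rw [hφ2] at h3
    simp at h3
  obtain ⟨w, hw⟩ := hunit.exists_right_inv
  have hw' : aeval ζ U * (w : K) = 1 := by
    rw [← hval]; exact_mod_cast congrArg Subtype.val hw
  have hne : aeval ζ U ≠ 0 := left_ne_zero_of_mul_eq_one hw'
  have hwne : (w : K) ≠ 0 := right_ne_zero_of_mul_eq_one hw'
  refine ⟨hne, ?_⟩
  have a1 := norm_le_of_integral (x := aeval ζ U) (by rw [← hval]; exact (aeval z U).2)
  have a2 := norm_le_of_integral w.2
  have a3 := congrArg (fun t => (Algebra.norm ℚ_[2] t).valuation) hw'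
  simp only [map_mul, map_one, Padic.valuation_one] at a3
  rw [Padic.valuation_mul (Algebra.norm_ne_zero_iff.2 hne) (Algebra.norm_ne_zero_iff.2 hwne)] at a3
  have : (Algebra.norm ℚ_[2] (aeval ζ U)).valuation = 0 := by omega
  simp [vK, this]

/-- an integer polynomial that vanishes mod 2 is divisible by 2 -/
lemma exists_two_mul (P : ℤ[X]) (h : P.map (Int.castRingHom (ZMod 2)) = 0) :
    ∃ V : ℤ[X], P = 2 * V := by
  have : (C (2 : ℤ)) ∣ P := by
    rw [Polynomial.C_dvd_iff_dvd_coeff]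
    intro i
    have := congrArg (fun Q => Polynomial.coeff Q i) h
    simp only [coeff_map, coeff_zero] at this
    exact (ZMod.intCast_zmod_eq_zero_iff_dvd (P.coeff i) 2).1 (by simpa using this)
  obtain ⟨V, hV⟩ := this
  exact ⟨V, by simpa using hV⟩

lemma exists_G (m : ℕ) : ∃ G : ℤ[X], (X : ℤ[X]) ^ (2 ^ m) + 1 = (X - 1) ^ (2 ^ m) + 2 * G ∧
    G.eval 1 = 1 := by
  obtain ⟨G, hG⟩ := exists_two_mul ((X : ℤ[X]) ^ (2 ^ m) + 1 - (X - 1) ^ (2 ^ m)) (by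
    simp only [Polynomial.map_sub, Polynomial.map_add, Polynomial.map_pow, Polynomial.map_X,
      Polynomial.map_one]
    rw [sub_pow_char_pow, one_pow]
    ring_nf
    exact CharTwo.two_eq_zero)
  refine ⟨G, by rw [← hG]; ring, ?_⟩
  have := congrArg (Polynomial.eval 1) hG
  simp at this
  omega

lemma zeta_half {n : ℕ} {ζ : K} (hζ : IsPrimitiveRoot ζ (2 ^ (n + 1))) : ζ ^ (2 ^ n) = -1 := by
  have h1 : (ζ ^ (2 ^ n)) ^ 2 = 1 := by rw [← pow_mul, ← pow_succ]; exact hζ.pow_eq_one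
  rcases mul_self_eq_one_iff.1 ((sq _).symm.trans h1) with h | h
  · exact absurd h (hζ.pow_ne_one_of_pos_of_lt (by positivity)
      (Nat.pow_lt_pow_right (by norm_num) (by omega)))
  · exact h

lemma val_criterion {n : ℕ} {ζ : K} (hζ : IsPrimitiveRoot ζ (2 ^ (n + 1)))
    {x : K} {q : ℕ} {A U : ℤ[X]} (hA : Odd (A.eval 1)) (hU : Odd (U.eval 1))
    (h : aeval ζ A * x = (ζ - 1) ^ q * aeval ζ U) : vK x = (q : ℚ) / 2 ^ n := by
  obtain ⟨G, hG, hG1⟩ := exists_G n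
  have hp := hζ.pow_eq_one
  have hh := zeta_half hζ
  have e := congrArg (aeval ζ) hG
  simp only [map_add, map_pow, map_mul, map_sub, aeval_X, map_one, hh, map_ofNat] at e
  obtain ⟨g0, g1⟩ := unit_of_odd hp G (by rw [hG1]; exact odd_one)
  obtain ⟨a0, a1⟩ := unit_of_odd hp A hA
  obtain ⟨u0, u1⟩ := unit_of_odd hp U hU
  obtain ⟨m0, m1⟩ := unit_of_odd hp (-1) (by simp)
  have e' : (ζ - 1) ^ (2 ^ n) = aeval ζ (-1 : ℤ[X]) * (2 * aeval ζ G) := by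
    simp only [map_neg, map_one]
    linear_combination -e
  have h20 : (2 : K) ≠ 0 := by
    intro h2
    have := vK_two (K := K)
    rw [h2] at this
    simp [vK] at this
  have hpi : ζ - 1 ≠ 0 := by
    intro h0
    rw [h0, zero_pow (by positivity)] at e'
    exact (mul_ne_zero m0 (mul_ne_zero h20 g0)) e'.symm
  have v1 := congrArg vK e'
  rw [vK_pow, vK_mul m0 (mul_ne_zero h20 g0), vK_mul h20 g0, m1, vK_two, g1] at v1
  have hx0 : x ≠ 0 := by
    rintro rfl
    rw [mul_zero] at h
    exact mul_ne_zero (pow_ne_zero _ hpi) u0 h.symm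
  have v2 := congrArg vK h
  rw [vK_mul a0 hx0, vK_mul (pow_ne_zero _ hpi) u0, vK_pow, a1, u1] at v2
  push_cast at v1
  field_simp
  have : vK x = q * vK (ζ - 1) := by linarith
  rw [this]
  linear_combination (q : ℚ) * v1

lemma val_small {n : ℕ} {ζ : K} (hζ : IsPrimitiveRoot ζ (2 ^ (n + 1)))
    {q : ℕ} {P U V : ℤ[X]} (hU : Odd (U.eval 1)) (hq : q < 2 ^ n)
    (h : P = (X - 1) ^ q * U + 2 * V) : vK (aeval ζ P) = (q : ℚ) / 2 ^ n := by
  obtain ⟨G, hG, hG1⟩ := exists_G n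
  have hh := zeta_half hζ
  have e := congrArg (aeval ζ) hG
  simp only [map_add, map_pow, map_mul, map_sub, aeval_X, map_one, hh, map_ofNat] at e
  obtain ⟨d, hd⟩ : ∃ d, 2 ^ n = q + (d + 1) := ⟨2 ^ n - q - 1, by omega⟩
  refine val_criterion hζ (A := G) (U := U * G - (X - 1) ^ (d + 1) * V) (by rw [hG1]; exact odd_one)
    ?_ ?_
  · simpa [hG1] using hU
  · rw [h]
    rw [hd, pow_add] at e
    simp only [map_add, map_pow, map_mul, map_sub, aeval_X, map_one, map_ofNat]
    linear_combination (-(aeval ζ V)) * e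

lemma val_three {ζ : K} (hζ : IsPrimitiveRoot ζ (2 ^ (2 + 1))) :
    vK (-(ζ ^ 2 * (1 + ζ) * (1 + ζ ^ 2) ^ 2)) = (5 : ℚ) / 2 ^ 2 := by
  obtain ⟨G, hG, hG1⟩ := exists_G 2
  have hh := zeta_half hζ
  have e := congrArg (aeval ζ) hG
  simp only [map_add, map_pow, map_mul, map_sub, aeval_X, map_one, hh, map_ofNat] at e
  norm_num at e
  refine val_criterion hζ (A := G ^ 3)
    (U := -(X ^ 2 * (G - (X - 1) ^ 3) * (G - (X - 1) ^ 2 * X) ^ 2)) (by simp [hG1])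
    (by simp [hG1]) ?_
  simp only [map_add, map_pow, map_mul, map_sub, aeval_X, map_one, map_ofNat, map_neg]
  have e1 : aeval ζ G * (1 + ζ) = (ζ - 1) * (aeval ζ G - (ζ - 1) ^ 3) := by
    linear_combination -e
  have e2 : aeval ζ G * (1 + ζ ^ 2) = (ζ - 1) ^ 2 * (aeval ζ G - (ζ - 1) ^ 2 * ζ) := by
    linear_combination -ζ * e
  calc aeval ζ G ^ 3 * -(ζ ^ 2 * (1 + ζ) * (1 + ζ ^ 2) ^ 2)
      = -(ζ ^ 2 * (aeval ζ G * (1 + ζ)) * (aeval ζ G * (1 + ζ ^ 2)) ^ 2) := by ring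
    _ = _ := by rw [e1, e2]; ring

end Val

section Comb
open Polynomial

lemma qseq_facts (n : ℕ) (hn : 2 ≤ n) :
    qseq (n + 2) = 2 ^ n + qseq n ∧ qseq n < 2 ^ n ∧ (n ≠ 3 → qseq n < 2 ^ (n - 1)) := by
  have h1 : n ≠ 1 := by omega
  have h1' : n + 2 ≠ 1 := by omega
  rcases Nat.even_or_odd' n with ⟨k, rfl | rfl⟩
  · have hk : 4 ^ k % 3 = 1 := by simp [Nat.pow_mod]
    have e0 : 2 ^ (2 * k) = 4 ^ k := by rw [pow_mul]; norm_num
    have e1 : 2 ^ (2 * k + 2) = 4 * 4 ^ k := by rw [pow_add, e0]; ring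
    have e2 : 2 * 2 ^ (2 * k - 1) = 4 ^ k := by
      rw [← e0, ← pow_succ']; congr 1; omega
    have o0 : ¬ Odd (2 * k) := by simp
    have o1 : ¬ Odd (2 * k + 2) := by simp [Nat.odd_add]
    simp only [qseq, if_neg h1, if_neg h1', if_neg o0, if_neg o1, e0, e1]
    omega
  · have hk : 4 ^ k % 3 = 1 := by simp [Nat.pow_mod]
    have e0 : 2 ^ (2 * k + 1) = 2 * 4 ^ k := by rw [pow_succ, pow_mul]; norm_num; ring
    have e1 : 2 ^ (2 * k + 1 + 2) = 8 * 4 ^ k := by rw [pow_add, e0]; ring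
    have e2 : 2 ^ (2 * k + 1 - 1) = 4 ^ k := by simp [pow_mul]
    have o0 : Odd (2 * k + 1) := by simp
    have o1 : Odd (2 * k + 1 + 2) := ⟨k + 1, by ring⟩
    have hk1 : 4 ^ 1 ≤ 4 ^ k := Nat.pow_le_pow_right (by norm_num) (by omega)
    have hk2 : 2 * k + 1 ≠ 3 → 4 ^ 2 ≤ 4 ^ k := fun h =>
      Nat.pow_le_pow_right (by norm_num) (by omega)
    simp only [qseq, if_neg h1, if_neg h1', if_pos o0, if_pos o1, e0, e1, e2]
    refine ⟨by omega, by omega, fun h => ?_⟩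
    have := hk2 h
    omega

/-- The polynomial attached to the first `2^k` terms of a sequence. -/
noncomputable def PP (k : ℕ) (c : ℕ → ℤ) : ℤ[X] := ∑ j ∈ Finset.range (2 ^ k), C (c j) * X ^ j

lemma poly_step (m : ℕ) (c c' : ℕ → ℤ) (hc : ∀ j, c (j + 2 ^ m) = c j)
    (hr : ∀ j, c' j + c' (j + 2 ^ (m + 1)) = -c j - 2) {q : ℕ} (hq : q < 2 ^ m)
    (h : ∃ U V : ℤ[X], PP m c = (X - 1) ^ q * U + 2 * V ∧ Odd (U.eval 1)) :
    ∃ U V : ℤ[X], PP (m + 2) c' = (X - 1) ^ (2 ^ m + q) * U + 2 * V ∧ Odd (U.eval 1) := by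
  obtain ⟨U, V, hP, hU⟩ := h
  obtain ⟨G, hG, -⟩ := exists_G m
  obtain ⟨H, hH, -⟩ := exists_G (m + 1)
  obtain ⟨d, hd⟩ : ∃ d, 2 ^ m = q + (d + 1) := ⟨2 ^ m - q - 1, by omega⟩
  set Q : ℤ[X] := ∑ j ∈ Finset.range (2 ^ (m + 1)), C (c' (j + 2 ^ (m + 1))) * X ^ j with hQ
  set R : ℤ[X] := ∑ j ∈ Finset.range (2 ^ (m + 1)), X ^ j with hR
  have e1 : PP (m + 2) c' = -(∑ j ∈ Finset.range (2 ^ (m + 1)), C (c j) * X ^ j) - 2 * R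
      + (X ^ (2 ^ (m + 1)) - 1) * Q := by
    have : 2 ^ (m + 2) = 2 ^ (m + 1) + 2 ^ (m + 1) := by ring
    rw [PP, this, Finset.sum_range_add, ← Finset.sum_add_distrib, hQ, hR, Finset.mul_sum,
      Finset.mul_sum, ← Finset.sum_neg_distrib, ← Finset.sum_sub_distrib,
      ← Finset.sum_add_distrib]
    refine Finset.sum_congr rfl fun j _ => ?_
    have h1 := congrArg (C : ℤ → ℤ[X]) (hr j)
    simp only [map_add, map_sub, map_neg, map_ofNat] at h1
    rw [add_comm (2 ^ (m + 1)) j, pow_add X j]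
    generalize c' (j + 2 ^ (m + 1)) = w at h1 ⊢
    linear_combination (X ^ j) * h1
  have e2 : (∑ j ∈ Finset.range (2 ^ (m + 1)), C (c j) * X ^ j : ℤ[X])
      = (1 + X ^ (2 ^ m)) * PP m c := by
    have : 2 ^ (m + 1) = 2 ^ m + 2 ^ m := by ring
    rw [PP, this, Finset.sum_range_add, add_mul, one_mul, Finset.mul_sum]
    congr 1
    refine Finset.sum_congr rfl fun j _ => ?_
    rw [add_comm (2 ^ m) j, hc, pow_add]
    ring
  refine ⟨-U + (X - 1) ^ (d + 1) * Q,
    -(X - 1) ^ (2 ^ m) * V - G * ((X - 1) ^ q * U + 2 * V) - R + (H - 1) * Q, ?_, ?_⟩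
  · have e3 : (X - 1 : ℤ[X]) ^ (2 ^ (m + 1)) = (X - 1) ^ (2 ^ m + q) * (X - 1) ^ (d + 1) := by
      rw [← pow_add]; congr 1; rw [pow_succ]; omega
    rw [e3] at hH
    rw [e1, e2, hP]
    rw [pow_add] at hH ⊢
    linear_combination (-((X - 1) ^ q * U + 2 * V)) * hG + Q * hH
  · simpa using hU

lemma S_int {S : ℚ → ℚ} (hSper : ∀ β : ℚ, S (β + 1) = S β) (k : ℤ) (β : ℚ) :
    S (β + k) = S β := by
  have h : Function.Periodic S 1 := hSper
  simpa using h.int_mul k β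

lemma S_congr {S : ℚ → ℚ} (hSper : ∀ β : ℚ, S (β + 1) = S β) (M : ℕ) (hM : M ≠ 0) (a b : ℤ)
    (h : (a : ZMod M) = b) : S ((a : ℚ) / M) = S ((b : ℚ) / M) := by
  obtain ⟨k, hk⟩ := (ZMod.intCast_eq_intCast_iff_dvd_sub a b M).1 h
  have : (b : ℚ) / M = (a : ℚ) / M + k := by
    have : (b : ℚ) = a + M * k := by
      have := congrArg (Int.cast : ℤ → ℚ) hk
      push_cast at this
      linarith
    rw [this]
    field_simp
  rw [this, S_int hSper]

lemma five_pow (k : ℕ) : ∃ t : ℤ, (5 : ℤ) ^ (2 ^ k) = 1 + 2 ^ (k + 2) + 2 ^ (k + 3) * t := by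
  induction k with
  | zero => exact ⟨0, by norm_num⟩
  | succ k ih =>
    obtain ⟨t, ht⟩ := ih
    refine ⟨t + 2 ^ k * (1 + 2 * t) ^ 2, ?_⟩
    rw [pow_succ, pow_mul, ht]
    ring

lemma S_five_period {S : ℚ → ℚ} (hSper : ∀ β : ℚ, S (β + 1) = S β) (m j : ℕ) :
    S (5 ^ (j + 2 ^ m) / 2 ^ (m + 2)) = S (5 ^ j / 2 ^ (m + 2)) := by
  obtain ⟨t, ht⟩ := five_pow m
  have ht' := congrArg (Int.cast : ℤ → ℚ) ht
  push_cast at ht'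
  have : (5 : ℚ) ^ (j + 2 ^ m) / 2 ^ (m + 2)
      = 5 ^ j / 2 ^ (m + 2) + ((5 ^ j * (1 + 2 * t) : ℤ) : ℚ) := by
    rw [pow_add, ht']
    push_cast
    field_simp
    ring
  rw [this, S_int hSper]

lemma S_five_half {S : ℚ → ℚ} (hSper : ∀ β : ℚ, S (β + 1) = S β) (m j : ℕ) :
    S (5 ^ (j + 2 ^ (m + 1)) / 2 ^ (m + 4)) = S ((5 ^ j / 2 ^ (m + 3) + 1) / 2) := by
  obtain ⟨t, ht⟩ := five_pow (m + 1)
  have ht' := congrArg (Int.cast : ℤ → ℚ) ht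
  push_cast at ht'
  obtain ⟨s, hs⟩ : Odd ((5 : ℤ) ^ j) := Odd.pow (by decide)
  have hs' := congrArg (Int.cast : ℤ → ℚ) hs
  push_cast at hs'
  have : (5 : ℚ) ^ (j + 2 ^ (m + 1)) / 2 ^ (m + 4)
      = (5 ^ j / 2 ^ (m + 3) + 1) / 2 + ((s + 5 ^ j * t : ℤ) : ℚ) := by
    rw [pow_add, ht']
    push_cast
    have e : (2 : ℚ) ^ (m + 4) = 2 * 2 ^ (m + 3) := by ring
    have e'' : (2 : ℚ) ^ (m + 1 + 2) = 2 ^ (m + 3) := by ring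
    rw [e, e'']
    have h0 : (2 : ℚ) ^ (m + 3) ≠ 0 := by positivity
    field_simp
    rw [hs']
    ring
  rw [this, S_int hSper]

lemma S_rel {N : ℕ} (hN : Odd N) {a : ℕ → ℤ} {S : ℚ → ℚ}
    (hS0 : S 0 = 0) (hSper : ∀ β : ℚ, S (β + 1) = S β)
    (hHecke : ∀ ℓ : ℕ, ℓ.Prime → ¬(ℓ ∣ N) → ∀ β : ℚ, Nat.Coprime β.den N →
      ∑ x ∈ Finset.range ℓ, S ((β + (x : ℚ)) / (ℓ : ℚ)) =
        (a ℓ : ℚ) * S β - S ((ℓ : ℚ) * β) + ∑ x ∈ Finset.range ℓ, S ((x : ℚ) / (ℓ : ℚ)))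
    (ha2 : a 2 = 0) (hv2 : S (1 / 2) = -1) (m j : ℕ) :
    S (5 ^ j / 2 ^ (m + 4)) + S (5 ^ (j + 2 ^ (m + 1)) / 2 ^ (m + 4))
      = - S (5 ^ j / 2 ^ (m + 2)) - 1 := by
  have hden : Nat.Coprime ((5 : ℚ) ^ j / 2 ^ (m + 3)).den N := by
    have h1 : ((5 : ℚ) ^ j / 2 ^ (m + 3)).den ∣ 2 ^ (m + 3) := by
      have := Rat.den_dvd (5 ^ j) (2 ^ (m + 3))
      rw [Rat.divInt_eq_div] at this
      push_cast at this
      exact_mod_cast this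
    exact Nat.Coprime.coprime_dvd_left h1 (Nat.Coprime.pow_left _ (Nat.coprime_two_left.2 hN))
  have h := hHecke 2 Nat.prime_two (by rw [← even_iff_two_dvd]; exact Nat.not_even_iff_odd.2 hN) _ hden
  simp only [Finset.sum_range_succ, Finset.sum_range_zero, ha2] at h
  push_cast at h
  rw [← S_five_half hSper] at h
  have e1 : ((5 : ℚ) ^ j / 2 ^ (m + 3) + 0) / 2 = 5 ^ j / 2 ^ (m + 4) := by
    rw [add_zero, div_div, ← pow_succ]
  have e2 : 2 * ((5 : ℚ) ^ j / 2 ^ (m + 3)) = 5 ^ j / 2 ^ (m + 2) := by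
    rw [pow_succ 2 (m + 2)]; field_simp
  rw [e1, e2, zero_div, hS0, hv2] at h
  linarith

lemma Xi_eq {S : ℚ → ℚ} (hSneg : ∀ β : ℚ, S (-β) = S β) (hSper : ∀ β : ℚ, S (β + 1) = S β)
    {K : Type*} [Field K] [CharZero K] (c : ℚ → ℤ) (hc : ∀ β, S β = (c β : ℚ) / 2) (n : ℕ) (ζ : K)
    (ψ : (ZMod (2 ^ (n + 2)))ˣ →* K)
    (hψneg : ∀ u : (ZMod (2 ^ (n + 2)))ˣ, (u : ZMod (2 ^ (n + 2))) = -1 → ψ u = 1)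
    (hψ5 : ∀ u : (ZMod (2 ^ (n + 2)))ˣ, (u : ZMod (2 ^ (n + 2))) = 5 → ψ u = ζ) :
    XiN S n ψ = aeval ζ (PP n (fun j => c (5 ^ j / 2 ^ (n + 2)))) := by
  have hu5 : IsUnit ((5 : ℕ) : ZMod (2 ^ (n + 2))) := by
    rw [ZMod.isUnit_iff_coprime]
    exact Nat.Coprime.pow_right _ (by norm_num)
  obtain ⟨f, hf⟩ := hu5
  push_cast at hf
  have hford : orderOf f = 2 ^ n := by
    rw [← ZMod.orderOf_five n, ← hf, orderOf_units]
  let e : Bool × Fin (2 ^ n) → (ZMod (2 ^ (n + 2)))ˣ := fun p => (if p.1 then -1 else 1) * f ^ (p.2 : ℕ)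
  have h4 : ∀ (i j : ℕ), f ^ i ≠ -1 * f ^ j := by
    intro i j h
    have h' := congrArg (fun u : (ZMod (2 ^ (n + 2)))ˣ => (u : ZMod (2 ^ (n + 2)))) h
    simp only [Units.val_mul, Units.val_pow_eq_pow_val, Units.val_neg, Units.val_one, hf] at h'
    have hd : 4 ∣ 2 ^ (n + 2) := ⟨2 ^ n, by ring⟩
    have h'' := congrArg (ZMod.castHom hd (ZMod 4)) h'
    simp only [map_mul, map_pow, map_neg, map_one, map_ofNat] at h''
    have h5 : (5 : ZMod 4) = 1 := by decide
    rw [h5, one_pow, one_pow] at h''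
    exact absurd h'' (by decide)
  have hinj : Function.Injective e := by
    have key : ∀ i j : Fin (2 ^ n), f ^ (i : ℕ) = f ^ (j : ℕ) → i = j := by
      intro i j h
      exact Fin.ext (pow_injOn_Iio_orderOf (by simp [hford]) (by simp [hford]) h)
    rintro ⟨b, i⟩ ⟨b', j⟩ h
    cases b <;> cases b' <;> simp only [e, if_true, if_false, Bool.false_eq_true, one_mul] at h
    · rw [key i j h]
    · exact absurd h (h4 _ _)
    · exact absurd h.symm (h4 _ _)
    · rw [key i j (mul_left_cancel h)]
  have hbij : Function.Bijective e := by
    rw [Fintype.bijective_iff_injective_and_card]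
    refine ⟨hinj, ?_⟩
    rw [Fintype.card_prod, Fintype.card_bool, Fintype.card_fin, ZMod.card_units_eq_totient,
      Nat.totient_prime_pow Nat.prime_two (by omega)]
    simp [pow_succ]; ring
  have hψ1 : ψ (-1) = 1 := hψneg _ (by simp)
  have hψf : ψ f = ζ := hψ5 _ hf
  have hval : ∀ (u : (ZMod (2 ^ (n + 2)))ˣ) (b : ℤ), (u : ZMod (2 ^ (n + 2))) = b →
      S (((u : ZMod (2 ^ (n + 2))).val : ℚ) / (2 ^ (n + 2) : ℚ)) = S ((b : ℚ) / 2 ^ (n + 2)) := by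
    intro u b hb
    have := S_congr hSper (2 ^ (n + 2)) (by positivity) ((u : ZMod (2 ^ (n + 2))).val : ℤ) b
      (by simp [hb])
    push_cast at this
    exact this
  unfold XiN
  rw [← hbij.sum_comp, Fintype.sum_prod_type, Fintype.sum_bool, ← Finset.sum_add_distrib, PP,
    map_sum, ← Fin.sum_univ_eq_sum_range (fun j => aeval ζ (C (c (5 ^ j / 2 ^ (n + 2))) * X ^ j))]
  refine Finset.sum_congr rfl fun j _ => ?_
  rw [hval (e (true, j)) (-5 ^ (j : ℕ)) (by simp [e, hf]),
    hval (e (false, j)) (5 ^ (j : ℕ)) (by simp [e, hf])]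
  have e1 : ψ (e (true, j)) = ζ ^ (j : ℕ) := by simp only [e, if_true, map_mul, map_pow, hψ1, hψf, one_mul]
  have e2 : ψ (e (false, j)) = ζ ^ (j : ℕ) := by
    simp only [e, Bool.false_eq_true, if_false, map_mul, map_pow, map_one, hψf, one_mul]
  rw [e1, e2]
  push_cast
  rw [neg_div, hSneg, hc]
  simp only [map_mul, map_pow, aeval_X, aeval_C]
  push_cast
  simp only [algebraMap_int_eq, eq_intCast]
  ring

end Comb

open Polynomial in
/-- `Ξ_1 = 0`, and for `n ≥ 2`, `v(Ξ_n) = q_n/2^{n−1}`. -/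
theorem valuation_cyclotomic_specialization
    (N : ℕ) (hN : Odd N)
    (a : ℕ → ℤ) (ha1 : a 1 = 1)
    (hamul : ∀ m k : ℕ, Nat.Coprime m k → a (m * k) = a m * a k)
    (S : ℚ → ℚ)
    (hS0 : S 0 = 0) (hSneg : ∀ β : ℚ, S (-β) = S β) (hSper : ∀ β : ℚ, S (β + 1) = S β)
    (hHecke : ∀ ℓ : ℕ, ℓ.Prime → ¬(ℓ ∣ N) → ∀ β : ℚ, Nat.Coprime β.den N →
      ∑ x ∈ Finset.range ℓ, S ((β + (x : ℚ)) / (ℓ : ℚ)) =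
        (a ℓ : ℚ) * S β - S ((ℓ : ℚ) * β) + ∑ x ∈ Finset.range ℓ, S ((x : ℚ) / (ℓ : ℚ)))
    (ha2 : a 2 = 0)
    (hhalf : ∀ β : ℚ, ∃ c : ℤ, S β = (c : ℚ) / 2)
    (hv2 : S (1 / 2) = -1) (hv4 : S (1 / 4) = -(1 / 2))
    (hv8 : ∀ x : ℤ, Odd x → S ((x : ℚ) / 8) = 0)
    (hv16a : S (1 / 16) = 0) (hv16b : S (5 / 16) = 0)
    (hv16c : S (3 / 16) = -(1 / 2)) (hv16d : S (7 / 16) = -(1 / 2))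
    (hv32a : S (3 / 32) = -(1 / 2)) (hv32b : S (7 / 32) = -(1 / 2))
    (hv32c : S (9 / 32) = -(1 / 2)) (hv32d : S (13 / 32) = -(1 / 2))
    (hv32e : S (11 / 32) = -1) (hv32f : S (15 / 32) = -1)
    (hv32g : S (1 / 32) = 0) (hv32h : S (5 / 32) = 0)
    (n : ℕ) (hn : 1 ≤ n)
    (K : Type*) [Field K] [Algebra ℚ_[2] K] [FiniteDimensional ℚ_[2] K]
    (ζ : K) (hζ : IsPrimitiveRoot ζ (2 ^ n))
    (ψ : (ZMod (2 ^ (n + 2)))ˣ →* K)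
    (hψneg : ∀ u : (ZMod (2 ^ (n + 2)))ˣ, (u : ZMod (2 ^ (n + 2))) = -1 → ψ u = 1)
    (hψ5 : ∀ u : (ZMod (2 ^ (n + 2)))ˣ, (u : ZMod (2 ^ (n + 2))) = 5 → ψ u = ζ) :
    (n = 1 → XiN S n ψ = 0) ∧
      (2 ≤ n → vK (XiN S n ψ) = (qseq n : ℚ) / (2 ^ (n - 1) : ℚ)) := by
  classical
  choose c hc using hhalf
  have hchar : CharZero K := charZero_of_injective_algebraMap (algebraMap ℚ_[2] K).injective
  rw [Xi_eq hSneg hSper c hc n ζ ψ hψneg hψ5]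
  have hcS : ∀ β (z : ℤ), S β = (z : ℚ) / 2 → c β = z := by
    intro β z h
    rw [hc] at h
    have : (c β : ℚ) = z := by linarith
    exact_mod_cast this
  -- the two explicit initial levels
  have hpos : ∀ (β γ : ℚ) (k z : ℤ), β = γ + k → S γ = (z : ℚ) / 2 → c β = z := by
    intro β γ k z h h'
    apply hcS
    rw [h, S_int hSper, h']
  have hneg : ∀ (β γ : ℚ) (k z : ℤ), β = -γ + k → S γ = (z : ℚ) / 2 → c β = z := by
    intro β γ k z h h'
    apply hcS
    rw [h, S_int hSper, hSneg, h']
  have hP1 : PP 1 (fun j => c (5 ^ j / 2 ^ (1 + 2))) = 0 := by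
    have : ∀ j : ℕ, c (5 ^ j / 2 ^ (1 + 2)) = 0 := by
      intro j
      apply hcS
      have := hv8 (5 ^ j) (Odd.pow (by decide))
      push_cast at this
      norm_num
      exact this
    simp [PP, this]
  have hP2 : PP 2 (fun j => c (5 ^ j / 2 ^ (2 + 2))) = -(X ^ 2 * (1 + X)) := by
    have c0 : c (5 ^ 0 / 2 ^ (2 + 2)) = 0 :=
      hpos _ (1 / 16) 0 _ (by norm_num) (by rw [hv16a]; norm_num)
    have c1 : c (5 ^ 1 / 2 ^ (2 + 2)) = 0 :=
      hpos _ (5 / 16) 0 _ (by norm_num) (by rw [hv16b]; norm_num)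
    have c2 : c (5 ^ 2 / 2 ^ (2 + 2)) = -1 :=
      hneg _ (7 / 16) 2 _ (by norm_num) (by rw [hv16d]; norm_num)
    have c3 : c (5 ^ 3 / 2 ^ (2 + 2)) = -1 :=
      hneg _ (3 / 16) 8 _ (by norm_num) (by rw [hv16c]; norm_num)
    rw [PP, show 2 ^ 2 = 4 from rfl]
    simp only [Finset.sum_range_succ, Finset.sum_range_zero, c0, c1, c2, c3, map_zero, map_neg,
      map_one]
    ring
  have hP3 : PP 3 (fun j => c (5 ^ j / 2 ^ (3 + 2))) = -(X ^ 2 * (1 + X) * (1 + X ^ 2) ^ 2) := by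
    have c0 : c (5 ^ 0 / 2 ^ (3 + 2)) = 0 :=
      hpos _ (1 / 32) 0 _ (by norm_num) (by rw [hv32g]; norm_num)
    have c1 : c (5 ^ 1 / 2 ^ (3 + 2)) = 0 :=
      hpos _ (5 / 32) 0 _ (by norm_num) (by rw [hv32h]; norm_num)
    have c2 : c (5 ^ 2 / 2 ^ (3 + 2)) = -1 :=
      hneg _ (7 / 32) 1 _ (by norm_num) (by rw [hv32b]; norm_num)
    have c3 : c (5 ^ 3 / 2 ^ (3 + 2)) = -1 :=
      hneg _ (3 / 32) 4 _ (by norm_num) (by rw [hv32a]; norm_num)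
    have c4 : c (5 ^ 4 / 2 ^ (3 + 2)) = -2 :=
      hneg _ (15 / 32) 20 _ (by norm_num) (by rw [hv32f]; norm_num)
    have c5 : c (5 ^ 5 / 2 ^ (3 + 2)) = -2 :=
      hneg _ (11 / 32) 98 _ (by norm_num) (by rw [hv32e]; norm_num)
    have c6 : c (5 ^ 6 / 2 ^ (3 + 2)) = -1 :=
      hpos _ (9 / 32) 488 _ (by norm_num) (by rw [hv32c]; norm_num)
    have c7 : c (5 ^ 7 / 2 ^ (3 + 2)) = -1 :=
      hpos _ (13 / 32) 2441 _ (by norm_num) (by rw [hv32d]; norm_num)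
    rw [PP, show 2 ^ 3 = 8 from rfl]
    simp only [Finset.sum_range_succ, Finset.sum_range_zero, c0, c1, c2, c3, c4, c5, c6, c7,
      map_zero, map_neg, map_one, map_ofNat]
    ring
  have hmain : ∀ k : ℕ, 2 ≤ k → ∃ U V : ℤ[X],
      PP k (fun j => c (5 ^ j / 2 ^ (k + 2))) = (X - 1) ^ (qseq k) * U + 2 * V ∧
        Odd (U.eval 1) := by
    intro k
    induction k using Nat.strong_induction_on with
    | _ k ih =>
      intro hk
      obtain rfl | rfl | hk4 : k = 2 ∨ k = 3 ∨ 4 ≤ k := by omega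
      · have hq : qseq 2 = 1 := by simp [qseq]
        refine ⟨-X ^ 2, -X ^ 2, ?_, by simp⟩
        rw [hP2, hq]
        ring
      · have hq : qseq 3 = 5 := by simp [qseq, show Odd 3 by decide]
        refine ⟨-X ^ 2, -X ^ 2 * (3 * X ^ 4 - 4 * X ^ 3 + 6 * X ^ 2 - 2 * X + 1), ?_, by simp⟩
        rw [hP3, hq]
        ring
      · obtain ⟨m, rfl⟩ : ∃ m, k = m + 2 := ⟨k - 2, by omega⟩
        obtain ⟨q1, q2, -⟩ := qseq_facts m (by omega)
        rw [q1]
        refine poly_step m _ _ ?_ ?_ q2 (ih m (by omega) (by omega))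
        · intro j
          apply hcS
          rw [S_five_period hSper, hc]
        · intro j
          have h := S_rel hN hS0 hSper hHecke ha2 hv2 m j
          rw [hc, hc (5 ^ (j + 2 ^ (m + 1)) / 2 ^ (m + 4)), hc (5 ^ j / 2 ^ (m + 2))] at h
          have h' : (c (5 ^ j / 2 ^ (m + 4)) : ℚ) + c (5 ^ (j + 2 ^ (m + 1)) / 2 ^ (m + 4))
            = -c (5 ^ j / 2 ^ (m + 2)) - 2 := by linarith
          exact_mod_cast h'
  refine ⟨?_, ?_⟩
  · rintro rfl
    rw [hP1, map_zero]
  · intro h2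
    obtain ⟨m, rfl⟩ : ∃ m, n = m + 1 := ⟨n - 1, by omega⟩
    by_cases h3 : m + 1 = 3
    · obtain rfl : m = 2 := by omega
      have hq : qseq 3 = 5 := by simp [qseq, show Odd 3 by decide]
      have := val_three hζ
      rw [hP3, hq]
      simpa using this
    · obtain ⟨U, V, hP, hU⟩ := hmain (m + 1) h2
      exact val_small hζ hU ((qseq_facts (m + 1) h2).2.2 h3) hP
end

section
/- For each integer n ≥ 1 define Ξ_n(m) = ∑_{x ∈ (ℤ/2^{n+2}mℤ)ˣ} χ(x)·ψ_n(x)·S(x/(2^{n+2}m)) ∈ ℚ₂(ζ_{2^n}), where χ and ψ_n are evaluated on x via reduction modulo m and modulo 2^{n+2} respectively. Then for every integer n ≥ 2, v(Ξ_n(m)) = q_n/2^{n−1}. -/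
/-- The twisted cyclotomic specialization
`Ξ_n(m) = ∑_{x ∈ (ℤ/2^{n+2}mℤ)ˣ} χ(x)·ψ_n(x)·S(x/(2^{n+2}m))`, where `χ = (·|m)` is the
Jacobi symbol and `ψ_n` is evaluated via reduction modulo `2^{n+2}`. -/
noncomputable def XiM (S : ℚ → ℚ) {K : Type*} [Field K] (n m : ℕ)
    [NeZero (2 ^ (n + 2) * m)] (ψ : (ZMod (2 ^ (n + 2)))ˣ →* K) : K :=
  ∑ x : (ZMod (2 ^ (n + 2) * m))ˣ,
    ((jacobiSym ((x : ZMod (2 ^ (n + 2) * m)).val : ℤ) m : ℤ) : K) *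
      ψ (Units.map
          (ZMod.castHom (dvd_mul_right (2 ^ (n + 2)) m) (ZMod (2 ^ (n + 2)))).toMonoidHom x) *
      (S (((x : ZMod (2 ^ (n + 2) * m)).val : ℚ) / ((2 ^ (n + 2) * m : ℕ) : ℚ)) : K)

theorem aux_pi_pow {A : Type*} [CommRing A] (z : A) (k : ℕ) (hz : z ^ (2 ^ k) = -1) :
    ∃ r, (z - 1) ^ (2 ^ k) = -2 * (1 + (z - 1) * r) := by
  obtain ⟨r, hr⟩ := exists_add_pow_prime_pow_eq Nat.prime_two (z - 1) 1 k
  refine ⟨r, ?_⟩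
  rw [sub_add_cancel, hz, one_pow] at hr
  push_cast at hr
  linear_combination -hr

theorem aux_prim {K : Type*} [Field K] (ζ : K) (k : ℕ) (hζ : IsPrimitiveRoot ζ (2 ^ (k + 1))) :
    ζ ^ (2 ^ k) = -1 := by
  have h1 : (ζ ^ (2 ^ k)) ^ 2 = 1 := by
    rw [← pow_mul, ← pow_succ]; exact hζ.pow_eq_one
  rcases eq_or_eq_neg_of_sq_eq_sq _ (1 : K) (by rw [h1, one_pow]) with h | h
  · exfalso
    have := hζ.dvd_of_pow_eq_one _ h
    have h3 := Nat.le_of_dvd (by positivity) this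
    rw [pow_succ] at h3
    have : 0 < 2 ^ k := by positivity
    omega
  · exact h

theorem aux_exists_O (K : Type*) [Field K] [Algebra ℚ_[2] K] [FiniteDimensional ℚ_[2] K]
    (ζ : K) (k : ℕ) (hζ : ζ ^ (2 ^ k) = -1) :
    ∃ O : Subring K, ζ ∈ O ∧
      (∀ u : ℤ, Odd u → ∀ y ∈ O, (u : K) + (ζ - 1) * y ≠ 0 ∧ ((u : K) + (ζ - 1) * y)⁻¹ ∈ O) ∧
      (∀ (e : ℕ) (w : K), w ∈ O → w⁻¹ ∈ O → w ≠ 0 →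
        vK ((ζ - 1) ^ e * w) = (e : ℚ) / (2 ^ k : ℚ)) := by
  let _ : Algebra ℤ_[2] K := ((algebraMap ℚ_[2] K).comp (algebraMap ℤ_[2] ℚ_[2])).toAlgebra
  have : IsScalarTower ℤ_[2] ℚ_[2] K := IsScalarTower.of_algebraMap_eq (fun x => rfl)
  have : CharZero K := charZero_of_injective_algebraMap (algebraMap ℚ_[2] K).injective
  have hζint : IsIntegral ℤ_[2] ζ := by
    refine IsIntegral.of_pow (n := 2 ^ k) (by positivity) ?_
    rw [hζ]
    exact isIntegral_one.neg
  -- unit lemma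
  have hunit : ∀ u : ℤ, Odd u → ∀ y ∈ integralClosure ℤ_[2] K,
      (u : K) + (ζ - 1) * y ≠ 0 ∧ ((u : K) + (ζ - 1) * y)⁻¹ ∈ integralClosure ℤ_[2] K := by
    intro u hu y hy
    let z : integralClosure ℤ_[2] K := ⟨ζ, hζint⟩
    let y' : integralClosure ℤ_[2] K := ⟨y, hy⟩
    have hz : z ^ (2 ^ k) = -1 := Subtype.ext (by simpa [z] using hζ)
    have hU : IsUnit ((u : integralClosure ℤ_[2] K) + (z - 1) * y') := by
      by_contra hnu
      obtain ⟨m, hm, hmem⟩ := exists_max_ideal_of_mem_nonunits hnu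
      have hmax := Ideal.isMaximal_comap_of_isIntegral_of_isMaximal (R := ℤ_[2]) m
      have h2 : (2 : integralClosure ℤ_[2] K) ∈ m := by
        have h := IsLocalRing.eq_maximalIdeal hmax
        rw [PadicInt.maximalIdeal_eq_span_p] at h
        have h3 : ((2 : ℕ) : ℤ_[2]) ∈ Ideal.comap (algebraMap ℤ_[2] (integralClosure ℤ_[2] K)) m := by
          rw [h]; exact Ideal.mem_span_singleton_self _
        rw [Ideal.mem_comap, map_natCast] at h3
        exact_mod_cast h3
      obtain ⟨r, hr⟩ := aux_pi_pow z k hz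
      have hpi : z - 1 ∈ m := by
        apply hm.isPrime.mem_of_pow_mem (2 ^ k)
        rw [hr]
        exact Ideal.mul_mem_right _ _ (neg_mem h2)
      have hum : (u : integralClosure ℤ_[2] K) ∈ m := by
        have := sub_mem hmem (Ideal.mul_mem_right y' _ hpi)
        simpa using this
      obtain ⟨c, rfl⟩ := hu
      apply hm.ne_top
      rw [Ideal.eq_top_iff_one]
      have := sub_mem hum (Ideal.mul_mem_right (c : integralClosure ℤ_[2] K) _ h2)
      simpa using this
    obtain ⟨w, hw⟩ := hU.exists_right_inv
    have hw' : ((u : K) + (ζ - 1) * y) * (w : K) = 1 := by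
      have := congrArg (Subtype.val) hw
      simpa [z, y'] using this
    have hne : (u : K) + (ζ - 1) * y ≠ 0 := left_ne_zero_of_mul_eq_one hw'
    refine ⟨hne, ?_⟩
    rw [inv_eq_of_mul_eq_one_right hw']
    exact w.2
  have hnint : ∀ w ∈ integralClosure ℤ_[2] K, ‖Algebra.norm ℚ_[2] w‖ ≤ 1 := by
    intro w hw
    have h := Algebra.isIntegral_norm ℚ_[2] (R := ℤ_[2]) (x := w) hw
    obtain ⟨y, hy⟩ := IsIntegrallyClosed.isIntegral_iff.mp h
    rw [← hy]
    exact y.2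
  have hval0 : ∀ w ∈ integralClosure ℤ_[2] K, w⁻¹ ∈ integralClosure ℤ_[2] K → w ≠ 0 →
      (Algebra.norm ℚ_[2] w).valuation = 0 := by
    intro w h1 h2 h0
    have a1 := (Padic.norm_le_one_iff_val_nonneg _).mp (hnint w h1)
    have a2 := (Padic.norm_le_one_iff_val_nonneg _).mp (hnint _ h2)
    have h3 : Algebra.norm ℚ_[2] w * Algebra.norm ℚ_[2] w⁻¹ = 1 := by
      rw [← map_mul, mul_inv_cancel₀ h0, map_one]
    rw [eq_inv_of_mul_eq_one_right h3, Padic.valuation_inv] at a2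
    omega
  have hz1 : ζ - 1 ≠ 0 := by
    intro h
    rw [sub_eq_zero.mp h, one_pow] at hζ
    have : (2 : K) = 0 := by linear_combination hζ
    norm_num at this
  have hNne : ∀ x : K, x ≠ 0 → Algebra.norm ℚ_[2] x ≠ 0 := fun x hx => by
    simpa [Algebra.norm_eq_zero_iff] using hx
  refine ⟨(integralClosure ℤ_[2] K).toSubring, hζint, hunit, ?_⟩
  intro e w hw hwi hw0
  obtain ⟨r, hr⟩ := aux_pi_pow (⟨ζ, hζint⟩ : integralClosure ℤ_[2] K) k
    (Subtype.ext (by simpa using hζ))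
  have hr' : (ζ - 1) ^ (2 ^ k) = algebraMap ℚ_[2] K 2 * (((-1 : ℤ) : K) + (ζ - 1) * (-(r : K))) := by
    have := congrArg (Subtype.val) hr
    have h2 : ((2 : integralClosure ℤ_[2] K) : K) = 2 := rfl
    simp [h2] at this
    rw [map_ofNat]
    push_cast
    linear_combination this
  have hu := hunit (-1) (by decide) (-(r : K)) (neg_mem r.2)
  have hv : (2 ^ k : ℤ) * (Algebra.norm ℚ_[2] (ζ - 1)).valuation = Module.finrank ℚ_[2] K := by
    have h := congrArg (fun x => (Algebra.norm ℚ_[2] x).valuation) hr'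
    simp only [map_pow, map_mul, Algebra.norm_algebraMap, Padic.valuation_pow] at h
    rw [Padic.valuation_mul (pow_ne_zero _ two_ne_zero) (hNne _ hu.1), Padic.valuation_pow, hval0 _ ?_ hu.2 hu.1] at h
    · have h2 : (2 : ℚ_[2]).valuation = 1 := by
        have := Padic.valuation_p (p := 2)
        exact_mod_cast this
      rw [h2] at h
      push_cast at h
      linarith
    · refine add_mem (intCast_mem _ _) (mul_mem (sub_mem hζint (one_mem _)) (neg_mem r.2))
  unfold vK
  rw [map_mul, map_pow, Padic.valuation_mul (pow_ne_zero _ (hNne _ hz1)) (hNne _ hw0),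
    Padic.valuation_pow, hval0 w hw hwi hw0]
  have hfin : 0 < Module.finrank ℚ_[2] K := Module.finrank_pos
  have hv' : (2 ^ k : ℚ) * ((Algebra.norm ℚ_[2] (ζ - 1)).valuation : ℚ) = Module.finrank ℚ_[2] K := by
    exact_mod_cast hv
  rw [div_eq_div_iff (by positivity) (by positivity)]
  rw [← hv']
  push_cast
  ring

theorem aux_per_mod {K : Type*} {M : ℕ} {h : ℤ → K} (hper : ∀ x, h (x + M) = h x)
    {x y : ℤ} (hxy : x ≡ y [ZMOD M]) : h x = h y := by
  obtain ⟨c, hc⟩ := hxy.dvd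
  have hp : Function.Periodic h (M : ℤ) := hper
  have h1 := (hp.int_mul c) x
  rw [← h1]
  congr 1
  push_cast
  linarith

theorem aux_sum_zmod {K : Type*} [AddCommMonoid K] (M : ℕ) [NeZero M] (h : ℤ → K) :
    ∑ x ∈ Finset.range M, h (x : ℤ) = ∑ z : ZMod M, h ((z.val : ℕ) : ℤ) := by
  refine Finset.sum_bij' (fun x _ => (x : ZMod M)) (fun z _ => z.val) ?_ ?_ ?_ ?_ ?_
  · intros; simp
  · intro z _; simpa using ZMod.val_lt z
  · intro x hx; simpa using ZMod.val_cast_of_lt (Finset.mem_range.mp hx)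
  · intro z _; simp
  · intro x hx; simp [ZMod.val_cast_of_lt (Finset.mem_range.mp hx)]

theorem aux_per_unit {K : Type*} [AddCommMonoid K] (M : ℕ) [NeZero M] (h : ℤ → K)
    (hper : ∀ x, h (x + M) = h x) (u : ℤ) (hu : IsCoprime u (M : ℤ)) :
    ∑ x ∈ Finset.range M, h (u * (x : ℤ)) = ∑ x ∈ Finset.range M, h (x : ℤ) := by
  rw [aux_sum_zmod M h, aux_sum_zmod M (fun x => h (u * x))]
  have hun : IsUnit ((u : ℤ) : ZMod M) := by
    obtain ⟨a, b, hab⟩ := hu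
    refine IsUnit.of_mul_eq_one (a : ZMod M) ?_
    have := congrArg (Int.cast : ℤ → ZMod M) hab
    push_cast at this
    rw [ZMod.natCast_self, mul_zero, add_zero] at this
    rw [mul_comm]; exact this
  obtain ⟨U, hU⟩ := hun
  rw [← Equiv.sum_comp (Units.mulLeft U) (fun z : ZMod M => h ((z.val : ℕ) : ℤ))]
  refine Finset.sum_congr rfl fun z _ => ?_
  apply aux_per_mod hper
  rw [← ZMod.intCast_eq_intCast_iff]
  simp [hU]

theorem aux_split {K : Type*} [AddCommMonoid K] (M l : ℕ) (g : ℕ → K) :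
    ∑ x ∈ Finset.range (M * l), g x =
      ∑ j ∈ Finset.range l, ∑ y ∈ Finset.range M, g (y + M * j) := by
  induction l with
  | zero => simp
  | succ l ih =>
    rw [Nat.mul_succ, Finset.sum_range_add, ih, Finset.sum_range_succ]
    simp [add_comm]

theorem aux_drop {K : Type*} [AddCommGroup K] (M l : ℕ) (hl : 0 < l) (g : ℤ → K) :
    ∑ x ∈ Finset.range (M * l), (if (l : ℤ) ∣ (x : ℤ) then 0 else g x) =
      ∑ x ∈ Finset.range (M * l), g (x : ℤ) - ∑ y ∈ Finset.range M, g ((l : ℤ) * y) := by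
  rw [eq_sub_iff_add_eq]
  have h : ∑ y ∈ Finset.range M, g ((l : ℤ) * y) =
      ∑ x ∈ Finset.range (M * l), (if (l : ℤ) ∣ (x : ℤ) then g x else 0) := by
    rw [mul_comm M l, aux_split l M]
    refine Finset.sum_congr rfl fun y _ => ?_
    rw [Finset.sum_eq_single 0]
    · simp
    · intro b hb hb0
      rw [if_neg]
      intro hd
      have hd' : l ∣ b + l * y := by exact_mod_cast hd
      have := (Nat.dvd_add_left (dvd_mul_right l y)).mp hd'
      exact hb0 (Nat.eq_zero_of_dvd_of_lt this (Finset.mem_range.mp hb))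
    · intro h0; exact absurd (Finset.mem_range.mpr hl) h0
  rw [h, ← Finset.sum_add_distrib]
  refine Finset.sum_congr rfl fun x _ => ?_
  split_ifs <;> simp

theorem aux_S_per {S : ℚ → ℚ} (hSper : ∀ β : ℚ, S (β + 1) = S β) (β : ℚ) (k : ℤ) :
    S (β + k) = S β := by
  have hp : Function.Periodic S 1 := hSper
  simpa using (hp.int_mul k) β

theorem aux_S_perM {S : ℚ → ℚ} (hSper : ∀ β : ℚ, S (β + 1) = S β) (M : ℕ) (hM : M ≠ 0) (x : ℤ) :
    S (((x + M : ℤ) : ℚ) / M) = S ((x : ℚ) / M) := by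
  rw [← hSper ((x : ℚ) / M)]
  congr 1
  have : (M : ℚ) ≠ 0 := by exact_mod_cast hM
  push_cast
  field_simp

theorem aux_den (x : ℤ) (M N : ℕ) (hM : Nat.Coprime M N) :
    Nat.Coprime ((x : ℚ) / M).den N := by
  refine Nat.Coprime.coprime_dvd_left ?_ hM
  have := Rat.den_dvd x M
  rw [Rat.divInt_eq_div] at this
  exact_mod_cast this

theorem aux_hecke {K : Type*} [Field K] [CharZero K] (N : ℕ) (a : ℕ → ℤ) (S : ℚ → ℚ)
    (hSper : ∀ β : ℚ, S (β + 1) = S β) (l : ℕ) (hl : l.Prime)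
    (hHecke : ∀ β : ℚ, Nat.Coprime β.den N →
      ∑ x ∈ Finset.range l, S ((β + (x : ℚ)) / (l : ℚ)) =
        (a l : ℚ) * S β - S ((l : ℚ) * β) + ∑ x ∈ Finset.range l, S ((x : ℚ) / (l : ℚ)))
    (M : ℕ) [NeZero M] (hM : Nat.Coprime M N) (hlM : Nat.Coprime l M)
    (f : ℤ → K) (hper : ∀ x, f (x + M) = f x) (hmul : ∀ x y, f (x * y) = f x * f y)
    (hsum : ∑ x ∈ Finset.range M, f (x : ℤ) = 0) (l' : ℤ) (hl' : f l * f l' = 1) :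
    ∑ x ∈ Finset.range (M * l), (if (l : ℤ) ∣ (x : ℤ) then 0 else f x) *
        (S ((x : ℚ) / ((M * l : ℕ) : ℚ)) : K) =
      ((a l : K) - f l - f l') * ∑ x ∈ Finset.range M, f x * (S ((x : ℚ) / (M : ℚ)) : K) := by
  have hM0 : (M : ℚ) ≠ 0 := by exact_mod_cast NeZero.ne M
  have hl0 : (l : ℚ) ≠ 0 := by exact_mod_cast hl.ne_zero
  have e1 := aux_drop M l hl.pos (fun x => f x * (S ((x : ℚ) / ((M * l : ℕ) : ℚ)) : K))
  have e0 : ∑ x ∈ Finset.range (M * l), (if (l : ℤ) ∣ (x : ℤ) then 0 else f x) *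
        (S ((x : ℚ) / ((M * l : ℕ) : ℚ)) : K) =
      ∑ x ∈ Finset.range (M * l), (if (l : ℤ) ∣ (x : ℤ) then 0 else
        f x * (S (((x : ℤ) : ℚ) / ((M * l : ℕ) : ℚ)) : K)) := by
    refine Finset.sum_congr rfl fun x _ => ?_
    split_ifs <;> simp
  rw [e0, e1]
  have e2 : ∑ y ∈ Finset.range M, f ((l : ℤ) * y) *
      (S ((((l : ℤ) * (y : ℤ) : ℤ) : ℚ) / ((M * l : ℕ) : ℚ)) : K) =
      f l * ∑ x ∈ Finset.range M, f x * (S ((x : ℚ) / (M : ℚ)) : K) := by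
    rw [Finset.mul_sum]
    refine Finset.sum_congr rfl fun y _ => ?_
    rw [hmul, mul_assoc]
    congr 4
    push_cast
    field_simp
  have e3 : ∑ x ∈ Finset.range M, f x * (S ((l : ℚ) * ((x : ℚ) / (M : ℚ))) : K) =
      f l' * ∑ x ∈ Finset.range M, f x * (S ((x : ℚ) / (M : ℚ)) : K) := by
    have := aux_per_unit M (fun x : ℤ => f x * (S ((x : ℚ) / (M : ℚ)) : K))
      (fun x => by simp only [hper, aux_S_perM hSper M (NeZero.ne M)]) (l : ℤ)
      (by exact_mod_cast Nat.isCoprime_iff_coprime.mpr hlM)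
    simp only [Int.cast_natCast] at this
    rw [← this, Finset.mul_sum]
    refine Finset.sum_congr rfl fun y _ => ?_
    rw [hmul, ← mul_assoc, ← mul_assoc, mul_comm (f l'), hl', one_mul]
    congr 3
    push_cast
    field_simp
  have e4 : ∑ x ∈ Finset.range (M * l), f x * (S (((x : ℤ) : ℚ) / ((M * l : ℕ) : ℚ)) : K) =
      ∑ y ∈ Finset.range M, f y * ((a l : K) * (S ((y : ℚ) / (M : ℚ)) : K) -
        (S ((l : ℚ) * ((y : ℚ) / (M : ℚ))) : K) +
          ((∑ x ∈ Finset.range l, S ((x : ℚ) / (l : ℚ)) : ℚ) : K)) := by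
    rw [aux_split, Finset.sum_comm]
    refine Finset.sum_congr rfl fun y _ => ?_
    have hh := hHecke ((y : ℚ) / M) (by exact_mod_cast aux_den (y : ℤ) M N hM)
    have hh' := congrArg (fun r : ℚ => (r : K)) hh
    simp only [Rat.cast_add, Rat.cast_sub, Rat.cast_mul, Rat.cast_intCast] at hh'
    rw [← hh', Rat.cast_sum, Finset.mul_sum]
    refine Finset.sum_congr rfl fun j _ => ?_
    have : f ((y + M * j : ℕ) : ℤ) = f y := by
      apply aux_per_mod hper
      push_cast
      simp [Int.ModEq]
    rw [this]
    congr 3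
    push_cast
    field_simp
  rw [e4, e2]
  simp only [mul_add, mul_sub, Finset.sum_add_distrib, Finset.sum_sub_distrib]
  rw [e3, ← Finset.sum_mul, hsum]
  have : ∑ x ∈ Finset.range M, f (x : ℤ) * ((a l : K) * (S ((x : ℚ) / (M : ℚ)) : K)) =
     (a l : K) * ∑ x ∈ Finset.range M, f x * (S ((x : ℚ) / (M : ℚ)) : K) := by
    rw [Finset.mul_sum]
    exact Finset.sum_congr rfl fun y _ => by ring
  rw [this]
  ring

theorem aux_qseq_lt (k : ℕ) : qseq (k + 2) < 2 ^ (k + 2) := by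
  unfold qseq
  have h : 4 ≤ 2 ^ (k + 2) := by
    calc 4 = 2 ^ 2 := by norm_num
      _ ≤ _ := Nat.pow_le_pow_right (by norm_num) (by omega)
  rw [if_neg (by omega)]
  split_ifs with ho
  · have : 1 ≤ k := by
      rcases Nat.eq_zero_or_pos k with rfl | h
      · exact absurd ho (by decide)
      · exact h
    have h : 8 ≤ 2 ^ (k + 2) := by
      calc 8 = 2 ^ 3 := by norm_num
        _ ≤ _ := Nat.pow_le_pow_right (by norm_num) (by omega)
    omega
  · omega

theorem aux_pow_mod (k : ℕ) : (Even k → 2 ^ k % 3 = 1) ∧ (Odd k → 2 ^ k % 3 = 2) := by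
  induction k with
  | zero => simp
  | succ k ih =>
    constructor
    · intro h
      have : Odd k := by
        rcases Nat.even_or_odd k with h' | h'
        · exact absurd h (by simpa [Nat.even_add_one] using h')
        · exact h'
      have := ih.2 this
      rw [pow_succ]; omega
    · intro h
      have : Even k := by
        rcases Nat.even_or_odd k with h' | h'
        · exact h'
        · exact absurd h (by simpa [Nat.odd_add_one] using h')
      have := ih.1 this
      rw [pow_succ]; omega

theorem aux_qseq_step (k : ℕ) : qseq (k + 2 + 2) = qseq (k + 2) + 2 ^ (k + 2) := by
  unfold qseq
  rw [if_neg (show ¬ (k + 2 + 2 = 1) by omega), if_neg (show ¬ (k + 2 = 1) by omega)]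
  have e : 2 ^ (k + 2 + 2) = 4 * 2 ^ (k + 2) := by rw [pow_add _ (k + 2) 2]; ring
  have hpm := aux_pow_mod (k + 2)
  by_cases ho : Odd (k + 2)
  · have ho' : Odd (k + 2 + 2) := by rw [Nat.odd_add]; simpa using ho
    rw [if_pos ho, if_pos ho', e]
    have := hpm.2 ho
    omega
  · have ho' : ¬ Odd (k + 2 + 2) := by rw [Nat.odd_add]; simpa using ho
    rw [if_neg ho, if_neg ho', e]
    have := hpm.1 (Nat.not_odd_iff_even.mp ho)
    omega

open Polynomial in
theorem aux_poly_step (n q : ℕ) (hq : q < 2 ^ n) (c0 c2 : ℕ → ℤ)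
    (hper : ∀ i, c0 (i + 2 ^ n) = c0 i)
    (hrec : ∀ i, c2 (i + 2 ^ (n + 1)) = -c2 i - c0 i - 2)
    (h : ∃ U V : ℤ[X], ∑ i ∈ Finset.range (2 ^ n), C (c0 i) * X ^ i = (X - 1) ^ q * U + 2 * V ∧
      Odd (U.eval 1)) :
    ∃ U V : ℤ[X], ∑ i ∈ Finset.range (2 ^ (n + 2)), C (c2 i) * X ^ i =
      (X - 1) ^ (q + 2 ^ n) * U + 2 * V ∧ Odd (U.eval 1) := by
  obtain ⟨U, V, hUV, hodd⟩ := h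
  obtain ⟨d, hd⟩ : ∃ d, 2 ^ n = q + (d + 1) := ⟨2 ^ n - q - 1, by omega⟩
  obtain ⟨r, hr⟩ := exists_add_pow_prime_pow_eq Nat.prime_two (X - 1 : ℤ[X]) 1 (n + 1)
  obtain ⟨s, hs⟩ := exists_add_pow_prime_pow_eq Nat.prime_two (X - 1 : ℤ[X]) 1 n
  rw [sub_add_cancel, one_pow] at hr hs
  push_cast at hr hs
  set A : ℤ[X] := ∑ i ∈ Finset.range (2 ^ (n + 1)), C (c2 i) * X ^ i with hA
  set E : ℤ[X] := ∑ i ∈ Finset.range (2 ^ (n + 1)), X ^ i with hE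
  have hB : ∑ i ∈ Finset.range (2 ^ (n + 1)), C (c0 i) * X ^ i =
      (1 + X ^ (2 ^ n)) * ∑ i ∈ Finset.range (2 ^ n), C (c0 i) * X ^ i := by
    rw [show 2 ^ (n + 1) = 2 ^ n + 2 ^ n by ring, Finset.sum_range_add, add_mul, one_mul,
      Finset.mul_sum]
    congr 1
    refine Finset.sum_congr rfl fun i _ => ?_
    rw [add_comm (2 ^ n) i, hper, pow_add]
    ring
  have hP : ∑ i ∈ Finset.range (2 ^ (n + 2)), C (c2 i) * X ^ i =
      A + X ^ (2 ^ (n + 1)) * (-A - ∑ i ∈ Finset.range (2 ^ (n + 1)), C (c0 i) * X ^ i - 2 * E) := by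
    rw [show 2 ^ (n + 2) = 2 ^ (n + 1) + 2 ^ (n + 1) by ring, Finset.sum_range_add, ← hA]
    congr 1
    rw [hA, hE, Finset.mul_sum, ← Finset.sum_neg_distrib, ← Finset.sum_sub_distrib,
      ← Finset.sum_sub_distrib, Finset.mul_sum]
    refine Finset.sum_congr rfl fun i _ => ?_
    rw [add_comm (2 ^ (n + 1)) i, hrec, pow_add]
    simp only [map_sub, map_neg, map_ofNat]
    ring
  have hTT : (X - 1 : ℤ[X]) ^ 2 ^ (n + 1) = (X - 1) ^ (q + 2 ^ n) * (X - 1) ^ (d + 1) := by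
    rw [← pow_add]
    congr 1
    rw [pow_succ]; omega
  refine ⟨-(X - 1) ^ (d + 1) * A - X ^ (2 ^ (n + 1)) * U,
    -((X - 1) * r) * A - X ^ (2 ^ (n + 1)) * ((1 + (X - 1) * s) * ((X - 1) ^ q * U + 2 * V)
      + (X - 1) ^ (2 ^ n) * V) - X ^ (2 ^ (n + 1)) * E, ?_, ?_⟩
  · rw [hP, hB, hUV, pow_add (X - 1 : ℤ[X]) q]
    have h1 : (1 : ℤ[X]) + X ^ 2 ^ n = (X - 1) ^ 2 ^ n + 2 + 2 * ((X - 1) * s) := by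
      rw [hs]; ring
    rw [h1]
    rw [pow_add (X - 1 : ℤ[X]) q] at hTT
    have h2 : (X : ℤ[X]) ^ 2 ^ (n + 1) = (X - 1) ^ q * (X - 1) ^ (2 ^ n) * (X - 1) ^ (d + 1) + 1 +
        2 * ((X - 1) * r) := by rw [hr, hTT]; ring
    linear_combination (-A) * h2
  · simp
    exact hodd

theorem aux_five_pow (k : ℕ) : ∃ j : ℤ, (5 : ℤ) ^ (2 ^ k) = 1 + 2 ^ (k + 2) * (2 * j + 1) := by
  induction k with
  | zero => exact ⟨0, by norm_num⟩
  | succ k ih =>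
    obtain ⟨j, hj⟩ := ih
    refine ⟨j + 2 ^ k * (2 * j + 1) ^ 2, ?_⟩
    rw [pow_succ, pow_mul, hj]
    ring

theorem aux_S_two {N : ℕ} (hN : Odd N) {a : ℕ → ℤ} {S : ℚ → ℚ} (hS0 : S 0 = 0)
    (hHecke : ∀ ℓ : ℕ, ℓ.Prime → ¬(ℓ ∣ N) → ∀ β : ℚ, Nat.Coprime β.den N →
      ∑ x ∈ Finset.range ℓ, S ((β + (x : ℚ)) / (ℓ : ℚ)) =
        (a ℓ : ℚ) * S β - S ((ℓ : ℚ) * β) + ∑ x ∈ Finset.range ℓ, S ((x : ℚ) / (ℓ : ℚ)))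
    (ha2 : a 2 = 0) (hv2 : S (1 / 2) = -1) (β : ℚ) (hβ : Nat.Coprime β.den N) :
    S (β / 2) + S ((β + 1) / 2) = -S (2 * β) - 1 := by
  have h := hHecke 2 Nat.prime_two (by
    obtain ⟨k, rfl⟩ := hN
    omega) β hβ
  simp only [Finset.sum_range_succ, Finset.sum_range_zero] at h
  norm_num [ha2, hS0] at h
  norm_num at hv2
  rw [hv2] at h
  linarith

theorem aux_c_per {S : ℚ → ℚ} (hSper : ∀ β : ℚ, S (β + 1) = S β) (n i : ℕ) :
    S ((5 : ℚ) ^ (i + 2 ^ n) / 2 ^ (n + 2)) = S ((5 : ℚ) ^ i / 2 ^ (n + 2)) := by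
  obtain ⟨j, hj⟩ := aux_five_pow n
  rw [← aux_S_per hSper ((5 : ℚ) ^ i / 2 ^ (n + 2)) (5 ^ i * (2 * j + 1))]
  congr 1
  have hj' : (5 : ℚ) ^ (2 ^ n) = 1 + 2 ^ (n + 2) * (2 * j + 1) := by exact_mod_cast hj
  rw [pow_add, hj']
  push_cast
  field_simp

theorem aux_c_rec {N : ℕ} (hN : Odd N) {S : ℚ → ℚ} (hSper : ∀ β : ℚ, S (β + 1) = S β)
    (h2 : ∀ β : ℚ, Nat.Coprime β.den N → S (β / 2) + S ((β + 1) / 2) = -S (2 * β) - 1)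
    (n i : ℕ) :
    S ((5 : ℚ) ^ (i + 2 ^ (n + 1)) / 2 ^ (n + 2 + 2)) =
      -S ((5 : ℚ) ^ i / 2 ^ (n + 2 + 2)) - S ((5 : ℚ) ^ i / 2 ^ (n + 2)) - 1 := by
  obtain ⟨j, hj⟩ := aux_five_pow (n + 1)
  have hj' : (5 : ℚ) ^ (2 ^ (n + 1)) = 1 + 2 ^ (n + 1 + 2) * (2 * j + 1) := by exact_mod_cast hj
  obtain ⟨s, hs⟩ : ∃ s : ℤ, (5 : ℤ) ^ i = 2 * s + 1 := (by decide : Odd (5 : ℤ)).pow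
  have hs' : (5 : ℚ) ^ i = 2 * s + 1 := by exact_mod_cast hs
  have h := h2 ((5 : ℚ) ^ i / 2 ^ (n + 3)) (by
    have hc : Nat.Coprime (2 ^ (n + 3)) N := by
      apply Nat.Coprime.pow_left
      exact (Nat.coprime_two_left).mpr hN
    have := aux_den (5 ^ i) (2 ^ (n + 3)) N hc
    push_cast at this
    exact this)
  have e1 : S ((5 : ℚ) ^ (i + 2 ^ (n + 1)) / 2 ^ (n + 2 + 2)) =
      S (((5 : ℚ) ^ i / 2 ^ (n + 3) + 1) / 2) := by
    rw [← aux_S_per hSper (((5 : ℚ) ^ i / 2 ^ (n + 3) + 1) / 2) (s * (2 * j + 1) + j)]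
    congr 1
    rw [pow_add, hj']
    have e : (5 : ℚ) ^ i * (1 + 2 ^ (n + 1 + 2) * (2 * j + 1)) = 5 ^ i +
      2 ^ (n + 1 + 2) * (2 * j + 1) * (2 * s + 1) := by rw [mul_add, ← hs']; ring
    rw [e]
    push_cast
    field_simp
    ring
  have e2 : (5 : ℚ) ^ i / 2 ^ (n + 2 + 2) = (5 : ℚ) ^ i / 2 ^ (n + 3) / 2 := by
    field_simp
    ring
  have e3 : (5 : ℚ) ^ i / 2 ^ (n + 2) = 2 * ((5 : ℚ) ^ i / 2 ^ (n + 3)) := by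
    field_simp
    ring
  rw [e1, e2, e3]
  linarith

open Polynomial in
theorem aux_poly {N : ℕ} (hN : Odd N) {S : ℚ → ℚ} (hSper : ∀ β : ℚ, S (β + 1) = S β)
    (hSneg : ∀ β : ℚ, S (-β) = S β)
    (h2 : ∀ β : ℚ, Nat.Coprime β.den N → S (β / 2) + S ((β + 1) / 2) = -S (2 * β) - 1)
    (hv16a : S (1 / 16) = 0) (hv16b : S (5 / 16) = 0)
    (hv16c : S (3 / 16) = -(1 / 2)) (hv16d : S (7 / 16) = -(1 / 2))
    (hv32a : S (3 / 32) = -(1 / 2)) (hv32b : S (7 / 32) = -(1 / 2))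
    (hv32c : S (9 / 32) = -(1 / 2)) (hv32d : S (13 / 32) = -(1 / 2))
    (hv32e : S (11 / 32) = -1) (hv32f : S (15 / 32) = -1)
    (hv32g : S (1 / 32) = 0) (hv32h : S (5 / 32) = 0)
    (c : ℕ → ℕ → ℤ) (hc : ∀ n i, S ((5 : ℚ) ^ i / 2 ^ (n + 2)) = (c n i : ℚ) / 2) :
    (∑ i ∈ Finset.range (2 ^ 3), C (c 3 i) * X ^ i =
      (-(X ^ 2 + X ^ 3 + X ^ 6 + X ^ 7) - 2 * (X ^ 4 + X ^ 5) : ℤ[X])) ∧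
    ∀ k, ∃ U V : ℤ[X], ∑ i ∈ Finset.range (2 ^ (k + 2)), C (c (k + 2) i) * X ^ i =
      (X - 1) ^ (qseq (k + 2)) * U + 2 * V ∧ Odd (U.eval 1) := by
  have key : ∀ (n i : ℕ) (β : ℚ) (v : ℤ) (k : ℤ), (5 : ℚ) ^ i / 2 ^ (n + 2) = β + k →
      S β = v / 2 → c n i = v := by
    intro n i β v k h1 h3
    have := hc n i
    rw [h1, aux_S_per hSper, h3] at this
    have : (v : ℚ) = c n i := by linarith
    exact_mod_cast this.symm
  have key' : ∀ (n i : ℕ) (β : ℚ) (v : ℤ) (k : ℤ), (5 : ℚ) ^ i / 2 ^ (n + 2) = -β + k →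
      S β = v / 2 → c n i = v := by
    intro n i β v k h1 h3
    exact key n i (-β) v k h1 (by rw [hSneg, h3])
  have a0 : c 2 0 = 0 := key 2 0 _ 0 0 (by norm_num) (hv16a.trans (by norm_num))
  have a1 : c 2 1 = 0 := key 2 1 _ 0 0 (by norm_num) (hv16b.trans (by norm_num))
  have a2 : c 2 2 = -1 := key' 2 2 _ (-1) 2 (by norm_num) (hv16d.trans (by norm_num))
  have a3 : c 2 3 = -1 := key' 2 3 _ (-1) 8 (by norm_num) (hv16c.trans (by norm_num))
  have b0 : c 3 0 = 0 := key 3 0 _ 0 0 (by norm_num) (hv32g.trans (by norm_num))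
  have b1 : c 3 1 = 0 := key 3 1 _ 0 0 (by norm_num) (hv32h.trans (by norm_num))
  have b2 : c 3 2 = -1 := key' 3 2 _ (-1) 1 (by norm_num) (hv32b.trans (by norm_num))
  have b3 : c 3 3 = -1 := key' 3 3 _ (-1) 4 (by norm_num) (hv32a.trans (by norm_num))
  have b4 : c 3 4 = -2 := key' 3 4 _ (-2) 20 (by norm_num) (hv32f.trans (by norm_num))
  have b5 : c 3 5 = -2 := key' 3 5 _ (-2) 98 (by norm_num) (hv32e.trans (by norm_num))
  have b6 : c 3 6 = -1 := key 3 6 _ (-1) 488 (by norm_num) (hv32c.trans (by norm_num))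
  have b7 : c 3 7 = -1 := key 3 7 _ (-1) 2441 (by norm_num) (hv32d.trans (by norm_num))
  have hP3 : ∑ i ∈ Finset.range (2 ^ 3), C (c 3 i) * X ^ i =
      (-(X ^ 2 + X ^ 3 + X ^ 6 + X ^ 7) - 2 * (X ^ 4 + X ^ 5) : ℤ[X]) := by
    norm_num [Finset.sum_range_succ, b0, b1, b2, b3, b4, b5, b6, b7]
    ring
  refine ⟨hP3, ?_⟩
  intro k
  induction k using Nat.twoStepInduction with
  | zero =>
    refine ⟨-X ^ 2, -X ^ 2, ?_, by simp⟩
    rw [show qseq (0 + 2) = 1 by decide]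
    norm_num [Finset.sum_range_succ, a0, a1, a2, a3]
    ring
  | one =>
    refine ⟨-X ^ 2, -(X ^ 4 + X ^ 5) + X ^ 2 * (-3 * X ^ 4 + 5 * X ^ 3 - 5 * X ^ 2 + 2 * X - 1),
      ?_, by simp⟩
    rw [show qseq (1 + 2) = 5 by decide]
    refine hP3.trans ?_
    ring
  | more k ih _ =>
    have hq := aux_qseq_step k
    rw [show k + 1 + 1 + 2 = k + 2 + 2 by ring, hq]
    refine aux_poly_step (k + 2) _ (aux_qseq_lt k) (c (k + 2)) (c (k + 2 + 2)) ?_ ?_ ih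
    · intro i
      have := aux_c_per hSper (k + 2) i
      rw [hc, hc] at this
      have : (c (k + 2) (i + 2 ^ (k + 2)) : ℚ) = c (k + 2) i := by linarith
      exact_mod_cast this
    · intro i
      have := aux_c_rec hN hSper h2 (k + 2) i
      rw [hc, hc, hc] at this
      have : (c (k + 2 + 2) (i + 2 ^ (k + 2 + 1)) : ℚ) =
        -c (k + 2 + 2) i - c (k + 2) i - 2 := by linarith
      exact_mod_cast this

theorem aux_unit_sum {R K : Type*} [CommRing R] [Fintype R] [Fintype Rˣ] [AddCommMonoid K] (g : R → K)
    (hg : ∀ z, ¬ IsUnit z → g z = 0) : ∑ u : Rˣ, g u = ∑ z, g z := by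
  refine Finset.sum_of_injOn (fun u : Rˣ => (u : R)) (fun _ _ _ _ h => Units.ext h)
    (fun _ _ => by simp) ?_ (fun _ _ => rfl)
  intro z _ hz
  apply hg
  rintro ⟨u, rfl⟩
  exact hz ⟨u, by simp, rfl⟩

theorem aux_units_struct (n : ℕ) (u5 : (ZMod (2 ^ (n + 2)))ˣ)
    (h5 : (u5 : ZMod (2 ^ (n + 2))) = 5) :
    Function.Bijective (fun x : Bool × Fin (2 ^ n) =>
      (if x.1 then u5 ^ (x.2 : ℕ) else -u5 ^ (x.2 : ℕ))) := by
  have hord : orderOf u5 = 2 ^ n := by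
    rw [← orderOf_units, h5, ZMod.orderOf_five]
  have h4 : (4 : ℕ) ∣ 2 ^ (n + 2) := ⟨2 ^ n, by ring⟩
  have hno : ∀ i j : ℕ, u5 ^ i ≠ -u5 ^ j := by
    intro i j h
    have h1 := congrArg (fun u : (ZMod (2 ^ (n + 2)))ˣ =>
      ZMod.castHom h4 (ZMod 4) (u : ZMod (2 ^ (n + 2)))) h
    have e : (5 : ZMod 4) = 1 := by decide
    simp only [Units.val_neg, Units.val_pow_eq_pow_val, h5, map_neg, map_pow, map_ofNat, e,
      one_pow] at h1
    exact absurd h1 (by decide)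
  have hinj : ∀ i j : Fin (2 ^ n), u5 ^ (i : ℕ) = u5 ^ (j : ℕ) → i = j := by
    intro i j h
    have := pow_injOn_Iio_orderOf (x := u5) (by simp [hord])
      (by simp [hord]) h
    exact Fin.ext this
  rw [Fintype.bijective_iff_injective_and_card]
  constructor
  · rintro ⟨a, i⟩ ⟨b, j⟩ h
    cases a <;> cases b <;> simp at h ⊢
    · exact hinj _ _ h
    · exact absurd h.symm (hno _ _)
    · exact absurd h (hno _ _)
    · exact hinj _ _ h
  · rw [ZMod.card_units_eq_totient, Nat.totient_prime_pow_succ Nat.prime_two]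
    simp
    ring

theorem aux_units_sum {K : Type*} [Ring K] (n : ℕ) (u5 : (ZMod (2 ^ (n + 2)))ˣ)
    (h5 : (u5 : ZMod (2 ^ (n + 2))) = 5) (H : (ZMod (2 ^ (n + 2)))ˣ → K)
    (hH : ∀ u, H (-u) = H u) :
    ∑ u, H u = 2 * ∑ i ∈ Finset.range (2 ^ n), H (u5 ^ i) := by
  rw [← (aux_units_struct n u5 h5).sum_comp H, Fintype.sum_prod_type]
  simp only [Fintype.sum_bool, if_true, Bool.false_eq_true, if_false, hH]
  rw [Finset.sum_range, two_mul]

theorem aux_Psi {K : Type*} [Field K] [CharZero K] (S : ℚ → ℚ)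
    (hSneg : ∀ β : ℚ, S (-β) = S β) (hSper : ∀ β : ℚ, S (β + 1) = S β)
    (n : ℕ) (hn : 1 ≤ n) (ζ : K) (hζ : IsPrimitiveRoot ζ (2 ^ n))
    (ψ : (ZMod (2 ^ (n + 2)))ˣ →* K)
    (hψneg : ∀ u : (ZMod (2 ^ (n + 2)))ˣ, (u : ZMod (2 ^ (n + 2))) = -1 → ψ u = 1)
    (hψ5 : ∀ u : (ZMod (2 ^ (n + 2)))ˣ, (u : ZMod (2 ^ (n + 2))) = 5 → ψ u = ζ)
    (c : ℕ → ℕ → ℤ) (hc : ∀ n i, S ((5 : ℚ) ^ i / 2 ^ (n + 2)) = (c n i : ℚ) / 2) :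
    ∃ Ψ : ℤ → K, (∀ x, Ψ (x + (2 ^ (n + 2) : ℕ)) = Ψ x) ∧ (∀ x y, Ψ (x * y) = Ψ x * Ψ y) ∧
      (∀ x, Even x → Ψ x = 0) ∧ (∀ x, Odd x → ∃ i : ℕ, Ψ x = ζ ^ i) ∧ (∀ x, Ψ (-x) = Ψ x) ∧
      Ψ 5 = ζ ∧ Ψ 1 = 1 ∧
      ∑ x ∈ Finset.range (2 ^ (n + 2)), Ψ (x : ℤ) = 0 ∧
      ∑ x ∈ Finset.range (2 ^ (n + 2)), Ψ (x : ℤ) * (S ((x : ℚ) / ((2 ^ (n + 2) : ℕ) : ℚ)) : K) =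
        ∑ i ∈ Finset.range (2 ^ n), (c n i : K) * ζ ^ i ∧
      ∀ m [NeZero (2 ^ (n + 2) * m)], Odd m → XiM S n m ψ =
        ∑ x ∈ Finset.range (2 ^ (n + 2) * m), ((jacobiSym (x : ℤ) m : ℤ) : K) * Ψ x *
          (S ((x : ℚ) / ((2 ^ (n + 2) * m : ℕ) : ℚ)) : K) := by
  have hcop : Nat.Coprime 5 (2 ^ (n + 2)) := Nat.Coprime.pow_right _ (by norm_num)
  let u5 : (ZMod (2 ^ (n + 2)))ˣ := ZMod.unitOfCoprime 5 hcop
  have h5 : (u5 : ZMod (2 ^ (n + 2))) = 5 := by simp [u5]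
  let χ : MulChar (ZMod (2 ^ (n + 2))) K := MulChar.ofUnitHom ψ.toHomUnits
  have hχ : ∀ u : (ZMod (2 ^ (n + 2)))ˣ, χ u = ψ u := by
    intro u
    simp [χ]
  have hχneg1 : χ (-1) = 1 := by
    have := hχ (-1)
    rw [hψneg (-1) (by simp)] at this
    simpa using this
  have hχneg : ∀ z, χ (-z) = χ z := by
    intro z
    rw [← neg_one_mul, map_mul, hχneg1, one_mul]
  have hψneg' : ∀ u, ψ (-u) = ψ u := by
    intro u
    rw [← hχ, ← hχ, Units.val_neg, hχneg]
  have hχ5 : χ 5 = ζ := by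
    rw [← h5, hχ, hψ5 _ h5]
  have hζ1 : ζ ≠ 1 := by
    intro h
    have h2 := hζ.eq_orderOf
    rw [h, orderOf_one] at h2
    have : 1 < 2 ^ n := Nat.one_lt_two_pow (by omega)
    omega
  have hunit : ∀ x : ℤ, IsUnit (x : ZMod (2 ^ (n + 2))) ↔ Odd x := by
    intro x
    rw [ZMod.coe_int_isUnit_iff_isCoprime, Nat.cast_pow, IsCoprime.pow_left_iff (by omega)]
    exact Int.isCoprime_two_left
  refine ⟨fun x => χ (x : ZMod (2 ^ (n + 2))), ?_, ?_, ?_, ?_, ?_, ?_, ?_, ?_, ?_, ?_⟩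
  · intro x
    simp only []
    congr 1
    push_cast
    have := ZMod.natCast_self (2 ^ (n + 2))
    push_cast at this
    rw [this, add_zero]
  · intro x y
    simp
  · intro x hx
    apply MulChar.map_nonunit
    rw [hunit]
    exact Int.not_odd_iff_even.mpr hx
  · intro x hx
    obtain ⟨u, hu⟩ := (hunit x).mpr hx
    obtain ⟨⟨b, i⟩, hi⟩ := (aux_units_struct n u5 h5).2 u
    refine ⟨i, ?_⟩
    simp only []
    rw [← hu, hχ, ← hi]
    cases b <;> simp [hψneg', hψ5 _ h5]
  · intro x
    simp [hχneg]
  · simpa using hχ5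
  · simp
  · rw [aux_sum_zmod (2 ^ (n + 2)) (fun x => χ (x : ZMod (2 ^ (n + 2))))]
    simp only [Int.cast_natCast, ZMod.natCast_zmod_val]
    apply MulChar.sum_eq_zero_of_ne_one
    intro h
    rw [h, ← h5, MulChar.one_apply_coe] at hχ5
    exact hζ1 hχ5.symm
  · have e := aux_sum_zmod (2 ^ (n + 2)) (fun x : ℤ => χ (x : ZMod (2 ^ (n + 2))) *
      (S ((x : ℚ) / ((2 ^ (n + 2) : ℕ) : ℚ)) : K))
    simp only [Int.cast_natCast] at e
    simp only [Int.cast_natCast]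
    rw [e]
    simp only [ZMod.natCast_zmod_val]
    rw [← aux_unit_sum _ (fun z hz => by rw [MulChar.map_nonunit _ hz, zero_mul])]
    have hmod : ∀ (x y : ℤ), (x : ZMod (2 ^ (n + 2))) = y →
        S ((x : ℚ) / ((2 ^ (n + 2) : ℕ) : ℚ)) = S ((y : ℚ) / ((2 ^ (n + 2) : ℕ) : ℚ)) := by
      intro x y hxy
      exact aux_per_mod (h := fun x : ℤ => S ((x : ℚ) / ((2 ^ (n + 2) : ℕ) : ℚ)))
        (fun x => aux_S_perM hSper _ (by positivity) x) ((ZMod.intCast_eq_intCast_iff _ _ _).mp hxy)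
    rw [aux_units_sum n u5 h5 _ ?_, Finset.mul_sum]
    · refine Finset.sum_congr rfl fun i _ => ?_
      rw [hχ, map_pow, hψ5 _ h5]
      have h1 := hmod ((((u5 ^ i : (ZMod (2 ^ (n + 2)))ˣ) : ZMod (2 ^ (n + 2))).val : ℕ) : ℤ)
        (5 ^ i) (by simp [h5])
      have h2 := hc n i
      simp only [Int.cast_natCast] at h1
      rw [h1]
      push_cast
      rw [h2]
      push_cast
      ring
    · intro u
      rw [Units.val_neg, hχneg]
      congr 2
      have h1 := hmod ((((-(u : ZMod (2 ^ (n + 2))))).val : ℕ) : ℤ)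
        (-((u : ZMod (2 ^ (n + 2))).val : ℕ)) (by simp)
      simp only [Int.cast_natCast, Int.cast_neg] at h1
      rw [h1, neg_div, hSneg]
  · intro m _ hm
    have e := aux_sum_zmod (2 ^ (n + 2) * m) (fun x : ℤ => ((jacobiSym x m : ℤ) : K) *
      χ (x : ZMod (2 ^ (n + 2))) * (S ((x : ℚ) / ((2 ^ (n + 2) * m : ℕ) : ℚ)) : K))
    simp only [Int.cast_natCast] at e
    simp only [Int.cast_natCast]
    rw [e, ← aux_unit_sum]
    · unfold XiM
      refine Finset.sum_congr rfl fun x _ => ?_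
      congr 2
      rw [← hχ]
      congr 1
      simp
    · intro z hz
      by_cases h1 : IsUnit (((z.val : ℕ) : ℤ) : ZMod (2 ^ (n + 2)))
      · have : jacobiSym (z.val : ℤ) m = 0 := by
          have : NeZero m := ⟨by rintro rfl; exact absurd hm (by decide)⟩
          rw [jacobiSym.eq_zero_iff_not_coprime]
          intro hg
          apply hz
          rw [hunit] at h1
          have h3 : Nat.Coprime z.val (2 ^ (n + 2) * m) := by
            apply Nat.Coprime.mul_right
            · apply Nat.Coprime.pow_right
              rw [Nat.coprime_two_right]
              exact_mod_cast h1
            · exact_mod_cast hg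
          have := (ZMod.isUnit_iff_coprime z.val (2 ^ (n + 2) * m)).mpr h3
          simpa using this
        rw [this]; simp
      · rw [Int.cast_natCast] at h1
        rw [MulChar.map_nonunit _ h1]; simp

theorem aux_Y3 {K : Type*} [Field K] (N : ℕ) (O : Subring K) (ζ : K) (hζO : ζ ∈ O)
    (hζ4 : ζ ^ 4 = -1) (ε : K) (hε : ε ∈ O) (h2 : (2 : K) = (ζ - 1) ^ 4 * ε)
    (Ψ : ℤ → K) (hper : ∀ x, Ψ (x + (32 : ℕ)) = Ψ x) (hmul : ∀ x y, Ψ (x * y) = Ψ x * Ψ y)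
    (heven : ∀ x, Even x → Ψ x = 0) (hodd : ∀ x, Odd x → ∃ i : ℕ, Ψ x = ζ ^ i)
    (hneg : ∀ x, Ψ (-x) = Ψ x) (h5 : Ψ 5 = ζ) (m : ℕ) (hm : Odd m)
    (A : ℤ → ℤ) (hA : ∀ x, A (x + m) = A x) (d : ℚ → ℤ) (hdper : ∀ β, d (β + 1) = d β)
    (hd2 : ∀ β : ℚ, Nat.Coprime β.den N → d (β / 2) + d ((β + 1) / 2) = -d (2 * β) - 2)
    (hmN : Nat.Coprime (16 * m) N) :
    ∃ y ∈ O, ∑ x ∈ Finset.range (32 * m),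
      (A x : K) * Ψ x * (d ((x : ℚ) / ((32 * m : ℕ) : ℚ)) : K) = (ζ - 1) ^ 2 * y := by
  have hm0 : (m : ℚ) ≠ 0 := by
    have : m ≠ 0 := by rintro rfl; exact absurd hm (by decide)
    exact_mod_cast this
  have hΨO : ∀ x, Ψ x ∈ O := by
    intro x
    rcases Int.even_or_odd x with h | h
    · rw [heven x h]; exact zero_mem _
    · obtain ⟨i, hi⟩ := hodd x h
      rw [hi]; exact pow_mem hζO _
  have hΨ5 : ∀ k : ℕ, Ψ (5 ^ k) = Ψ 1 * ζ ^ k := by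
    intro k
    induction k with
    | zero => simp
    | succ k ih => rw [pow_succ, hmul, ih, h5, pow_succ, mul_assoc]
  have hA' : ∀ x (k : ℕ), A (x + (k * m : ℕ)) = A x := by
    intro x k
    apply aux_per_mod hA
    push_cast
    simp [Int.ModEq]
  have hΨ1 : ∀ x, Ψ x * Ψ 1 = Ψ x := by intro x; rw [← hmul, mul_one]
  -- shift by 16 m
  have s16 : ∀ x : ℤ, Ψ (x + (16 * m : ℕ)) = -Ψ x := by
    intro x
    rcases Int.even_or_odd x with h | h
    · rw [heven x h, heven, neg_zero]
      exact h.add (by push_cast; exact (by decide : Even (16 : ℤ)).mul_right _)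
    · have e : Ψ (x + (16 * m : ℕ)) = Ψ (x * 5 ^ 4) := by
        apply aux_per_mod hper
        obtain ⟨a, rfl⟩ := h
        obtain ⟨b, rfl⟩ := hm
        push_cast
        refine Int.modEq_iff_dvd.mpr ⟨39 * a + 19 - b, by ring⟩
      rw [e, hmul, hΨ5, ← mul_assoc, hΨ1, hζ4]; ring
  have s8 : ∀ x : ℤ, ∃ w ∈ O, Ψ x + Ψ (x + (8 * m : ℕ)) = (ζ - 1) ^ 2 * w := by
    intro x
    rcases Int.even_or_odd x with h | h
    · refine ⟨0, zero_mem _, ?_⟩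
      rw [heven x h, heven]
      · simp
      · exact h.add (by push_cast; exact (by decide : Even (8 : ℤ)).mul_right _)
    · obtain ⟨a, ha⟩ := h
      obtain ⟨b, hb⟩ := hm
      have hk : (∃ k : ℤ, (m : ℤ) - 3 * x = 4 * k) ∨ (∃ k : ℤ, (m : ℤ) - x = 4 * k) := by
        by_cases hab : ((b : ℤ) - a) % 2 = 0
        · right; exact ⟨((b : ℤ) - a) / 2, by omega⟩
        · left; exact ⟨((b : ℤ) - a - 2 * a - 1) / 2, by omega⟩
      rcases hk with ⟨k, hk⟩ | ⟨k, hk⟩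
      · have e : Ψ (x + (8 * m : ℕ)) = Ψ (x * 5 ^ 2) := by
          apply aux_per_mod hper
          push_cast
          refine Int.modEq_iff_dvd.mpr ⟨-k, by push_cast; linarith⟩
        refine ⟨Ψ x * (1 + (ζ - 1) ^ 2 * ε * ζ), mul_mem (hΨO x) (add_mem (one_mem _)
          (mul_mem (mul_mem (pow_mem (sub_mem hζO (one_mem _)) _) hε) hζO)), ?_⟩
        rw [e, hmul, hΨ5, ← mul_assoc, hΨ1]
        linear_combination (Ψ x * ζ) * h2
      · have e : Ψ (x + (8 * m : ℕ)) = Ψ (x * 5 ^ 6) := by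
          apply aux_per_mod hper
          push_cast
          refine Int.modEq_iff_dvd.mpr ⟨488 * x - k, by push_cast; norm_num; linarith⟩
        refine ⟨-Ψ x * (1 + (ζ - 1) ^ 3 * ε), mul_mem (neg_mem (hΨO x)) (add_mem (one_mem _)
          (mul_mem (pow_mem (sub_mem hζO (one_mem _)) _) hε)), ?_⟩
        rw [e, hmul, hΨ5, ← mul_assoc, hΨ1]
        linear_combination (Ψ x * ζ ^ 2) * hζ4 - (Ψ x * (ζ - 1)) * h2
  -- first fold
  have f1 : ∑ x ∈ Finset.range (32 * m),
      (A x : K) * Ψ x * (d ((x : ℚ) / ((32 * m : ℕ) : ℚ)) : K) =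
      -(∑ x ∈ Finset.range (16 * m), (A x : K) * Ψ x * (d ((x : ℚ) / ((8 * m : ℕ) : ℚ)) : K)) -
      2 * ∑ x ∈ Finset.range (16 * m), (A x : K) * Ψ x *
        (1 + (d (((16 * m + x : ℕ) : ℚ) / ((32 * m : ℕ) : ℚ)) : K)) := by
    rw [show 32 * m = 16 * m + 16 * m by ring, Finset.sum_range_add, ← Finset.sum_neg_distrib,
      Finset.mul_sum, ← Finset.sum_sub_distrib, ← Finset.sum_add_distrib]
    refine Finset.sum_congr rfl fun x _ => ?_
    have e1 : A ((16 * m + x : ℕ) : ℤ) = A x := by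
      rw [add_comm, Nat.cast_add]; exact hA' x 16
    have e2 : Ψ ((16 * m + x : ℕ) : ℤ) = -Ψ x := by
      rw [add_comm, Nat.cast_add]; exact s16 x
    have hh := hd2 ((x : ℚ) / ((16 * m : ℕ) : ℚ))
      (by
        have := aux_den (x : ℤ) (16 * m) N hmN
        rw [Int.cast_natCast] at this
        exact this)
    have e3 : (x : ℚ) / ((16 * m : ℕ) : ℚ) / 2 = (x : ℚ) / ((16 * m + 16 * m : ℕ) : ℚ) := by
      push_cast; field_simp; ring
    have e4 : ((x : ℚ) / ((16 * m : ℕ) : ℚ) + 1) / 2 =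
        ((16 * m + x : ℕ) : ℚ) / ((16 * m + 16 * m : ℕ) : ℚ) := by
      push_cast; field_simp; ring
    have e5 : 2 * ((x : ℚ) / ((16 * m : ℕ) : ℚ)) = (x : ℚ) / ((8 * m : ℕ) : ℚ) := by
      push_cast; field_simp; ring
    rw [e3, e4, e5] at hh
    have hh' := congrArg (Int.cast : ℤ → K) hh
    rw [e1, e2]
    push_cast at hh' ⊢
    linear_combination ((A x : K) * Ψ x) * hh'
  have f2 : ∑ x ∈ Finset.range (16 * m), (A x : K) * Ψ x * (d ((x : ℚ) / ((8 * m : ℕ) : ℚ)) : K) =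
      ∑ x ∈ Finset.range (8 * m), (A x : K) * (Ψ x + Ψ (x + (8 * m : ℕ))) *
        (d ((x : ℚ) / ((8 * m : ℕ) : ℚ)) : K) := by
    rw [show 16 * m = 8 * m + 8 * m by ring, Finset.sum_range_add, ← Finset.sum_add_distrib]
    refine Finset.sum_congr rfl fun x _ => ?_
    have e1 : A ((8 * m + x : ℕ) : ℤ) = A x := by
      rw [add_comm, Nat.cast_add]; exact hA' x 8
    have e4 : d (((8 * m + x : ℕ) : ℚ) / ((8 * m : ℕ) : ℚ)) = d ((x : ℚ) / ((8 * m : ℕ) : ℚ)) := by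
      rw [← hdper ((x : ℚ) / ((8 * m : ℕ) : ℚ))]
      congr 1
      push_cast; field_simp; ring
    rw [e1, e4, add_comm (8 * m) x, Nat.cast_add]
    ring
  choose w hw hw' using s8
  refine ⟨-(∑ x ∈ Finset.range (8 * m), (A x : K) * w x *
        (d ((x : ℚ) / ((8 * m : ℕ) : ℚ)) : K)) - (ζ - 1) ^ 2 * ε *
      ∑ x ∈ Finset.range (16 * m), (A x : K) * Ψ x *
        (1 + (d (((16 * m + x : ℕ) : ℚ) / ((32 * m : ℕ) : ℚ)) : K)), ?_, ?_⟩
  · refine sub_mem (neg_mem (sum_mem fun x _ => ?_)) (mul_mem (mul_mem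
      (pow_mem (sub_mem hζO (one_mem _)) _) hε) (sum_mem fun x _ => ?_))
    · exact mul_mem (mul_mem (intCast_mem _ _) (hw _)) (intCast_mem _ _)
    · exact mul_mem (mul_mem (intCast_mem _ _) (hΨO _)) (add_mem (one_mem _) (intCast_mem _ _))
  · rw [f1, f2]
    have : ∑ x ∈ Finset.range (8 * m), (A x : K) * (Ψ x + Ψ (x + (8 * m : ℕ))) *
        (d ((x : ℚ) / ((8 * m : ℕ) : ℚ)) : K) = (ζ - 1) ^ 2 *
        ∑ x ∈ Finset.range (8 * m), (A x : K) * w x *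
        (d ((x : ℚ) / ((8 * m : ℕ) : ℚ)) : K) := by
      rw [Finset.mul_sum]
      refine Finset.sum_congr rfl fun x _ => ?_
      rw [hw']; ring
    rw [this]
    linear_combination (-∑ x ∈ Finset.range (16 * m), (A x : K) * Ψ x *
        (1 + (d (((16 * m + x : ℕ) : ℚ) / ((32 * m : ℕ) : ℚ)) : K))) * h2


theorem aux_eps {K : Type*} [Field K] (O : Subring K) (ζ : K) (k : ℕ) (hζO : ζ ∈ O)
    (hζ : ζ ^ (2 ^ k) = -1)
    (hO : ∀ u : ℤ, Odd u → ∀ y ∈ O, (u : K) + (ζ - 1) * y ≠ 0 ∧ ((u : K) + (ζ - 1) * y)⁻¹ ∈ O) :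
    ∃ ε ∈ O, ε ≠ 0 ∧ ε⁻¹ ∈ O ∧ (2 : K) = (ζ - 1) ^ (2 ^ k) * ε := by
  obtain ⟨r, hr⟩ := aux_pi_pow (⟨ζ, hζO⟩ : O) k (by ext; simpa using hζ)
  have hr' := congrArg (Subtype.val) hr
  push_cast at hr'
  obtain ⟨h0, hi⟩ := hO (-1) (by decide) (-(r : K)) (neg_mem r.2)
  have hπ : (ζ - 1) ^ (2 ^ k) = 2 * (((-1 : ℤ) : K) + (ζ - 1) * -(r : K)) := by
    push_cast
    have e2 : ((2 : O) : K) = 2 := rfl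
    rw [e2] at hr'
    linear_combination hr'
  refine ⟨_, hi, inv_ne_zero h0, ?_, ?_⟩
  · rw [inv_inv]
    exact add_mem (intCast_mem _ _) (mul_mem (sub_mem hζO (one_mem _)) (neg_mem r.2))
  · rw [hπ, mul_assoc, mul_inv_cancel₀ h0, mul_one]

theorem aux_pow_form {K : Type*} [Field K] (O : Subring K) (ζ : K) (hζO : ζ ∈ O) (i : ℕ) :
    ∃ y ∈ O, ζ ^ i = 1 + (ζ - 1) * y := by
  refine ⟨∑ j ∈ Finset.range i, ζ ^ j, sum_mem fun j _ => pow_mem hζO j, ?_⟩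
  rw [mul_geom_sum]; ring

theorem aux_euler {K : Type*} [Field K] (O : Subring K) (ζ : K) (hζO : ζ ∈ O) (u : ℤ) (hu : Odd u)
    (i j : ℕ) : ∃ w : ℤ, Odd w ∧ ∃ y ∈ O, (u : K) - ζ ^ i - ζ ^ j = (w : K) + (ζ - 1) * y := by
  obtain ⟨y, hy, h1⟩ := aux_pow_form O ζ hζO i
  obtain ⟨z, hz, h2⟩ := aux_pow_form O ζ hζO j
  refine ⟨u - 2, by grind, -y - z, sub_mem (neg_mem hy) hz, ?_⟩
  rw [h1, h2]; push_cast; ring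

theorem aux_sumzero {K : Type*} [Field K] (t p : ℕ) [NeZero t] (hp : p.Prime)
    (hpt : Nat.Coprime p t) (Ψ : ℤ → K) (hper : ∀ x, Ψ (x + t) = Ψ x)
    (hsum : ∑ x ∈ Finset.range t, Ψ (x : ℤ) = 0) :
    ∑ x ∈ Finset.range (t * p), (if (p : ℤ) ∣ (x : ℤ) then 0 else Ψ x) = 0 := by
  rw [aux_drop t p hp.pos Ψ, aux_per_unit t Ψ hper p (by exact_mod_cast hpt.isCoprime), hsum,
    aux_split t p]
  rw [sub_zero]
  refine Finset.sum_eq_zero fun j _ => ?_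
  rw [← hsum]
  refine Finset.sum_congr rfl fun y _ => ?_
  apply aux_per_mod hper
  push_cast
  simp [Int.ModEq]

theorem aux_twoprimes {K : Type*} [Field K] [CharZero K] (N : ℕ) (a : ℕ → ℤ) (S : ℚ → ℚ)
    (hSper : ∀ β : ℚ, S (β + 1) = S β)
    (hHecke : ∀ ℓ : ℕ, ℓ.Prime → ¬(ℓ ∣ N) → ∀ β : ℚ, Nat.Coprime β.den N →
      ∑ x ∈ Finset.range ℓ, S ((β + (x : ℚ)) / (ℓ : ℚ)) =
        (a ℓ : ℚ) * S β - S ((ℓ : ℚ) * β) + ∑ x ∈ Finset.range ℓ, S ((x : ℚ) / (ℓ : ℚ)))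
    (p q : ℕ) (hp : p.Prime) (hq : q.Prime) (hpq : p ≠ q)
    (hpN : ¬(p ∣ N)) (hqN : ¬(q ∣ N)) (t : ℕ) [NeZero t] (htN : Nat.Coprime t N)
    (hpt : Nat.Coprime p t) (hqt : Nat.Coprime q t)
    (Ψ : ℤ → K) (hper : ∀ x, Ψ (x + t) = Ψ x) (hmul : ∀ x y, Ψ (x * y) = Ψ x * Ψ y)
    (hsum : ∑ x ∈ Finset.range t, Ψ (x : ℤ) = 0)
    (p' q' : ℤ) (hp' : Ψ p * Ψ p' = 1) (hq' : Ψ q * Ψ q' = 1) (hpq' : ¬ (p : ℤ) ∣ q') :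
    ∑ x ∈ Finset.range (t * (p * q)),
        (if (q : ℤ) ∣ (x : ℤ) then 0 else if (p : ℤ) ∣ (x : ℤ) then 0 else Ψ x) *
        (S ((x : ℚ) / ((t * (p * q) : ℕ) : ℚ)) : K) =
      ((a q : K) - Ψ q - Ψ q') * ((a p : K) - Ψ p - Ψ p') *
        ∑ x ∈ Finset.range t, Ψ x * (S ((x : ℚ) / (t : ℚ)) : K) := by
  have : NeZero p := ⟨hp.ne_zero⟩
  have h1 := aux_hecke (K := K) N a S hSper p hp (hHecke p hp hpN) t htN hpt Ψ hper hmul hsum p' hp'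
  have hpp : Prime (p : ℤ) := Nat.prime_iff_prime_int.mp hp
  have hpq0 : ¬ (p : ℤ) ∣ (q : ℤ) := by
    intro h
    exact hpq ((Nat.prime_dvd_prime_iff_eq hp hq).mp (by exact_mod_cast h))
  have hcop : Nat.Coprime q p := (Nat.coprime_primes hq hp).mpr (Ne.symm hpq)
  have h2 := aux_hecke (K := K) N a S hSper q hq (hHecke q hq hqN) (t * p)
    (Nat.Coprime.mul_left htN ((Nat.Prime.coprime_iff_not_dvd hp).mpr hpN))
    (Nat.Coprime.mul_right hqt hcop)
    (fun x => if (p : ℤ) ∣ x then 0 else Ψ x)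
    (by
      intro x
      have e1 : (p : ℤ) ∣ x + ((t * p : ℕ) : ℤ) ↔ (p : ℤ) ∣ x := by
        push_cast
        exact dvd_add_left (dvd_mul_left _ _)
      have e2 : Ψ (x + ((t * p : ℕ) : ℤ)) = Ψ x := by
        apply aux_per_mod hper
        push_cast
        simp [Int.ModEq]
      simp only [e1, e2])
    (by
      intro x y
      by_cases hx : (p : ℤ) ∣ x
      · rw [if_pos (hx.mul_right y), if_pos hx, zero_mul]
      · by_cases hy : (p : ℤ) ∣ y
        · rw [if_pos (hy.mul_left x), if_pos hy, mul_zero]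
        · rw [if_neg (fun h => (hpp.dvd_or_dvd h).elim hx hy), if_neg hx, if_neg hy, hmul])
    (aux_sumzero t p hp hpt Ψ hper hsum) q'
    (by
      rw [if_neg hpq0, if_neg hpq', hq'])
  simp only [if_neg hpq0, if_neg hpq'] at h2
  rw [h1] at h2
  rw [← mul_assoc t p q, h2]
  ring

theorem aux_twist {K : Type*} [Field K] [CharZero K] (S : ℚ → ℚ)
    (hSneg : ∀ β : ℚ, S (-β) = S β) (hSper : ∀ β : ℚ, S (β + 1) = S β)
    (d : ℚ → ℤ) (hd : ∀ β, S β = (d β : ℚ) / 2)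
    (p q : ℕ) (hp : p.Prime) (hq : q.Prime) (hp4 : p % 4 = 3) (hq4 : q % 4 = 3)
    (t : ℕ) [NeZero t] (Ψ : ℤ → K) (hper : ∀ x, Ψ (x + t) = Ψ x)
    (hneg : ∀ x, Ψ (-x) = Ψ x) :
    ∃ A : ℤ → ℤ, (∀ x, A (x + (p * q : ℕ)) = A x) ∧
    ∑ x ∈ Finset.range (t * (p * q)), ((jacobiSym (x : ℤ) (p * q) : ℤ) : K) * Ψ x *
        (S ((x : ℚ) / ((t * (p * q) : ℕ) : ℚ)) : K) =
    ∑ x ∈ Finset.range (t * (p * q)),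
        (if (q : ℤ) ∣ (x : ℤ) then 0 else if (p : ℤ) ∣ (x : ℤ) then 0 else Ψ x) *
        (S ((x : ℚ) / ((t * (p * q) : ℕ) : ℚ)) : K) -
      2 * ∑ x ∈ Finset.range (t * (p * q)), (A x : K) * Ψ x *
        (d ((x : ℚ) / ((t * (p * q) : ℕ) : ℚ)) : K) := by
  have : NeZero p := ⟨hp.ne_zero⟩
  have : NeZero q := ⟨hq.ne_zero⟩
  have : NeZero (p * q) := ⟨mul_ne_zero hp.ne_zero hq.ne_zero⟩
  have : NeZero (t * (p * q)) := ⟨mul_ne_zero (NeZero.ne t) (NeZero.ne _)⟩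
  set A : ℤ → ℤ := fun x => if jacobiSym x p = 1 ∧ jacobiSym x q = -1 then 1 else 0 with hA
  set B : ℤ → ℤ := fun x => if jacobiSym x p = -1 ∧ jacobiSym x q = 1 then 1 else 0 with hB
  have jper : ∀ (l : ℕ) (x y : ℤ), x ≡ y [ZMOD l] → jacobiSym x l = jacobiSym y l := by
    intro l x y h
    rw [jacobiSym.mod_left x, jacobiSym.mod_left y, h]
  have hmp : ∀ x : ℤ, x + (p * q : ℕ) ≡ x [ZMOD p] := by
    intro x; push_cast; simp [Int.ModEq]
  have hmq : ∀ x : ℤ, x + (p * q : ℕ) ≡ x [ZMOD q] := by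
    intro x; push_cast; simp [Int.ModEq]
  have hAper : ∀ x, A (x + (p * q : ℕ)) = A x := by
    intro x
    simp only [hA, jper p _ _ (hmp x), jper q _ _ (hmq x)]
  have jn : ∀ (l : ℕ), l % 4 = 3 → ∀ x, jacobiSym (-x) l = - jacobiSym x l := by
    intro l hl x
    rw [jacobiSym.neg _ (Nat.odd_iff.mpr (by omega)), ZMod.χ₄_nat_three_mod_four hl, neg_one_mul]
  have hAB : ∀ x, A (-x) = B x := by
    intro x
    simp only [hA, hB, jn p hp4, jn q hq4, neg_eq_iff_eq_neg, neg_neg]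
  have jz : ∀ (l : ℕ), l.Prime → ∀ x : ℤ, jacobiSym x l = 0 ↔ (l : ℤ) ∣ x := by
    intro l hl x
    have : Fact l.Prime := ⟨hl⟩
    rw [← jacobiSym.legendreSym.to_jacobiSym, legendreSym.eq_zero_iff]
    exact ZMod.intCast_zmod_eq_zero_iff_dvd x l
  have hpt : ∀ x : ℤ, ((jacobiSym x (p * q) : ℤ) : K) * Ψ x =
      (if (q : ℤ) ∣ x then 0 else if (p : ℤ) ∣ x then 0 else Ψ x) - 2 * (A x : K) * Ψ x
      - 2 * (B x : K) * Ψ x := by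
    intro x
    rw [jacobiSym.mul_right]
    simp only [← jz p hp, ← jz q hq, hA, hB]
    rcases jacobiSym.trichotomy x p with h | h | h <;>
      rcases jacobiSym.trichotomy x q with h' | h' | h' <;>
      simp [h, h'] <;> ring
  have hSp : ∀ x : ℤ, S (((x + (t * (p * q) : ℕ) : ℤ) : ℚ) / ((t * (p * q) : ℕ) : ℚ)) =
      S ((x : ℚ) / ((t * (p * q) : ℕ) : ℚ)) := fun x => aux_S_perM hSper _ (NeZero.ne _) x
  have hswap : ∑ x ∈ Finset.range (t * (p * q)), (B x : K) * Ψ x *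
        (S ((x : ℚ) / ((t * (p * q) : ℕ) : ℚ)) : K) =
      ∑ x ∈ Finset.range (t * (p * q)), (A x : K) * Ψ x *
        (S ((x : ℚ) / ((t * (p * q) : ℕ) : ℚ)) : K) := by
    have := aux_per_unit (t * (p * q)) (fun x : ℤ => (A x : K) * Ψ x *
        (S ((x : ℚ) / ((t * (p * q) : ℕ) : ℚ)) : K)) (by
          intro x
          have e1 : A (x + ((t * (p * q) : ℕ) : ℤ)) = A x := by
            apply aux_per_mod hAper
            push_cast; simp [Int.ModEq]
          have e2 : Ψ (x + ((t * (p * q) : ℕ) : ℤ)) = Ψ x := by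
            apply aux_per_mod hper
            push_cast; simp [Int.ModEq]
          simp only [e1, e2, hSp]) (-1) (isCoprime_one_left.neg_left)
    simp only [Int.cast_natCast] at this
    rw [← this]
    refine Finset.sum_congr rfl fun x _ => ?_
    rw [neg_one_mul, hAB, hneg]
    rw [show (((-(x : ℤ) : ℤ)) : ℚ) / ((t * (p * q) : ℕ) : ℚ) =
      -((x : ℚ) / ((t * (p * q) : ℕ) : ℚ)) by push_cast; ring, hSneg]
  refine ⟨A, hAper, ?_⟩
  have hY : ∑ x ∈ Finset.range (t * (p * q)), (A x : K) * Ψ x *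
        (d ((x : ℚ) / ((t * (p * q) : ℕ) : ℚ)) : K) = 2 *
      ∑ x ∈ Finset.range (t * (p * q)), (A x : K) * Ψ x *
        (S ((x : ℚ) / ((t * (p * q) : ℕ) : ℚ)) : K) := by
    rw [Finset.mul_sum]
    refine Finset.sum_congr rfl fun x _ => ?_
    rw [hd]; push_cast; ring
  rw [hY, show ∀ s : K, 2 * (2 * s) = 2 * s + 2 * s by intro s; ring]
  nth_rewrite 2 [← hswap]
  rw [Finset.mul_sum, Finset.mul_sum, ← Finset.sum_add_distrib, ← Finset.sum_sub_distrib]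
  refine Finset.sum_congr rfl fun x _ => ?_
  rw [hpt]; ring
/-- For `n ≥ 2`, `v(Ξ_n(m)) = q_n/2^{n−1}` where `m = pq`. -/
theorem valuation_twisted_cyclotomic_specialization
    (N : ℕ) (hN : Odd N)
    (a : ℕ → ℤ) (ha1 : a 1 = 1)
    (hamul : ∀ m k : ℕ, Nat.Coprime m k → a (m * k) = a m * a k)
    (S : ℚ → ℚ)
    (hS0 : S 0 = 0) (hSneg : ∀ β : ℚ, S (-β) = S β) (hSper : ∀ β : ℚ, S (β + 1) = S β)
    (hHecke : ∀ ℓ : ℕ, ℓ.Prime → ¬(ℓ ∣ N) → ∀ β : ℚ, Nat.Coprime β.den N →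
      ∑ x ∈ Finset.range ℓ, S ((β + (x : ℚ)) / (ℓ : ℚ)) =
        (a ℓ : ℚ) * S β - S ((ℓ : ℚ) * β) + ∑ x ∈ Finset.range ℓ, S ((x : ℚ) / (ℓ : ℚ)))
    (ha2 : a 2 = 0)
    (hhalf : ∀ β : ℚ, ∃ c : ℤ, S β = (c : ℚ) / 2)
    (hv2 : S (1 / 2) = -1) (hv4 : S (1 / 4) = -(1 / 2))
    (hv8 : ∀ x : ℤ, Odd x → S ((x : ℚ) / 8) = 0)
    (hv16a : S (1 / 16) = 0) (hv16b : S (5 / 16) = 0)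
    (hv16c : S (3 / 16) = -(1 / 2)) (hv16d : S (7 / 16) = -(1 / 2))
    (hv32a : S (3 / 32) = -(1 / 2)) (hv32b : S (7 / 32) = -(1 / 2))
    (hv32c : S (9 / 32) = -(1 / 2)) (hv32d : S (13 / 32) = -(1 / 2))
    (hv32e : S (11 / 32) = -1) (hv32f : S (15 / 32) = -1)
    (hv32g : S (1 / 32) = 0) (hv32h : S (5 / 32) = 0)
    (p q : ℕ) (hp : p.Prime) (hq : q.Prime) (hpq : p ≠ q)
    (hpN : ¬(p ∣ N)) (hqN : ¬(q ∣ N))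
    (hp12 : p % 12 = 7) (hq12 : q % 12 = 7)
    (hap : Odd (a p)) (haq : Odd (a q))
    (n : ℕ) (hn : 2 ≤ n) [NeZero (2 ^ (n + 2) * (p * q))]
    (K : Type*) [Field K] [Algebra ℚ_[2] K] [FiniteDimensional ℚ_[2] K]
    (ζ : K) (hζ : IsPrimitiveRoot ζ (2 ^ n))
    (ψ : (ZMod (2 ^ (n + 2)))ˣ →* K)
    (hψneg : ∀ u : (ZMod (2 ^ (n + 2)))ˣ, (u : ZMod (2 ^ (n + 2))) = -1 → ψ u = 1)
    (hψ5 : ∀ u : (ZMod (2 ^ (n + 2)))ˣ, (u : ZMod (2 ^ (n + 2))) = 5 → ψ u = ζ) :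
    vK (XiM S n (p * q) ψ) = (qseq n : ℚ) / (2 ^ (n - 1) : ℚ) := by
  haveI : CharZero K := charZero_of_injective_algebraMap (algebraMap ℚ_[2] K).injective
  obtain ⟨k, rfl⟩ : ∃ k, n = k + 2 := ⟨n - 2, by omega⟩
  choose d hd using hhalf
  have h2S := fun β hβ => aux_S_two (N := N) hN (a := a) (S := S) hS0 hHecke ha2 hv2 β hβ
  obtain ⟨hP3, hPk⟩ := aux_poly hN hSper hSneg h2S hv16a hv16b hv16c hv16d hv32a hv32b hv32c hv32d
    hv32e hv32f hv32g hv32h (fun n i => d ((5 : ℚ) ^ i / 2 ^ (n + 2))) (fun n i => hd _)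
  obtain ⟨Ψ, hper, hmul, heven, hodd, hneg, h5, h1, hsum, hXi, hXiM⟩ :=
    aux_Psi S hSneg hSper (k + 2) (by omega) ζ hζ ψ hψneg hψ5
      (fun n i => d ((5 : ℚ) ^ i / 2 ^ (n + 2))) (fun n i => hd _)
  have hζ1 : ζ ^ (2 ^ (k + 1)) = -1 := aux_prim ζ (k + 1) hζ
  obtain ⟨O, hζO, hO, hv⟩ := aux_exists_O K ζ (k + 1) hζ1
  obtain ⟨ε, hεO, hε0, hεi, h2⟩ := aux_eps O ζ (k + 1) hζO hζ1 hO
  have hπO : ζ - 1 ∈ O := sub_mem hζO (one_mem _)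
  have hpo : Odd p := Nat.odd_iff.mpr (by omega)
  have hqo : Odd q := Nat.odd_iff.mpr (by omega)
  have hΨpow : ∀ (x : ℤ) (i : ℕ), Ψ (x ^ i) = Ψ x ^ i := by
    intro x i
    induction i with
    | zero => simp [h1]
    | succ i ih => rw [pow_succ, hmul, ih, pow_succ]
  have hinv : ∀ l : ℕ, Odd l → Ψ l * Ψ ((l : ℤ) ^ (2 ^ (k + 2) - 1)) = 1 := by
    intro l hl
    obtain ⟨i, hi⟩ := hodd l (by exact_mod_cast hl)
    rw [hΨpow, ← pow_succ', Nat.sub_add_cancel Nat.one_le_two_pow, hi, ← pow_mul, mul_comm,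
      pow_mul, hζ.pow_eq_one, one_pow]
  have hE : ∀ l : ℕ, Odd l → Odd (a l) → ∃ w : ℤ, Odd w ∧ ∃ y ∈ O,
      (a l : K) - Ψ l - Ψ ((l : ℤ) ^ (2 ^ (k + 2) - 1)) = (w : K) + (ζ - 1) * y := by
    intro l hl hal
    obtain ⟨i, hi⟩ := hodd l (by exact_mod_cast hl)
    rw [hΨpow, hi, ← pow_mul]
    exact aux_euler O ζ hζO _ hal _ _
  obtain ⟨wp, hwp, yp, hyp, hEp⟩ := hE p hpo hap
  obtain ⟨wq, hwq, yq, hyq, hEq⟩ := hE q hqo haq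
  have h2N : Nat.Coprime 2 N := (Nat.coprime_two_left).mpr hN
  have htN : Nat.Coprime (2 ^ (k + 2 + 2)) N := Nat.Coprime.pow_left _ h2N
  have hpN' : Nat.Coprime p N := (Nat.Prime.coprime_iff_not_dvd hp).mpr hpN
  have hqN' : Nat.Coprime q N := (Nat.Prime.coprime_iff_not_dvd hq).mpr hqN
  have hT := aux_twoprimes (K := K) N a S hSper hHecke p q hp hq hpq hpN hqN (2 ^ (k + 2 + 2)) htN
    (Nat.Coprime.pow_right _ (Nat.coprime_two_right.mpr hpo))
    (Nat.Coprime.pow_right _ (Nat.coprime_two_right.mpr hqo)) Ψ hper hmul hsum _ _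
    (hinv p hpo) (hinv q hqo) (by
      intro h
      have h' := (Nat.prime_iff_prime_int.mp hp).dvd_of_dvd_pow h
      exact hpq ((Nat.prime_dvd_prime_iff_eq hp hq).mp (by exact_mod_cast h')))
  obtain ⟨A, hA, hTw⟩ := aux_twist (K := K) S hSneg hSper d hd p q hp hq (by omega) (by omega)
    (2 ^ (k + 2 + 2)) Ψ hper hneg
  rw [hXiM (p * q) (hpo.mul hqo), hTw, hT, hEp, hEq, hXi]
  have hΨO : ∀ x, Ψ x ∈ O := by
    intro x
    rcases Int.even_or_odd x with h | h
    · rw [heven x h]; exact zero_mem _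
    · obtain ⟨i, hi⟩ := hodd x h
      rw [hi]; exact pow_mem hζO _
  by_cases hk : k = 1
  · subst hk
    have hζ4 : ζ ^ 4 = -1 := by simpa using hζ1
    have h2' : (2 : K) = (ζ - 1) ^ 4 * ε := by simpa using h2
    obtain ⟨y, hy, hY⟩ := aux_Y3 N O ζ hζO hζ4 ε hεO h2' Ψ hper hmul heven hodd hneg h5 (p * q)
      (hpo.mul hqo) A hA d (by
        intro β
        have := hSper β
        rw [hd, hd β] at this
        exact_mod_cast (div_left_inj' (by norm_num : (2 : ℚ) ≠ 0)).mp this) (by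
        intro β hβ
        have := h2S β hβ
        rw [hd, hd ((β + 1) / 2), hd (2 * β)] at this
        have h' : ((d (β / 2) : ℚ)) + d ((β + 1) / 2) = -d (2 * β) - 2 := by linarith
        exact_mod_cast h') (Nat.Coprime.mul_left (Nat.Coprime.pow_left 4 h2N)
          (Nat.Coprime.mul_left hpN' hqN'))
    have hP := congrArg (Polynomial.aeval ζ) hP3
    simp only [map_sum, map_mul, map_pow, Polynomial.aeval_C, Polynomial.aeval_X, map_sub, map_neg,
      map_add, map_ofNat, algebraMap_int_eq, eq_intCast, map_intCast] at hP
    have e32 : (2 : ℕ) ^ (1 + 2 + 2) = 32 := by norm_num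
    rw [e32, hY, hP]
    have hfin : ((wq : K) + (ζ - 1) * yq) * ((wp : K) + (ζ - 1) * yp) *
        (-(ζ ^ 2 + ζ ^ 3 + ζ ^ 6 + ζ ^ 7) - 2 * (ζ ^ 4 + ζ ^ 5)) - 2 * ((ζ - 1) ^ 2 * y) =
        (ζ - 1) ^ 5 * (ε * (((wq * wp : ℤ) : K) + (ζ - 1) * (wq * yp + wp * yq + (ζ - 1) * yp * yq +
          ((wq : K) + (ζ - 1) * yq) * ((wp : K) + (ζ - 1) * yp) * ((ζ - 1) ^ 2 * ε) - y))) := by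
      have hs : -(ζ ^ 2 + ζ ^ 3 + ζ ^ 6 + ζ ^ 7) - 2 * (ζ ^ 4 + ζ ^ 5) =
          (ζ - 1) ^ 5 * ε * (1 + (ζ - 1) ^ 3 * ε) := by
        have e1 : -(ζ ^ 2 + ζ ^ 3 + ζ ^ 6 + ζ ^ 7) - 2 * (ζ ^ 4 + ζ ^ 5) = 2 * (2 + (ζ - 1)) := by
          linear_combination (-ζ ^ 2 - ζ ^ 3 - 2 - 2 * ζ) * hζ4
        rw [e1, h2']; ring
      rw [hs, h2']
      push_cast
      ring
    have hin : (wq * yp + wp * yq + (ζ - 1) * yp * yq +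
          ((wq : K) + (ζ - 1) * yq) * ((wp : K) + (ζ - 1) * yp) * ((ζ - 1) ^ 2 * ε) - y) ∈ O := by
      have a1 : (wq : K) ∈ O := intCast_mem _ _
      have a2 : (wp : K) ∈ O := intCast_mem _ _
      exact sub_mem (add_mem (add_mem (add_mem (mul_mem a1 hyp) (mul_mem a2 hyq))
        (mul_mem (mul_mem hπO hyp) hyq)) (mul_mem (mul_mem (add_mem a1 (mul_mem hπO hyq))
        (add_mem a2 (mul_mem hπO hyp))) (mul_mem (pow_mem hπO _) hεO))) hy
    obtain ⟨g0, gi⟩ := hO (wq * wp) (hwq.mul hwp) _ hin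
    rw [hfin, hv 5 _ (mul_mem hεO (add_mem (intCast_mem _ _) (mul_mem hπO hin)))
      (by rw [mul_inv]; exact mul_mem hεi gi) (mul_ne_zero hε0 g0)]
    have hq3 : qseq (1 + 2) = 5 := by decide
    rw [hq3]
  · obtain ⟨U, V, hP, hU⟩ := hPk k
    have hlt : qseq (k + 2) < 2 ^ (k + 1) := by
      unfold qseq
      have e : 2 ^ (k + 2) = 2 * 2 ^ (k + 1) := by rw [pow_succ]; ring
      have hpos : 0 < 2 ^ (k + 1) := by positivity
      rw [if_neg (by omega), e]
      split_ifs with h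
      · have hk3 : 3 ≤ k := by
          obtain ⟨j, hj⟩ := h
          omega
        have : 2 ^ 4 ≤ 2 ^ (k + 1) := Nat.pow_le_pow_right (by norm_num) (by omega)
        omega
      · omega
    obtain ⟨g, hg⟩ : ∃ g, 2 ^ (k + 1) = qseq (k + 2) + (g + 1) :=
      ⟨2 ^ (k + 1) - qseq (k + 2) - 1, by omega⟩
    have haev : ∀ W : Polynomial ℤ, Polynomial.aeval ζ W ∈ O := by
      intro W
      rw [Polynomial.aeval_eq_sum_range]
      exact sum_mem fun i _ => zsmul_mem (pow_mem hζO _) _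
    obtain ⟨W, hW⟩ : Polynomial.X - Polynomial.C 1 ∣ U - Polynomial.C (U.eval 1) := by
      rw [Polynomial.dvd_iff_isRoot]
      simp
    have hW' := congrArg (Polynomial.aeval ζ) hW
    simp only [map_sub, map_mul, Polynomial.aeval_X, Polynomial.aeval_C, map_one, algebraMap_int_eq,
      eq_intCast, map_intCast] at hW'
    have hP' := congrArg (Polynomial.aeval ζ) hP
    simp only [map_sum, map_mul, map_pow, Polynomial.aeval_C, Polynomial.aeval_X, map_sub, map_one,
      map_add, map_ofNat, algebraMap_int_eq, eq_intCast, map_intCast] at hP'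
    have hUζ : Polynomial.aeval ζ U = ((U.eval 1 : ℤ) : K) + (ζ - 1) * Polynomial.aeval ζ W := by
      linear_combination hW'
    rw [hP', hUζ]
    set Y := ∑ x ∈ Finset.range (2 ^ (k + 2 + 2) * (p * q)), (A x : K) * Ψ x *
        (d ((x : ℚ) / ((2 ^ (k + 2 + 2) * (p * q) : ℕ) : ℚ)) : K) with hYdef
    have hYO : Y ∈ O := sum_mem fun x _ =>
      mul_mem (mul_mem (intCast_mem _ _) (hΨO _)) (intCast_mem _ _)
    have hWO := haev W
    have hVO := haev V
    generalize Polynomial.aeval ζ W = W' at *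
    generalize Polynomial.aeval ζ V = V' at *
    generalize Polynomial.eval 1 U = u at *
    have h2' : (2 : K) = (ζ - 1) ^ (qseq (k + 2)) * ((ζ - 1) * ((ζ - 1) ^ g * ε)) := by
      rw [h2, hg]; ring
    have hδO : (ζ - 1) ^ g * ε ∈ O := mul_mem (pow_mem hπO _) hεO
    generalize (ζ - 1) ^ g * ε = δ at *
    have a1 : (wq : K) ∈ O := intCast_mem _ _
    have a2 : (wp : K) ∈ O := intCast_mem _ _
    have a3 : (u : K) ∈ O := intCast_mem _ _
    have hbig : ∃ y ∈ O, ((wq : K) + (ζ - 1) * yq) * ((wp : K) + (ζ - 1) * yp) *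
        ((ζ - 1) ^ (qseq (k + 2)) * ((u : K) + (ζ - 1) * W') + 2 * V') - 2 * Y =
        (ζ - 1) ^ (qseq (k + 2)) * (((wq * wp * u : ℤ) : K) + (ζ - 1) * y) := by
      refine ⟨(wq * yp + wp * yq + (ζ - 1) * yp * yq) * u +
        ((wq : K) + (ζ - 1) * yq) * ((wp : K) + (ζ - 1) * yp) * (W' + δ * V') - δ * Y, ?_, ?_⟩
      · exact sub_mem (add_mem (mul_mem (add_mem (add_mem (mul_mem a1 hyp) (mul_mem a2 hyq))
          (mul_mem (mul_mem hπO hyp) hyq)) a3) (mul_mem (mul_mem (add_mem a1 (mul_mem hπO hyq))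
          (add_mem a2 (mul_mem hπO hyp))) (add_mem hWO (mul_mem hδO hVO)))) (mul_mem hδO hYO)
      · push_cast
        linear_combination (((wq : K) + (ζ - 1) * yq) * ((wp : K) + (ζ - 1) * yp) * V' - Y) * h2'
    obtain ⟨y, hy, hfin⟩ := hbig
    obtain ⟨g0, gi⟩ := hO (wq * wp * u) ((hwq.mul hwp).mul hU) y hy
    rw [hfin, hv _ _ (add_mem (intCast_mem _ _) (mul_mem hπO hy)) gi g0]
    rfl
end

section
/- For every integer n ≥ 1, the elements Ξ_n(m) = ∑_{x ∈ (ℤ/2^{n+2}mℤ)ˣ} χ(x)·ψ_n(x)·S(x/(2^{n+2}m)) and Ξ_n = ∑_{k ∈ (ℤ/2^{n+2}ℤ)ˣ} ψ_n(k)·S(k/2^{n+2}) both lie in the subring ℤ[ζ_{2^n}] of ℚ₂(ζ_{2^n}), and Ξ_n(m) ≡ (a(p) − ψ_n(p) − ψ_n(p)⁻¹)·(a(q) − ψ_n(q) − ψ_n(q)⁻¹)·Ξ_n (mod 2ℤ[ζ_{2^n}]), where ψ_n(p), ψ_n(q) denote ψ_n evaluated at p, q modulo 2^{n+2}. -/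
open Finset in
lemma aux_units_sum_s17 {K : Type*} [Field K] (L : ℕ) [NeZero L] (H : ℕ → K) :
    ∑ u : (ZMod L)ˣ, H (u : ZMod L).val = ∑ x ∈ (range L).filter (fun x => x.Coprime L), H x := by
  refine Finset.sum_bij (fun u _ => (u : ZMod L).val) ?_ ?_ ?_ ?_
  · intro u _
    simp only [mem_filter, mem_range]
    exact ⟨ZMod.val_lt _, ZMod.val_coe_unit_coprime u⟩
  · intro u _ v _ h
    exact Units.ext (ZMod.val_injective L h)
  · intro x hx
    simp only [mem_filter, mem_range] at hx
    refine ⟨ZMod.unitOfCoprime x hx.2, mem_univ _, ?_⟩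
    rw [ZMod.coe_unitOfCoprime, ZMod.val_natCast, Nat.mod_eq_of_lt hx.1]
  · intro u _; rfl

open Finset in
lemma aux_reindex {K : Type*} [Field K] (L : ℕ) [NeZero L] (H : ℕ → K)
    (hH : ∀ x y, x ≡ y [MOD L] → H x = H y) (c : ℕ) (hc : c.Coprime L) :
    ∑ x ∈ (range L).filter (fun x => x.Coprime L), H (c * x) =
      ∑ x ∈ (range L).filter (fun x => x.Coprime L), H x := by
  rw [← aux_units_sum_s17 L (fun x => H (c * x)), ← aux_units_sum_s17 L H,
    ← Equiv.sum_comp (Equiv.mulLeft (ZMod.unitOfCoprime c hc)) (fun u => H (u : ZMod L).val)]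
  refine Finset.sum_congr rfl fun u _ => hH _ _ ?_
  rw [← ZMod.natCast_eq_natCast_iff]
  simp

lemma aux_S_per_s17 (S : ℚ → ℚ) (hSper : ∀ β : ℚ, S (β + 1) = S β) (L : ℕ) (hL : L ≠ 0)
    (i j : ℤ) (h : i ≡ j [ZMOD L]) : S ((i : ℚ) / L) = S ((j : ℚ) / L) := by
  obtain ⟨k, hk⟩ := h.dvd
  have hp : Function.Periodic S 1 := hSper
  have := (hp.int_mul k) ((i : ℚ) / L)
  rw [← this]
  congr 1
  have hL' : (L : ℚ) ≠ 0 := by exact_mod_cast hL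
  have : (j : ℚ) = i + L * k := by
    have : j = i + L * k := by linarith
    rw [this]; push_cast; ring
  rw [this]; field_simp

lemma aux_S_per_nat (S : ℚ → ℚ) (hSper : ∀ β : ℚ, S (β + 1) = S β) (L : ℕ) (hL : L ≠ 0)
    (i j : ℕ) (h : i ≡ j [MOD L]) : S ((i : ℚ) / L) = S ((j : ℚ) / L) := by
  have := aux_S_per_s17 S hSper L hL i j ((Int.natCast_modEq_iff).2 h)
  simpa only [Int.cast_natCast] using this

open Finset in
lemma aux_sum_range_mul {K : Type*} [Field K] (L p : ℕ) (f : ℕ → K) :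
    ∑ z ∈ range (L * p), f z = ∑ y ∈ range L, ∑ x ∈ range p, f (y + L * x) := by
  rw [Finset.sum_comm]
  induction p with
  | zero => simp
  | succ p ih =>
    rw [Nat.mul_succ, Finset.sum_range_add, ih, Finset.sum_range_succ]
    congr 1
    exact Finset.sum_congr rfl fun y _ => by rw [add_comm]

/-- untwisted sum at level `L` -/
noncomputable def auxG {K : Type*} [Field K] (Φ : ℕ → K) (S : ℚ → ℚ) (L : ℕ) : K :=
  ∑ x ∈ (Finset.range L).filter (fun x => x.Coprime L), Φ x * (S ((x : ℚ) / (L : ℚ)) : K)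

open Finset in
lemma aux_key {K : Type*} [Field K] [CharZero K] (S : ℚ → ℚ)
    (hSper : ∀ β : ℚ, S (β + 1) = S β) (M L p : ℕ) (hL : 0 < L) (hML : M ∣ L)
    (hp : p.Prime) (hpL : p.Coprime L) (ap : ℤ)
    (hHecke : ∀ y : ℕ, 
      ∑ x ∈ Finset.range p, S (((y : ℚ) / L + (x : ℚ)) / (p : ℚ)) =
        (ap : ℚ) * S ((y : ℚ) / L) - S ((p : ℚ) * ((y : ℚ) / L)) +
          ∑ x ∈ Finset.range p, S ((x : ℚ) / (p : ℚ)))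
    (Φ : ℕ → K) (hmul : ∀ x y, Φ (x * y) = Φ x * Φ y)
    (hper : ∀ x y, x ≡ y [MOD M] → Φ x = Φ y) (hΦp : Φ p ≠ 0)
    (c : ℕ) (hc : c.Coprime L) (hΦc : Φ c ≠ 1) :
    auxG Φ S (L * p) = ((ap : K) - Φ p - (Φ p)⁻¹) * auxG Φ S L := by
  have : NeZero L := ⟨hL.ne'⟩
  have hLq : (L : ℚ) ≠ 0 := by exact_mod_cast hL.ne'
  have hpq : (p : ℚ) ≠ 0 := by exact_mod_cast hp.ne_zero
  have hperL : ∀ x y, x ≡ y [MOD L] → Φ x = Φ y := fun x y h => hper x y (h.of_dvd hML)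
  -- the character sum vanishes
  have hzero : ∑ y ∈ (range L).filter (fun x => x.Coprime L), Φ y = 0 := by
    have h := aux_reindex L Φ hperL c hc
    simp only [hmul, ← Finset.mul_sum] at h
    have h2 : (Φ c - 1) * ∑ y ∈ (range L).filter (fun x => x.Coprime L), Φ y = 0 := by
      rw [sub_mul, h]; ring
    exact (mul_eq_zero.1 h2).resolve_left (sub_ne_zero.2 hΦc)
  -- the full sum
  set F : ℕ → K := fun z => Φ z * (S ((z : ℚ) / ((L * p : ℕ) : ℚ)) : K) with hF
  have hsplit : (∑ z ∈ (range (L * p)).filter (fun z => z.Coprime L), F z) =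
      auxG Φ S (L * p) + Φ p * auxG Φ S L := by
    rw [← Finset.sum_filter_add_sum_filter_not _ (fun z => ¬ p ∣ z)]
    congr 1
    · unfold auxG
      refine Finset.sum_congr ?_ (fun _ _ => rfl)
      ext z
      simp only [mem_filter, mem_range, Nat.coprime_mul_iff_right]
      rw [Nat.coprime_comm (n := z) (m := p), hp.coprime_iff_not_dvd]
      tauto
    · unfold auxG
      rw [Finset.mul_sum]
      symm
      refine Finset.sum_bij (fun w _ => p * w) ?_ ?_ ?_ ?_
      · intro w hw
        simp only [mem_filter, mem_range, not_not] at hw ⊢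
        refine ⟨⟨?_, Nat.Coprime.mul_left hpL hw.2⟩, dvd_mul_right _ _⟩
        rw [mul_comm]; exact Nat.mul_lt_mul_of_pos_right hw.1 hp.pos
      · intro w _ v _ h
        exact Nat.eq_of_mul_eq_mul_left hp.pos h
      · intro z hz
        simp only [mem_filter, mem_range, not_not] at hz
        obtain ⟨⟨h1, h2⟩, w, rfl⟩ := hz
        refine ⟨w, ?_, rfl⟩
        simp only [mem_filter, mem_range]
        refine ⟨?_, (Nat.coprime_mul_iff_left.1 h2).2⟩
        rw [mul_comm L] at h1
        exact Nat.lt_of_mul_lt_mul_left h1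
      · intro w _
        simp only [hF, hmul]
        rw [← mul_assoc]
        congr 3
        push_cast
        field_simp
  have hfull : (∑ z ∈ (range (L * p)).filter (fun z => z.Coprime L), F z) =
      ∑ y ∈ (range L).filter (fun y => y.Coprime L), Φ y *
        ((∑ x ∈ Finset.range p, S (((y : ℚ) / L + (x : ℚ)) / (p : ℚ)) : ℚ) : K) := by
    rw [Finset.sum_filter, Finset.sum_filter, aux_sum_range_mul L p]
    refine Finset.sum_congr rfl fun y _ => ?_
    have hcop : ∀ x, (y + L * x).Coprime L ↔ y.Coprime L := fun x => by simp
    simp only [hcop]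
    split_ifs with h
    · rw [Rat.cast_sum, Finset.mul_sum]
      refine Finset.sum_congr rfl fun x _ => ?_
      simp only [hF]
      rw [hperL (y + L * x) y (by simp [Nat.ModEq])]
      congr 3
      push_cast
      field_simp
    · simp
  have hp3 : ∑ y ∈ (range L).filter (fun y => y.Coprime L),
      Φ y * (S ((p : ℚ) * ((y : ℚ) / L)) : K) = (Φ p)⁻¹ * auxG Φ S L := by
    rw [eq_inv_mul_iff_mul_eq₀ hΦp, Finset.mul_sum]
    unfold auxG
    rw [← aux_reindex L (fun x => Φ x * (S ((x : ℚ) / (L : ℚ)) : K)) _ p hpL]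
    · refine Finset.sum_congr rfl fun y _ => ?_
      rw [hmul, ← mul_assoc]
      congr 3
      push_cast
      ring
    · intro x y h
      rw [hperL x y h, aux_S_per_nat S hSper L hL.ne' x y h]
  have hrhs : (∑ y ∈ (range L).filter (fun y => y.Coprime L), Φ y *
        ((∑ x ∈ Finset.range p, S (((y : ℚ) / L + (x : ℚ)) / (p : ℚ)) : ℚ) : K)) =
      (ap : K) * auxG Φ S L - (Φ p)⁻¹ * auxG Φ S L := by
    rw [← hp3]
    have : ∀ y : ℕ, Φ y * ((∑ x ∈ Finset.range p, S (((y : ℚ) / L + (x : ℚ)) / (p : ℚ)) : ℚ) : K)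
      = (ap : K) * (Φ y * (S ((y : ℚ) / L) : K)) - Φ y * (S ((p : ℚ) * ((y : ℚ) / L)) : K)
        + Φ y * ((∑ x ∈ Finset.range p, S ((x : ℚ) / (p : ℚ)) : ℚ) : K) := by
      intro y
      rw [hHecke y, Rat.cast_add, Rat.cast_sub, Rat.cast_mul, Rat.cast_intCast]
      ring
    simp only [this]
    rw [Finset.sum_add_distrib, Finset.sum_sub_distrib, ← Finset.sum_mul, hzero,
      ← Finset.mul_sum]
    simp [auxG]
  rw [hfull, hrhs] at hsplit
  linear_combination -hsplit

open Finset in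
lemma aux_even_sum {K : Type*} [Field K] (A : Subalgebra ℤ K) (L : ℕ) [NeZero L] (h4 : 4 ∣ L)
    (g : (ZMod L)ˣ → K) (hg : ∀ u, g (-u) = g u) (h2 : ∀ u, 2 * g u ∈ A) :
    ∑ u, g u ∈ A := by
  let φ : (ZMod L)ˣ → (ZMod 4)ˣ := ZMod.unitsMap h4
  have hφ : ∀ u, φ (-u) = - φ u := by
    intro u
    ext
    simp [φ, ZMod.unitsMap_def]
  have hd : ∀ v : (ZMod 4)ˣ, (-v = 1) ↔ ¬ (v = 1) := by decide
  rw [← Finset.sum_filter_add_sum_filter_not univ (fun u => φ u = 1)]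
  have : ∑ u ∈ univ.filter (fun u => ¬ φ u = 1), g u = ∑ u ∈ univ.filter (fun u => φ u = 1), g u := by
    refine Finset.sum_nbij' (fun u => -u) (fun u => -u) ?_ ?_ ?_ ?_ ?_
    · intro u; simp [hφ, hd]
    · intro u; simp only [mem_filter, mem_univ, true_and, hφ]
      intro h; rw [h]; decide
    · intro u _; simp
    · intro u _; simp
    · intro u _; exact (hg u).symm
  rw [this, ← two_mul, Finset.mul_sum]
  exact Subalgebra.sum_mem _ fun u _ => h2 u

lemma aux_odd_pow (n : ℕ) (hn : 1 ≤ n) (u : (ZMod (2 ^ (n + 2)))ˣ) : u ^ (2 ^ n) = 1 := by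
  have hodd : Odd ((u : ZMod (2 ^ (n + 2))).val : ℤ) := by
    have := ZMod.val_coe_unit_coprime u
    rw [Nat.coprime_pow_right_iff (by omega), Nat.coprime_two_right] at this
    exact_mod_cast this
  have key : ∀ (x : ℤ), Odd x → ∀ n : ℕ, 1 ≤ n → (2 : ℤ) ^ (n + 2) ∣ x ^ (2 ^ n) - 1 := by
    intro x hx n hn
    induction n, hn using Nat.le_induction with
    | base => exact_mod_cast Int.eight_dvd_sq_sub_one_of_odd hx
    | succ k _ ih =>
      have h : x ^ (2 ^ (k + 1)) - 1 = (x ^ (2 ^ k) - 1) * (x ^ (2 ^ k) + 1) := by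
        rw [pow_succ 2 k, pow_mul]; ring
      rw [h, show k + 1 + 2 = (k + 2) + 1 by ring, pow_succ]
      refine mul_dvd_mul ih ?_
      exact ((hx.pow).add_odd odd_one).two_dvd
  have := key _ hodd n hn
  ext
  have h2 := (ZMod.intCast_zmod_eq_zero_iff_dvd _ (2 ^ (n + 2))).2 (by exact_mod_cast this)
  push_cast at h2
  rw [ZMod.natCast_zmod_val] at h2
  simpa using sub_eq_zero.1 h2

set_option maxHeartbeats 2000000 in
/-- `Ξ_n(m)` and `Ξ_n` lie in `ℤ[ζ_{2^n}]`, and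
`Ξ_n(m) ≡ (a(p) − ψ_n(p) − ψ_n(p)⁻¹)·(a(q) − ψ_n(q) − ψ_n(q)⁻¹)·Ξ_n (mod 2ℤ[ζ_{2^n}])`. -/
theorem twisted_specialization_congruence
    (N : ℕ) (hN : Odd N)
    (a : ℕ → ℤ) (ha1 : a 1 = 1)
    (hamul : ∀ m k : ℕ, Nat.Coprime m k → a (m * k) = a m * a k)
    (S : ℚ → ℚ)
    (hS0 : S 0 = 0) (hSneg : ∀ β : ℚ, S (-β) = S β) (hSper : ∀ β : ℚ, S (β + 1) = S β)
    (hHecke : ∀ ℓ : ℕ, ℓ.Prime → ¬(ℓ ∣ N) → ∀ β : ℚ, Nat.Coprime β.den N →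
      ∑ x ∈ Finset.range ℓ, S ((β + (x : ℚ)) / (ℓ : ℚ)) =
        (a ℓ : ℚ) * S β - S ((ℓ : ℚ) * β) + ∑ x ∈ Finset.range ℓ, S ((x : ℚ) / (ℓ : ℚ)))
    (ha2 : a 2 = 0)
    (hhalf : ∀ β : ℚ, ∃ c : ℤ, S β = (c : ℚ) / 2)
    (p q : ℕ) (hp : p.Prime) (hq : q.Prime) (hpq : p ≠ q)
    (hpN : ¬(p ∣ N)) (hqN : ¬(q ∣ N))
    (hp12 : p % 12 = 7) (hq12 : q % 12 = 7)
    (hap : Odd (a p)) (haq : Odd (a q))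
    (n : ℕ) (hn : 1 ≤ n) [NeZero (2 ^ (n + 2) * (p * q))]
    (K : Type*) [Field K] [Algebra ℚ_[2] K]
    (ζ : K) (hζ : IsPrimitiveRoot ζ (2 ^ n))
    (ψ : (ZMod (2 ^ (n + 2)))ˣ →* K)
    (hψneg : ∀ u : (ZMod (2 ^ (n + 2)))ˣ, (u : ZMod (2 ^ (n + 2))) = -1 → ψ u = 1)
    (hψ5 : ∀ u : (ZMod (2 ^ (n + 2)))ˣ, (u : ZMod (2 ^ (n + 2))) = 5 → ψ u = ζ) :
    XiM S n (p * q) ψ ∈ Algebra.adjoin ℤ {ζ} ∧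
      XiN S n ψ ∈ Algebra.adjoin ℤ {ζ} ∧
      ∀ up uq : (ZMod (2 ^ (n + 2)))ˣ,
        (up : ZMod (2 ^ (n + 2))) = (p : ZMod (2 ^ (n + 2))) →
        (uq : ZMod (2 ^ (n + 2))) = (q : ZMod (2 ^ (n + 2))) →
        ∃ d ∈ Algebra.adjoin ℤ {ζ},
          XiM S n (p * q) ψ -
            ((a p : K) - ψ up - (ψ up)⁻¹) * ((a q : K) - ψ uq - (ψ uq)⁻¹) * XiN S n ψ =
              2 * d := by

  classical
  have : CharZero K := charZero_of_injective_algebraMap (algebraMap ℚ_[2] K).injective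
  have hM0 : 0 < (2 ^ (n + 2) : ℕ) := by positivity
  have hNM : NeZero (2 ^ (n + 2) : ℕ) := ⟨hM0.ne'⟩
  have h4M : 4 ∣ (2 ^ (n + 2) : ℕ) := ⟨2 ^ n, by rw [pow_add]; ring⟩
  have hpodd : Odd p := Nat.odd_iff.2 (by omega)
  have hqodd : Odd q := Nat.odd_iff.2 (by omega)
  have hcopM : ∀ x : ℕ, Odd x → x.Coprime (2 ^ (n + 2) : ℕ) := fun x hx =>
    Nat.Coprime.pow_right _ (Nat.coprime_two_right.2 hx)
  have hpM := hcopM p hpodd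
  have hqM := hcopM q hqodd
  set A := Algebra.adjoin ℤ {ζ} with hA
  have hψA : ∀ u, ψ u ∈ A := by
    intro u
    have h1 : ψ u ^ (2 ^ n) = 1 := by rw [← map_pow, aux_odd_pow n hn, map_one]
    have : NeZero (2 ^ n) := ⟨by positivity⟩
    obtain ⟨i, _, hi⟩ := hζ.eq_pow_of_pow_eq_one h1
    rw [← hi]
    have hm : ζ ∈ A := Algebra.subset_adjoin (Set.mem_singleton ζ)
    exact pow_mem hm i
  have hψn : ∀ u, ψ (-u) = ψ u := by
    intro u
    rw [← neg_one_mul, map_mul, hψneg (-1) (by simp), one_mul]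
  have hζ1 : ζ ≠ 1 := hζ.ne_one (Nat.one_lt_two_pow (by omega))
  -- the extension of ψ to ℕ
  let Φ : ℕ → K := fun x => if h : x.Coprime (2 ^ (n + 2) : ℕ) then ψ (ZMod.unitOfCoprime x h) else 0
  have hΦ : ∀ (x : ℕ) (u : (ZMod (2 ^ (n + 2) : ℕ))ˣ), (u : ZMod (2 ^ (n + 2) : ℕ)) = x → Φ x = ψ u := by
    intro x u h
    have hx : x.Coprime (2 ^ (n + 2) : ℕ) := by
      rw [← ZMod.isUnit_iff_coprime, ← h]; exact u.isUnit
    simp only [Φ, dif_pos hx]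
    congr 1
    ext
    simp [h]
  have hΦ0 : ∀ x : ℕ, ¬ x.Coprime (2 ^ (n + 2) : ℕ) → Φ x = 0 := fun x hx => by simp only [Φ, dif_neg hx]
  have hmulΦ : ∀ x y, Φ (x * y) = Φ x * Φ y := by
    intro x y
    by_cases hx : x.Coprime (2 ^ (n + 2) : ℕ)
    · by_cases hy : y.Coprime (2 ^ (n + 2) : ℕ)
      · rw [hΦ x (ZMod.unitOfCoprime x hx) (by simp), hΦ y (ZMod.unitOfCoprime y hy) (by simp),
          hΦ (x * y) (ZMod.unitOfCoprime x hx * ZMod.unitOfCoprime y hy) (by simp), map_mul]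
      · rw [hΦ0 y hy, hΦ0 _ (fun h => hy (Nat.coprime_mul_iff_left.1 h).2), mul_zero]
    · rw [hΦ0 x hx, hΦ0 _ (fun h => hx (Nat.coprime_mul_iff_left.1 h).1), zero_mul]
  have hperΦ : ∀ x y, x ≡ y [MOD (2 ^ (n + 2) : ℕ)] → Φ x = Φ y := by
    intro x y h
    have h' := (ZMod.natCast_eq_natCast_iff _ _ _).2 h
    by_cases hx : x.Coprime (2 ^ (n + 2) : ℕ)
    · rw [hΦ x (ZMod.unitOfCoprime x hx) (by simp), hΦ y (ZMod.unitOfCoprime x hx) (by simp [h'])]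
    · rw [hΦ0 x hx, hΦ0 y]
      rwa [← ZMod.isUnit_iff_coprime, ← h', ZMod.isUnit_iff_coprime]
  have hΦne : ∀ x : ℕ, x.Coprime (2 ^ (n + 2) : ℕ) → Φ x ≠ 0 := by
    intro x hx
    rw [hΦ x (ZMod.unitOfCoprime x hx) (by simp)]
    exact ((Group.isUnit (ZMod.unitOfCoprime x hx)).map ψ).ne_zero
  have hΦ5 : ∀ c : ℕ, c ≡ 5 [MOD (2 ^ (n + 2) : ℕ)] → Φ c ≠ 1 := by
    intro c hc
    have h5 : (5 : ℕ).Coprime (2 ^ (n + 2) : ℕ) := hcopM 5 (by decide)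
    rw [hperΦ c 5 hc, hΦ 5 (ZMod.unitOfCoprime 5 h5) (by simp), hψ5 _ (by simp)]
    exact hζ1
  -- the Hecke steps
  have hden : ∀ (D : ℕ), 0 < D → D.Coprime N → ∀ y : ℕ, Nat.Coprime ((y : ℚ) / D).den N := by
    intro D hL hLN y
    refine Nat.Coprime.coprime_dvd_left ?_ hLN
    have := Rat.den_dvd (y : ℤ) (D : ℤ)
    rw [Rat.divInt_eq_div] at this
    rw [Int.cast_natCast, Int.cast_natCast] at this
    exact Int.natCast_dvd_natCast.1 this
  have hMN : (2 ^ (n + 2) : ℕ).Coprime N := Nat.Coprime.pow_left _ (Nat.coprime_two_left.2 hN)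
  have hstep1 : auxG Φ S ((2 ^ (n + 2) : ℕ) * p) = ((a p : K) - Φ p - (Φ p)⁻¹) * auxG Φ S (2 ^ (n + 2) : ℕ) :=
    aux_key S hSper (2 ^ (n + 2) : ℕ) (2 ^ (n + 2) : ℕ) p hM0 dvd_rfl hp hpM (a p)
      (fun y => hHecke p hp hpN _ (hden (2 ^ (n + 2) : ℕ) hM0 hMN y)) Φ hmulΦ hperΦ (hΦne p hpM) 5
      (hcopM 5 (by decide)) (hΦ5 5 rfl)
  have hMp0 : 0 < (2 ^ (n + 2) : ℕ) * p := Nat.mul_pos hM0 hp.pos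
  obtain ⟨c, hcM, hcp⟩ := Nat.chineseRemainder hpM.symm 5 1
  have hcL : c.Coprime ((2 ^ (n + 2) : ℕ) * p) := by
    refine Nat.Coprime.mul_right ?_ ?_
    · have h5 := hcopM 5 (by decide)
      rw [Nat.Coprime, hcM.gcd_eq]; exact h5
    · rw [Nat.Coprime, hcp.gcd_eq]; simp
  have hstep2 : auxG Φ S ((2 ^ (n + 2) : ℕ) * p * q) = ((a q : K) - Φ q - (Φ q)⁻¹) * auxG Φ S ((2 ^ (n + 2) : ℕ) * p) :=
    aux_key S hSper (2 ^ (n + 2) : ℕ) ((2 ^ (n + 2) : ℕ) * p) q hMp0 (dvd_mul_right _ _) hq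
      (Nat.Coprime.mul_right hqM ((Nat.coprime_primes hq hp).2 hpq.symm)) (a q)
      (fun y => hHecke q hq hqN _ (hden ((2 ^ (n + 2) : ℕ) * p) hMp0
        (Nat.Coprime.mul_left hMN ((hp.coprime_iff_not_dvd).2 hpN)) y)) Φ hmulΦ hperΦ
      (hΦne q hqM) c hcL (hΦ5 c hcM)
  -- identify XiN
  have hXiN : XiN S n ψ = auxG Φ S (2 ^ (n + 2) : ℕ) := by
    unfold XiN auxG
    rw [← aux_units_sum_s17 (2 ^ (n + 2) : ℕ) (fun x => Φ x * (S ((x : ℚ) / ((2 ^ (n + 2) : ℕ) : ℚ)) : K))]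
    refine Finset.sum_congr rfl fun u _ => ?_
    beta_reduce
    rw [hΦ _ u (by simp)]
    simp
  have hL0 : (2 ^ (n + 2) * (p * q) : ℕ) ≠ 0 := NeZero.ne (2 ^ (n + 2) * (p * q) : ℕ)
  let π : (ZMod (2 ^ (n + 2) * (p * q) : ℕ))ˣ →* (ZMod (2 ^ (n + 2) : ℕ))ˣ := 
    Units.map (ZMod.castHom (dvd_mul_right (2 ^ (n + 2) : ℕ) (p * q)) (ZMod (2 ^ (n + 2) : ℕ))).toMonoidHom
  have hπn : ∀ u, π (-u) = - π u := by
    intro u; ext; simp [π]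
  have hG : auxG Φ S (2 ^ (n + 2) * (p * q) : ℕ) = ∑ u : (ZMod (2 ^ (n + 2) * (p * q) : ℕ))ˣ, ψ (π u) * (S (((u : ZMod (2 ^ (n + 2) * (p * q) : ℕ)).val : ℚ) / ((2 ^ (n + 2) * (p * q) : ℕ) : ℚ)) : K) := by
    unfold auxG
    rw [← aux_units_sum_s17 (2 ^ (n + 2) * (p * q) : ℕ) (fun x => Φ x * (S ((x : ℚ) / ((2 ^ (n + 2) * (p * q) : ℕ) : ℚ)) : K))]
    refine Finset.sum_congr rfl fun u _ => ?_
    beta_reduce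
    rw [hΦ _ (π u) (by simp [π])]
  have hSn : ∀ (D : ℕ) [NeZero D] (u : (ZMod D)ˣ), S (((-u : (ZMod D)ˣ) : ZMod D).val / (D : ℚ)) =
      S ((u : ZMod D).val / (D : ℚ)) := by
    intro D _ u
    rw [← hSneg (((u : ZMod D).val : ℚ) / D)]
    have := aux_S_per_s17 S hSper D (NeZero.ne D) (((-u : (ZMod D)ˣ) : ZMod D).val : ℤ)
      (-((u : ZMod D).val : ℤ)) (by
        rw [← ZMod.intCast_eq_intCast_iff]; simp)
    rw [Int.cast_neg, Int.cast_natCast, Int.cast_natCast, neg_div] at this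
    exact this
  have hS2 : ∀ β, (2 : K) * (S β : K) ∈ A := by
    intro β
    obtain ⟨c, hc⟩ := hhalf β
    have : (2 : K) * (S β : K) = (c : K) := by
      rw [hc]; push_cast; field_simp
    rw [this]
    exact intCast_mem A c
  let χ : (ZMod (2 ^ (n + 2) * (p * q) : ℕ))ˣ → ℤ := fun u => jacobiSym ((u : ZMod (2 ^ (n + 2) * (p * q) : ℕ)).val : ℤ) (p * q)
  have hpq4 : (p * q) % 4 = 1 := by
    rw [Nat.mul_mod, show p % 4 = 3 by omega, show q % 4 = 3 by omega]
  have hχn : ∀ u, χ (-u) = χ u := by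
    intro u
    simp only [χ]
    have h1 : ((((-u : (ZMod (2 ^ (n + 2) * (p * q) : ℕ))ˣ) : ZMod (2 ^ (n + 2) * (p * q) : ℕ)).val : ℤ)) ≡ -((u : ZMod (2 ^ (n + 2) * (p * q) : ℕ)).val : ℤ) [ZMOD (p * q : ℕ)] := by
      have : ((((-u : (ZMod (2 ^ (n + 2) * (p * q) : ℕ))ˣ) : ZMod (2 ^ (n + 2) * (p * q) : ℕ)).val : ℤ)) ≡ -((u : ZMod (2 ^ (n + 2) * (p * q) : ℕ)).val : ℤ) [ZMOD ((2 ^ (n + 2) * (p * q) : ℕ) : ℕ)] := by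
        rw [← ZMod.intCast_eq_intCast_iff]; simp
      exact this.of_dvd (by exact_mod_cast dvd_mul_left (p * q) (2 ^ (n + 2) : ℕ))
    rw [jacobiSym.mod_left' h1, jacobiSym.neg _ (hpodd.mul hqodd), ZMod.χ₄_nat_one_mod_four hpq4,
      one_mul]
  have hχodd : ∀ u, ∃ e : ℤ, χ u = 2 * e + 1 := by
    intro u
    have hc : (((u : ZMod (2 ^ (n + 2) * (p * q) : ℕ)).val : ℤ)).gcd ((p * q : ℕ) : ℤ) = 1 := by
      rw [Int.gcd_natCast_natCast]
      exact Nat.Coprime.coprime_dvd_right (dvd_mul_left (p * q) (2 ^ (n + 2) : ℕ)) (ZMod.val_coe_unit_coprime u)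
    rcases jacobiSym.eq_one_or_neg_one hc with h | h
    · exact ⟨0, by simp only [χ, h]; norm_num⟩
    · exact ⟨-1, by simp only [χ, h]; norm_num⟩
  choose e he using hχodd
  have hen : ∀ u, e (-u) = e u := by
    intro u
    have h1 := he u
    have h2 := he (-u)
    rw [hχn] at h2
    omega
  have hXiM : XiM S n (p * q) ψ =
      ∑ u : (ZMod (2 ^ (n + 2) * (p * q) : ℕ))ˣ, (χ u : K) * ψ (π u) * (S (((u : ZMod (2 ^ (n + 2) * (p * q) : ℕ)).val : ℚ) / ((2 ^ (n + 2) * (p * q) : ℕ) : ℚ)) : K) := rfl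
  have h4L : 4 ∣ (2 ^ (n + 2) * (p * q) : ℕ) := h4M.mul_right _
  refine ⟨?_, ?_, ?_⟩
  · rw [hXiM]
    refine aux_even_sum A (2 ^ (n + 2) * (p * q) : ℕ) h4L _ ?_ ?_
    · intro u
      rw [hχn, hπn, hψn, hSn]
    · intro u
      rw [mul_left_comm]
      exact A.mul_mem (A.mul_mem (intCast_mem A _) (hψA _)) (hS2 _)
  · rw [hXiN]
    unfold auxG
    rw [← aux_units_sum_s17 (2 ^ (n + 2) : ℕ) (fun x => Φ x * (S ((x : ℚ) / ((2 ^ (n + 2) : ℕ) : ℚ)) : K))]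
    refine aux_even_sum A (2 ^ (n + 2) : ℕ) h4M _ ?_ ?_
    · intro u
      beta_reduce
      rw [hΦ (u : ZMod (2 ^ (n + 2))).val u (by simp), hΦ _ (-u) (by simp), hψn, hSn]
    · intro u
      beta_reduce
      rw [hΦ _ u (by simp), mul_left_comm]
      exact A.mul_mem (hψA _) (hS2 _)
  · intro up uq hup huq
    refine ⟨∑ u : (ZMod (2 ^ (n + 2) * (p * q) : ℕ))ˣ, (e u : K) * ψ (π u) * (S (((u : ZMod (2 ^ (n + 2) * (p * q) : ℕ)).val : ℚ) / ((2 ^ (n + 2) * (p * q) : ℕ) : ℚ)) : K),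
      ?_, ?_⟩
    · refine aux_even_sum A (2 ^ (n + 2) * (p * q) : ℕ) h4L _ ?_ ?_
      · intro u
        rw [hen, hπn, hψn, hSn]
      · intro u
        rw [mul_left_comm]
        exact A.mul_mem (A.mul_mem (intCast_mem A _) (hψA _)) (hS2 _)
    · have hprod : ((a p : K) - ψ up - (ψ up)⁻¹) * ((a q : K) - ψ uq - (ψ uq)⁻¹) * XiN S n ψ =
          auxG Φ S (2 ^ (n + 2) * (p * q) : ℕ) := by
        rw [hXiN, ← hΦ p up hup, ← hΦ q uq huq, ← mul_assoc (2 ^ (n + 2) : ℕ) p q, hstep2, hstep1]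
        ring
      rw [hprod, hG, hXiM, ← Finset.sum_sub_distrib, Finset.mul_sum]
      refine Finset.sum_congr rfl fun u _ => ?_
      rw [he u]
      push_cast
      ring
end
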